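/- (Sub-flat type metrics.) In the wrapped product setting take d(r)=r^n with n ∈ (2−√2, 4/3]. There exists a constant C_n > 0 such that if R_β(x²,x³) ≥ C_n for all (x²,x³)∈Ω, then for every η₁, η₂ > 0 there is a constant C = C(η₁,η₂,n) > 0 such that for every solution u of the Dirac equation with initial datum u₀ one has ‖⟨r⟩^{−(3/2+η₁)} u‖²_{L²(M_g)} + ‖⟨r⟩^{−(1/2+η₂)} |∇_h u|‖²_{L²(M_g)} ≤ C ‖Hu₀‖²_{L²(M_h)}, where ⟨r⟩=(1+r²)^{1/2}. -/

import Mathlib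

noncomputable section
open MeasureTheory Real Set

abbrev Eu (n : ℕ) : Type := EuclideanSpace ℝ (Fin n)

def pd {n : ℕ} {F : Type*} [NormedAddCommGroup F] [NormedSpace ℝ F]
    (j : Fin n) (f : Eu n → F) (x : Eu n) : F :=
  fderiv ℝ f x (EuclideanSpace.single j 1)

def Chr {n : ℕ} (h : Eu n → Matrix (Fin n) (Fin n) ℝ) (i j k : Fin n) (x : Eu n) : ℝ :=
  (1/2) * ∑ l, (h x)⁻¹ i l *
    (pd j (fun y => h y l k) x + pd k (fun y => h y j l) x - pd l (fun y => h y j k) x)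

def Rscal {n : ℕ} (h : Eu n → Matrix (Fin n) (Fin n) ℝ) (x : Eu n) : ℝ :=
  ∑ j, ∑ k, (h x)⁻¹ j k *
    ((∑ i, pd i (fun y => Chr h i j k y) x) - (∑ i, pd k (fun y => Chr h i j i y) x)
      + (∑ i, ∑ l, Chr h l j k x * Chr h i i l x) - (∑ i, ∑ l, Chr h l j i x * Chr h i k l x))

def sdet {n : ℕ} (h : Eu n → Matrix (Fin n) (Fin n) ℝ) (x : Eu n) : ℝ := Real.sqrt (h x).det

def lapR {n : ℕ} (h : Eu n → Matrix (Fin n) (Fin n) ℝ) (f : Eu n → ℝ) (x : Eu n) : ℝ :=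
  (sdet h x)⁻¹ * ∑ j, pd j (fun y => sdet h y * ∑ k, (h y)⁻¹ j k * pd k f y) x

def lapC {n : ℕ} (h : Eu n → Matrix (Fin n) (Fin n) ℝ) (f : Eu n → ℂ) (x : Eu n) : ℂ :=
  ((sdet h x : ℝ) : ℂ)⁻¹ *
    ∑ j, pd j (fun y => ((sdet h y : ℝ) : ℂ) * ∑ k, (((h y)⁻¹ j k : ℝ) : ℂ) * pd k f y) x

def jap {n : ℕ} (x : Eu n) : ℝ := Real.sqrt (1 + ‖x‖ ^ 2)

def Hop (A : Fin 3 → Eu 3 → Fin 4 → Fin 4 → ℂ) (B : Eu 3 → Fin 4 → Fin 4 → ℂ)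
    (f : Eu 3 → Fin 4 → ℂ) (x : Eu 3) : Fin 4 → ℂ :=
  fun i => (∑ j, ∑ k, A j x i k * pd j f x k) + ∑ k, B x i k * f x k

def Elliptic (h : Eu 3 → Matrix (Fin 3) (Fin 3) ℝ) (ν N : ℝ) : Prop :=
  ∀ x : Eu 3, ∀ ξ : Fin 3 → ℝ,
    ν * (∑ j, ξ j ^ 2) ≤ (∑ j, ∑ k, (h x)⁻¹ j k * ξ j * ξ k) ∧
      (∑ j, ∑ k, (h x)⁻¹ j k * ξ j * ξ k) ≤ N * (∑ j, ξ j ^ 2)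

def opNorm {n : ℕ} (A : Matrix (Fin n) (Fin n) ℝ) : ℝ :=
  ‖LinearMap.toContinuousLinearMap (Matrix.toEuclideanLin A)‖

def pdM {n : ℕ} (j : Fin n) (H : Eu n → Matrix (Fin n) (Fin n) ℝ) (x : Eu n) :
    Matrix (Fin n) (Fin n) ℝ :=
  Matrix.of fun a b => pd j (fun y => H y a b) x

def AFlat (h : Eu 3 → Matrix (Fin 3) (Fin 3) ℝ) (σ CI Ch : ℝ) : Prop :=
  (∀ x : Eu 3, opNorm ((h x)⁻¹ - 1) ≤ CI * jap x ^ (-σ)) ∧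
  (∀ x : Eu 3,
    (∑ j, opNorm (pdM j (fun y => (h y)⁻¹) x))
      + ‖x‖ * (∑ j, ∑ k, opNorm (pdM j (pdM k (fun y => (h y)⁻¹)) x))
      + ‖x‖ ^ 2 * (∑ j, ∑ k, ∑ l, opNorm (pdM j (pdM k (pdM l (fun y => (h y)⁻¹))) x))
    ≤ Ch * jap x ^ (-(1 + σ)))

def sphInt (f : Eu 3 → ℝ) (R : ℝ) : ℝ :=
  R ^ 2 * ∫ ω : Metric.sphere (0 : Eu 3) 1, f (R • (ω : Eu 3)) ∂(volume.toSphere)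

def innC4 (h : Eu 3 → Matrix (Fin 3) (Fin 3) ℝ) (f g : Eu 3 → Fin 4 → ℂ) : ℂ :=
  ∫ x : Eu 3, (∑ i, (starRingEnd ℂ) (f x i) * g x i) * ((sdet h x : ℝ) : ℂ)

/-- Projection of `ℝ³ = ℝ × ℝ²` onto the last two coordinates. -/
def pr32 (x : Eu 3) : Eu 2 := (EuclideanSpace.equiv (Fin 2) ℝ).symm fun i => x i.succ

/-- The wrapped-product manifold `M = (0,∞) × Ω` as a subset of `ℝ³`. -/
def Mset (Ω : Set (Eu 2)) : Set (Eu 3) := {x : Eu 3 | 0 < x 0 ∧ pr32 x ∈ Ω}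

/-- `h` is the wrapped-product metric `dr² + d(r) β` on `M = (0,∞) × Ω`. -/
def WrapMetric (Ω : Set (Eu 2)) (β : Eu 2 → Matrix (Fin 2) (Fin 2) ℝ) (d : ℝ → ℝ)
    (h : Eu 3 → Matrix (Fin 3) (Fin 3) ℝ) : Prop :=
  ∀ x ∈ Mset Ω, h x 0 0 = 1 ∧ (∀ i : Fin 2, h x 0 i.succ = 0 ∧ h x i.succ 0 = 0) ∧
    ∀ i j : Fin 2, h x i.succ j.succ = d (x 0) * β (pr32 x) i j

/-- `Λ^{k,ij} = ½( h^{kl}∂_l h^{ij} − h^{il}∂_l h^{kj} − h^{jl}∂_l h^{ki} )`. -/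
def LamUp (h : Eu 3 → Matrix (Fin 3) (Fin 3) ℝ) (k i j : Fin 3) (x : Eu 3) : ℝ :=
  (1 / 2) * ∑ l, ((h x)⁻¹ k l * pd l (fun y => (h y)⁻¹ i j) x
      - (h x)⁻¹ i l * pd l (fun y => (h y)⁻¹ k j) x
      - (h x)⁻¹ j l * pd l (fun y => (h y)⁻¹ k i) x)

/-- The inner product `⟨f,g⟩_h = ∫_M (∑ᵢ conj fᵢ gᵢ) √det h` on the wrapped product `M`. -/
def innM (Ω : Set (Eu 2)) (h : Eu 3 → Matrix (Fin 3) (Fin 3) ℝ)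
    (f g : Eu 3 → Fin 4 → ℂ) : ℂ :=
  ∫ x in Mset Ω, (∑ i, (starRingEnd ℂ) (f x i) * g x i) * ((sdet h x : ℝ) : ℂ)

/-- `|∇_h u|² = h^{ij} ∂_i ū ∂_j u` (summed over the `ℂ⁴` components). -/
def gradhSq (h : Eu 3 → Matrix (Fin 3) (Fin 3) ℝ) (u : Eu 3 → Fin 4 → ℂ) (x : Eu 3) : ℝ :=
  ∑ i, ∑ j, (h x)⁻¹ i j *
    ∑ c, ((starRingEnd ℂ) (pd i (fun y => u y c) x) * pd j (fun y => u y c) x).re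

/-! ### Weak evolution equations in a pre-Hilbert space -/

section Evolution

variable {E : Type*} [SeminormedAddCommGroup E] [InnerProductSpace ℂ E]

/-- `u` solves `i ∂ₜ u = ρ(t) H u` when tested against arbitrary vectors. -/
def WeakEvol (H : E →ₗ[ℂ] E) (ρ : ℝ → ℝ) (u : ℝ → E) : Prop :=
  ∀ v t, HasDerivAt (fun s => inner ℂ v (u s))
    (-Complex.I * (ρ t : ℂ) * inner ℂ v (H (u t))) t

theorem hasDerivAt_zero_of_sq_bound {q : ℝ → ℝ} {t K ε : ℝ} (hε : 0 < ε)
    (hq : ∀ s, |s - t| < ε → |q s| ≤ K * |s - t| ^ 2) : HasDerivAt q 0 t := by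
  have hO : q =O[nhds t] fun s => ‖s - t‖ ^ 2 := by
    refine Asymptotics.IsBigO.of_bound K ?_
    filter_upwards [Metric.ball_mem_nhds t hε] with s hs
    rw [Metric.mem_ball, Real.dist_eq] at hs
    simpa using hq s hs
  have := hO.hasFDerivAt (𝕜 := ℝ) (n := 2) (by norm_num)
  simpa using this.hasDerivAt

variable {H : E →ₗ[ℂ] E} {ρ : ℝ → ℝ} {u : ℝ → E}

theorem WeakEvol.map (hu : WeakEvol H ρ u)
    (hH : ∀ x y, inner ℂ (H x) y = inner ℂ x (H y)) : WeakEvol H ρ (fun t => H (u t)) := by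
  intro v t
  have h := hu (H v) t
  rw [hH] at h
  exact h.congr_of_eventuallyEq (Filter.Eventually.of_forall fun s => (hH v (u s)).symm)

theorem WeakEvol.reflect (hu : WeakEvol H ρ u) :
    WeakEvol H (fun t => -ρ (-t)) (fun t => u (-t)) := by
  intro v t
  have := (hu v (-t)).scomp t (hasDerivAt_neg t)
  refine this.congr_deriv ?_
  push_cast
  simp

theorem WeakEvol.norm_sub_le (hu : WeakEvol H ρ u) {a b P B : ℝ} (hab : a ≤ b)
    (hP : ∀ t ∈ Icc a b, |ρ t| ≤ P) (hB : ∀ t ∈ Ico a b, ‖H (u t)‖ ≤ B) :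
    ‖u b - u a‖ ≤ P * B * (b - a) := by
  have hP0 : 0 ≤ P := (abs_nonneg _).trans (hP a ⟨le_rfl, hab⟩)
  set v := u b - u a with hv
  have key := norm_image_sub_le_of_norm_deriv_right_le_segment
    (f := fun s => inner ℂ v (u s)) (C := P * B * ‖v‖) (a := a) (b := b)
    (fun s _ => (hu v s).continuousAt.continuousWithinAt)
    (fun s _ => (hu v s).hasDerivWithinAt) (by
      intro s hs
      rw [norm_mul, norm_mul, norm_neg, Complex.norm_I, one_mul, Complex.norm_real, mul_assoc]
      refine mul_le_mul (hP s ⟨hs.1, hs.2.le⟩) ?_ (norm_nonneg _) hP0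
      rw [mul_comm]
      exact (norm_inner_le_norm _ _).trans
        (mul_le_mul_of_nonneg_left (hB s hs) (norm_nonneg _))) b ⟨hab, le_rfl⟩
  simp only [← inner_sub_right] at key
  rw [← hv, inner_self_eq_norm_sq_to_K] at key
  have h2 : ‖v‖ ^ 2 ≤ P * B * ‖v‖ * (b - a) := by simpa using key
  rcases (norm_nonneg v).eq_or_lt with h0 | h0
  · rw [← h0]
    rcases hab.eq_or_lt with rfl | hlt
    · simp
    · have hB0 : 0 ≤ B := (norm_nonneg _).trans (hB a ⟨le_rfl, hlt⟩)
      have := sub_nonneg.2 hab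
      positivity
  · nlinarith

/-- Local Lipschitz continuity at a time near which `‖H u‖` is bounded. -/
theorem WeakEvol.exists_lipschitz (hu : WeakEvol H ρ u) (hρ : Continuous ρ) {t ε B : ℝ}
    (hε : 0 < ε) (hB : ∀ s, |s - t| < ε → ‖H (u s)‖ ≤ B) :
    ∃ L, 0 ≤ L ∧ ∀ s, |s - t| < ε → ‖u s - u t‖ ≤ L * |s - t| := by
  obtain ⟨P, hP⟩ := (isCompact_Icc (a := t - ε) (b := t + ε)).exists_bound_of_continuousOn
    hρ.continuousOn
  have hP0 : 0 ≤ P := (norm_nonneg _).trans (hP t ⟨by linarith, by linarith⟩)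
  have hB0 : 0 ≤ B := (norm_nonneg _).trans (hB t (by simpa using hε))
  refine ⟨P * B, by positivity, fun s hs => ?_⟩
  have hs' := abs_lt.1 hs
  rcases le_total s t with h | h
  · rw [abs_of_nonpos (by linarith), neg_sub, norm_sub_rev]
    refine hu.norm_sub_le h (fun τ hτ => hP τ ⟨by linarith [hτ.1], by linarith [hτ.2]⟩)
      fun τ hτ => hB τ (abs_lt.2 ⟨by linarith [hτ.1], by linarith [hτ.2]⟩)
  · rw [abs_of_nonneg (by linarith)]
    refine hu.norm_sub_le h (fun τ hτ => hP τ ⟨by linarith [hτ.1], by linarith [hτ.2]⟩)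
      fun τ hτ => hB τ (abs_lt.2 ⟨by linarith [hτ.1], by linarith [hτ.2]⟩)

theorem WeakEvol.hasDerivAt_normSq (hu : WeakEvol H ρ u) (hρ : Continuous ρ)
    (hH : ∀ x y, inner ℂ (H x) y = inner ℂ x (H y)) {t ε B : ℝ}
    (hε : 0 < ε) (hB : ∀ s, |s - t| < ε → ‖H (u s)‖ ≤ B) :
    HasDerivAt (fun s => ‖u s‖ ^ 2) 0 t := by
  obtain ⟨L, hL0, hL⟩ := hu.exists_lipschitz hρ hε hB
  have h1 : HasDerivAt (fun s => ‖u s - u t‖ ^ 2) 0 t := by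
    refine hasDerivAt_zero_of_sq_bound (K := L ^ 2) hε fun s hs => ?_
    rw [abs_of_nonneg (by positivity), ← mul_pow]
    exact pow_le_pow_left₀ (norm_nonneg _) (hL s hs) 2
  have h2 : HasDerivAt (fun s => (inner ℂ (u t) (u s)).re) 0 t := by
    have h3 := Complex.reCLM.hasFDerivAt.comp_hasDerivAt t (hu (u t) t)
    have him : (inner ℂ (u t) (H (u t)) : ℂ).im = 0 := by
      have h4 := inner_conj_symm (𝕜 := ℂ) (u t) (H (u t))
      rw [hH] at h4
      exact Complex.conj_eq_iff_im.1 h4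
    refine h3.congr_deriv ?_
    simp [him]
  have h5 : (fun s => ‖u s‖ ^ 2) = fun s =>
      ‖u s - u t‖ ^ 2 + 2 * (inner ℂ (u t) (u s)).re - ‖u t‖ ^ 2 := by
    funext s
    have := norm_sub_sq (𝕜 := ℂ) (u s) (u t)
    rw [← inner_conj_symm] at this
    rw [RCLike.re_to_complex, Complex.conj_re] at this
    linarith
  rw [h5]
  simpa using (h1.add (h2.const_mul 2)).sub_const (‖u t‖ ^ 2)

theorem WeakEvol.iterate (hu : WeakEvol H ρ u)
    (hH : ∀ x y, inner ℂ (H x) y = inner ℂ x (H y)) (k : ℕ) :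
    WeakEvol H ρ (fun t => (H ^ k) (u t)) := by
  induction k with
  | zero => simpa using hu
  | succ k ih => simpa [pow_succ'] using ih.map hH

/-- The times around which all `‖H ^ k u‖` are bounded. -/
def goodTimes (H : E →ₗ[ℂ] E) (u : ℝ → E) : Set ℝ :=
  {t | ∃ ε > 0, ∀ k : ℕ, ∃ b, ∀ s, |s - t| < ε → ‖(H ^ k) (u s)‖ ≤ b}

theorem isOpen_goodTimes : IsOpen (goodTimes H u) := by
  rw [Metric.isOpen_iff]
  rintro t ⟨ε, hε, h⟩
  refine ⟨ε / 2, by positivity, fun s hs => ⟨ε / 2, by positivity, fun k => ?_⟩⟩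
  obtain ⟨b, hb⟩ := h k
  rw [Metric.mem_ball, Real.dist_eq] at hs
  refine ⟨b, fun τ hτ => hb τ ?_⟩
  have := abs_sub_le τ s t
  linarith

theorem WeakEvol.hasDerivAt_normSq_of_good (hu : WeakEvol H ρ u) (hρ : Continuous ρ)
    (hH : ∀ x y, inner ℂ (H x) y = inner ℂ x (H y)) {t : ℝ} (ht : t ∈ goodTimes H u) (k : ℕ) :
    HasDerivAt (fun s => ‖(H ^ k) (u s)‖ ^ 2) 0 t := by
  obtain ⟨ε, hε, h⟩ := ht
  obtain ⟨b, hb⟩ := h (k + 1)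
  refine (hu.iterate hH k).hasDerivAt_normSq hρ hH hε (B := b) fun s hs => ?_
  simpa [pow_succ'] using hb s hs

theorem WeakEvol.norm_eq_of_good (hu : WeakEvol H ρ u) (hρ : Continuous ρ)
    (hH : ∀ x y, inner ℂ (H x) y = inner ℂ x (H y)) {a b : ℝ} (hab : a ≤ b)
    (hg : Icc a b ⊆ goodTimes H u) (k : ℕ) : ‖(H ^ k) (u b)‖ = ‖(H ^ k) (u a)‖ := by
  have := constant_of_has_deriv_right_zero (f := fun s => ‖(H ^ k) (u s)‖ ^ 2) (a := a) (b := b)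
    (fun s hs => (hu.hasDerivAt_normSq_of_good hρ hH (hg hs) k).continuousAt.continuousWithinAt)
    (fun s hs => (hu.hasDerivAt_normSq_of_good hρ hH
      (hg ⟨hs.1, hs.2.le⟩) k).hasDerivWithinAt) b ⟨hab, le_rfl⟩
  exact (pow_left_inj₀ (norm_nonneg _) (norm_nonneg _) two_ne_zero).1 this

/-- The norms `‖H ^ k u‖` do not drop at the right end of an interval of good times. -/
theorem WeakEvol.norm_le_of_good (hu : WeakEvol H ρ u) (hρ : Continuous ρ)
    (hH : ∀ x y, inner ℂ (H x) y = inner ℂ x (H y)) {a b : ℝ} (hab : a < b)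
    (hg : Ico a b ⊆ goodTimes H u) (k : ℕ) : ‖(H ^ k) (u a)‖ ≤ ‖(H ^ k) (u b)‖ := by
  obtain ⟨P, hP⟩ := (isCompact_Icc (a := a) (b := b)).exists_bound_of_continuousOn
    hρ.continuousOn
  have hconst : ∀ j : ℕ, ∀ t ∈ Ico a b, ‖(H ^ j) (u t)‖ = ‖(H ^ j) (u a)‖ := fun j t ht =>
    hu.norm_eq_of_good hρ hH ht.1 (fun s hs => hg ⟨hs.1, hs.2.trans_lt ht.2⟩) j
  set B := ‖(H ^ (k + 1)) (u a)‖
  have hle : ∀ t ∈ Ico a b, ‖(H ^ k) (u a)‖ ≤ ‖(H ^ k) (u b)‖ + P * B * (b - t) := by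
    intro t ht
    have h1 := (hu.iterate hH k).norm_sub_le ht.2.le (P := P) (B := B)
      (fun s hs => hP s ⟨ht.1.trans hs.1, hs.2⟩) (fun s hs => by
        have := hconst (k + 1) s ⟨ht.1.trans hs.1, hs.2⟩
        exact (congrArg (fun f : E →ₗ[ℂ] E => ‖f (u s)‖) (pow_succ' H k)).ge.trans this.le)
    rw [← hconst k t ht]
    have h2 := norm_sub_norm_le ((H ^ k) (u t)) ((H ^ k) (u b))
    rw [norm_sub_rev] at h2
    linarith
  have hlim : Filter.Tendsto (fun t => ‖(H ^ k) (u b)‖ + P * B * (b - t))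
      (nhdsWithin b (Iio b)) (nhds (‖(H ^ k) (u b)‖ + P * B * (b - b))) := by
    refine Filter.Tendsto.mono_left ?_ nhdsWithin_le_nhds
    exact Continuous.tendsto (by fun_prop) b
  have := ge_of_tendsto hlim (b := ‖(H ^ k) (u a)‖) (by
    filter_upwards [Ioo_mem_nhdsLT hab] with t ht
    exact hle t ⟨ht.1.le, ht.2⟩)
  simpa using this

theorem WeakEvol.norm_le_of_bad_right (hu : WeakEvol H ρ u) (hρ : Continuous ρ)
    (hH : ∀ x y, inner ℂ (H x) y = inner ℂ x (H y)) {t t₀ b : ℝ} (htt : t ≤ t₀)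
    (ht₀ : t₀ ∉ goodTimes H u) (k : ℕ)
    (hb : ∀ s ∈ Icc t t₀, s ∉ goodTimes H u → ‖(H ^ k) (u s)‖ ≤ b) : ‖(H ^ k) (u t)‖ ≤ b := by
  by_cases ht : t ∈ goodTimes H u
  · have hcl : IsCompact (Icc t t₀ ∩ (goodTimes H u)ᶜ) :=
      isCompact_Icc.inter_right isOpen_goodTimes.isClosed_compl
    obtain ⟨e, he, hmin⟩ := hcl.exists_isLeast ⟨t₀, ⟨htt, le_rfl⟩, ht₀⟩
    have hte : t < e := lt_of_le_of_ne he.1.1 fun h => he.2 (h ▸ ht)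
    refine (hu.norm_le_of_good hρ hH hte (fun s hs => ?_) k).trans (hb e he.1 he.2)
    by_contra hs'
    exact absurd (hmin ⟨⟨hs.1, hs.2.le.trans he.1.2⟩, hs'⟩) (not_le.2 hs.2)
  · exact hb t ⟨le_rfl, htt⟩ ht

theorem mem_goodTimes_reflect {t : ℝ} :
    t ∈ goodTimes H (fun s => u (-s)) ↔ -t ∈ goodTimes H u := by
  constructor
  · rintro ⟨ε, hε, h⟩
    refine ⟨ε, hε, fun k => ?_⟩
    obtain ⟨b, hb⟩ := h k
    refine ⟨b, fun s hs => ?_⟩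
    have := hb (-s) (by rwa [← abs_neg, neg_sub, sub_neg_eq_add, add_comm, ← sub_neg_eq_add])
    simpa using this
  · rintro ⟨ε, hε, h⟩
    refine ⟨ε, hε, fun k => ?_⟩
    obtain ⟨b, hb⟩ := h k
    refine ⟨b, fun s hs => hb (-s) ?_⟩
    rwa [← abs_neg, neg_sub, sub_neg_eq_add, neg_add_eq_sub]

/-- If the line is a countable union of closed sets on each of which all `‖H ^ k u‖` are
locally bounded, then every time is good. -/
theorem WeakEvol.mem_goodTimes (hu : WeakEvol H ρ u) (hρ : Continuous ρ)
    (hH : ∀ x y, inner ℂ (H x) y = inner ℂ x (H y)) {S : ℕ → Set ℝ}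
    (hS : ∀ N, IsClosed (S N)) (hSu : ∀ t, ∃ N, t ∈ S N)
    (hb : ∀ N (k : ℕ) (T : ℝ), ∃ b, ∀ t ∈ S N, |t| ≤ T → ‖(H ^ k) (u t)‖ ≤ b) (t : ℝ) :
    t ∈ goodTimes H u := by
  by_contra hbad
  set Z : Set ℝ := (goodTimes H u)ᶜ with hZ
  have hZc : IsClosed Z := isOpen_goodTimes.isClosed_compl
  have : CompleteSpace Z := hZc.completeSpace_coe
  have : Nonempty Z := ⟨⟨t, hbad⟩⟩
  obtain ⟨N, ⟨t₀, ht₀⟩, hN⟩ := nonempty_interior_of_iUnion_of_closed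
    (f := fun N => ((↑) : Z → ℝ) ⁻¹' S N) (fun N => (hS N).preimage continuous_subtype_val)
    (by
      ext s
      simpa using hSu s)
  obtain ⟨ε, hε, hball⟩ := Metric.mem_nhds_iff.1 (mem_interior_iff_mem_nhds.1 hN)
  refine ht₀ ⟨ε, hε, fun k => ?_⟩
  obtain ⟨b, hb⟩ := hb N k (|t₀| + ε)
  have hbZ : ∀ s ∉ goodTimes H u, |s - t₀| < ε → ‖(H ^ k) (u s)‖ ≤ b := by
    intro s hs hst
    refine hb s (hball (show (⟨s, hs⟩ : Z) ∈ Metric.ball ⟨t₀, ht₀⟩ ε from ?_)) ?_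
    · rwa [Metric.mem_ball, Subtype.dist_eq, Real.dist_eq]
    · have := abs_sub_abs_le_abs_sub s t₀
      linarith
  refine ⟨b, fun s hs => ?_⟩
  have hs' := abs_lt.1 hs
  rcases le_total s t₀ with h | h
  · exact hu.norm_le_of_bad_right hρ hH h ht₀ k fun τ hτ hτg =>
      hbZ τ hτg (abs_lt.2 ⟨by linarith [hτ.1], by linarith [hτ.2]⟩)
  · have := hu.reflect.norm_le_of_bad_right (by fun_prop) hH (t := -s) (t₀ := -t₀) (b := b)
      (by linarith) (by rwa [mem_goodTimes_reflect, neg_neg]) k fun τ hτ hτg => by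
        rw [mem_goodTimes_reflect] at hτg
        exact hbZ (-τ) hτg (abs_lt.2 ⟨by linarith [hτ.2], by linarith [hτ.1]⟩)
    simpa using this

/-- Derivative of the virial functional `Re⟪-iHu, Au⟫`. -/
theorem WeakEvol.hasDerivAt_virial (hu : WeakEvol H ρ u) (hρ : Continuous ρ)
    (hH : ∀ x y, inner ℂ (H x) y = inner ℂ x (H y)) {A : E →ₗ[ℂ] E}
    (hA : ∀ x y, inner ℂ (A x) y = -inner ℂ x (A y)) {K : ℝ} (hK : ∀ x, ‖A x‖ ≤ K * ‖H x‖)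
    {t : ℝ} (ht : t ∈ goodTimes H u) :
    HasDerivAt (fun s => (inner ℂ (-Complex.I • H (u s)) (A (u s))).re)
      (-ρ t * (inner ℂ (H (H (u t))) (A (u t))).re) t := by
  obtain ⟨ε, hε, h⟩ := ht
  obtain ⟨B, hB⟩ := h 2
  obtain ⟨L, hL0, hL⟩ := (hu.map hH).exists_lipschitz hρ hε (B := B) (by simpa [pow_two] using hB)
  have hq : HasDerivAt (fun s =>
      (inner ℂ (-Complex.I • H (u s - u t)) (A (u s - u t))).re) 0 t := by
    refine hasDerivAt_zero_of_sq_bound (K := |K| * L ^ 2) hε fun s hs => ?_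
    have h1 : ‖H (u s - u t)‖ ≤ L * |s - t| := by rw [map_sub]; exact hL s hs
    have h2 : ‖A (u s - u t)‖ ≤ |K| * (L * |s - t|) := by
      refine (hK _).trans ((mul_le_mul_of_nonneg_right (le_abs_self K) (norm_nonneg _)).trans ?_)
      exact mul_le_mul_of_nonneg_left h1 (abs_nonneg K)
    refine (Complex.abs_re_le_norm _).trans ((norm_inner_le_norm _ _).trans ?_)
    rw [norm_smul, norm_neg, Complex.norm_I, one_mul]
    calc _ ≤ (L * |s - t|) * (|K| * (L * |s - t|)) :=
          mul_le_mul h1 h2 (norm_nonneg _) (by positivity)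
      _ = _ := by ring
  have h1 := Complex.reCLM.hasFDerivAt.comp_hasDerivAt t
    ((hu (Complex.I • H (A (u t))) t).add (hu (A (Complex.I • H (u t))) t))
  have hsplit : (fun s => (inner ℂ (-Complex.I • H (u s)) (A (u s))).re) = fun s =>
      (inner ℂ (-Complex.I • H (u s - u t)) (A (u s - u t))).re
      + (Complex.reCLM (inner ℂ (Complex.I • H (A (u t))) (u s)
          + inner ℂ (A (Complex.I • H (u t))) (u s))
        - (inner ℂ (-Complex.I • H (u t)) (A (u t))).re) := by
    funext s
    have e1 : (inner ℂ (Complex.I • H (A (u t))) (u s) : ℂ).re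
        = (inner ℂ (-Complex.I • H (u s)) (A (u t))).re := by
      rw [← Complex.conj_re (inner ℂ (-Complex.I • H (u s)) (A (u t))), inner_conj_symm,
        inner_smul_left, inner_smul_right, ← hH]
      simp
    have e2 : inner ℂ (A (Complex.I • H (u t))) (u s)
        = (inner ℂ (-Complex.I • H (u t)) (A (u s)) : ℂ) := by
      rw [hA]
      simp [inner_smul_left]
    rw [Complex.reCLM_apply, Complex.add_re, e1, e2]
    simp only [map_sub, smul_sub, inner_sub_left, inner_sub_right, Complex.sub_re]
    ring
  rw [hsplit]
  have h2 := hq.add (h1.sub_const ((inner ℂ (-Complex.I • H (u t)) (A (u t)) : ℂ).re))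
  refine h2.congr_deriv ?_
  have e3 : (inner ℂ (Complex.I • H (A (u t))) (H (u t)) : ℂ)
      = -Complex.I * inner ℂ (A (u t)) (H (H (u t))) := by
    rw [inner_smul_left, hH]; simp
  have hre : ∀ x y : E, (inner ℂ x y : ℂ).re = (inner ℂ y x : ℂ).re := inner_re_symm (𝕜 := ℂ)
  have e5 : (inner ℂ (A (H (u t))) (H (u t)) : ℂ).re = 0 := by
    have h3 := congrArg Complex.re (hA (H (u t)) (H (u t)))
    rw [Complex.neg_re, hre] at h3
    rw [hre]
    linarith
  have e6 := hre (A (u t)) (H (H (u t)))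
  rw [e3, map_smul, inner_smul_left]
  simp [e5, e6]

end Evolution

/-! ### Calculus of coordinate derivatives -/

section Pd

variable {n : ℕ} {F : Type*} [NormedAddCommGroup F] [NormedSpace ℝ F]

theorem pd_congr {f g : Eu n → F} {x : Eu n} (j : Fin n) (hfg : f =ᶠ[nhds x] g) :
    pd j f x = pd j g x := by
  rw [pd, pd, hfg.fderiv_eq]

theorem pd_congr_on {s : Set (Eu n)} (hs : IsOpen s) {f g : Eu n → F} (hfg : EqOn f g s)
    {x : Eu n} (hx : x ∈ s) (j : Fin n) : pd j f x = pd j g x :=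
  pd_congr j (Filter.eventuallyEq_of_mem (hs.mem_nhds hx) hfg)

@[simp] theorem pd_const (c : F) (j : Fin n) (x : Eu n) : pd j (fun _ => c) x = 0 := by
  simp [pd]

theorem pd_add {f g : Eu n → F} {x : Eu n} (hf : DifferentiableAt ℝ f x)
    (hg : DifferentiableAt ℝ g x) (j : Fin n) :
    pd j (fun y => f y + g y) x = pd j f x + pd j g x := by
  simp [pd, fderiv_fun_add hf hg]

theorem pd_mul {f g : Eu n → ℝ} {x : Eu n} (hf : DifferentiableAt ℝ f x)
    (hg : DifferentiableAt ℝ g x) (j : Fin n) :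
    pd j (fun y => f y * g y) x = pd j f x * g x + f x * pd j g x := by
  simp [pd, fderiv_fun_mul hf hg]
  ring

theorem pd_sum {ι : Type*} (t : Finset ι) {f : ι → Eu n → F} {x : Eu n}
    (hf : ∀ i ∈ t, DifferentiableAt ℝ (f i) x) (j : Fin n) :
    pd j (fun y => ∑ i ∈ t, f i y) x = ∑ i ∈ t, pd j (f i) x := by
  simp [pd, fderiv_fun_sum hf]

theorem pd_clm {G : Type*} [NormedAddCommGroup G] [NormedSpace ℝ G] (L : F →L[ℝ] G)
    {f : Eu n → F} {x : Eu n} (hf : DifferentiableAt ℝ f x) (j : Fin n) :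
    pd j (fun y => L (f y)) x = L (pd j f x) := by
  have := (L.hasFDerivAt.comp x hf.hasFDerivAt).fderiv
  rw [pd, pd]
  change (fderiv ℝ (L ∘ f) x) _ = _
  rw [this]; rfl

theorem pd_contDiffOn {s : Set (Eu n)} (hs : IsOpen s) {f : Eu n → F}
    (hf : ContDiffOn ℝ (⊤ : ℕ∞) f s) (j : Fin n) : ContDiffOn ℝ (⊤ : ℕ∞) (pd j f) s :=
  (hf.fderiv_of_isOpen hs (by simp)).clm_apply contDiffOn_const

end Pd

theorem ContDiffOn.diffAt {E F : Type*} [NormedAddCommGroup E] [NormedSpace ℝ E]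
    [NormedAddCommGroup F] [NormedSpace ℝ F] {s : Set E} {f : E → F}
    (hf : ContDiffOn ℝ (⊤ : ℕ∞) f s) (hs : IsOpen s) {x : E} (hx : x ∈ s) :
    DifferentiableAt ℝ f x :=
  (hf.contDiffAt (hs.mem_nhds hx)).differentiableAt (by simp)

/-- `pr32` as a continuous linear map. -/
def pr32L : Eu 3 →L[ℝ] Eu 2 :=
  (EuclideanSpace.equiv (Fin 2) ℝ).symm.toContinuousLinearMap ∘L
    ContinuousLinearMap.pi fun i => EuclideanSpace.proj i.succ

theorem pr32L_apply (x : Eu 3) : pr32L x = pr32 x := rfl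

theorem continuous_pr32 : Continuous pr32 := pr32L.continuous

theorem pr32_single_zero : pr32 (EuclideanSpace.single 0 1) = 0 := by
  ext i; simp [pr32]

theorem pr32_single_succ (a : Fin 2) :
    pr32 (EuclideanSpace.single a.succ 1) = EuclideanSpace.single a 1 := by
  ext i; simp [pr32]

section PdPull

variable {F : Type*} [NormedAddCommGroup F] [NormedSpace ℝ F] {x : Eu 3}

theorem hasFDerivAt_pr32_comp {g : Eu 2 → F} (hg : DifferentiableAt ℝ g (pr32 x)) :
    HasFDerivAt (fun y => g (pr32 y)) ((fderiv ℝ g (pr32 x)).comp pr32L) x :=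
  HasFDerivAt.comp (g := g) (f := pr32) x hg.hasFDerivAt pr32L.hasFDerivAt

theorem pd_zero_pr32 {g : Eu 2 → F} (hg : DifferentiableAt ℝ g (pr32 x)) :
    pd 0 (fun y => g (pr32 y)) x = 0 := by
  rw [pd, (hasFDerivAt_pr32_comp hg).fderiv]
  simp [pr32L_apply, pr32_single_zero]

theorem pd_succ_pr32 {g : Eu 2 → F} (hg : DifferentiableAt ℝ g (pr32 x)) (a : Fin 2) :
    pd a.succ (fun y => g (pr32 y)) x = pd a g (pr32 x) := by
  rw [pd, (hasFDerivAt_pr32_comp hg).fderiv]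
  rw [ContinuousLinearMap.comp_apply, pr32L_apply]
  exact congrArg _ (pr32_single_succ a)

theorem hasFDerivAt_radial {k : ℝ → ℝ} {k' : ℝ} (hk : HasDerivAt k k' (x 0)) :
    HasFDerivAt (fun y : Eu 3 => k (y 0))
      (k' • (EuclideanSpace.proj 0 : Eu 3 →L[ℝ] ℝ)) x :=
  hk.comp_hasFDerivAt x (EuclideanSpace.proj 0 : Eu 3 →L[ℝ] ℝ).hasFDerivAt

theorem pd_zero_radial {k : ℝ → ℝ} {k' : ℝ} (hk : HasDerivAt k k' (x 0)) :
    pd 0 (fun y : Eu 3 => k (y 0)) x = k' := by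
  rw [pd, (hasFDerivAt_radial hk).fderiv]
  simp

theorem pd_succ_radial {k : ℝ → ℝ} {k' : ℝ} (hk : HasDerivAt k k' (x 0)) (a : Fin 2) :
    pd a.succ (fun y : Eu 3 => k (y 0)) x = 0 := by
  rw [pd, (hasFDerivAt_radial hk).fderiv]
  simp [(Fin.succ_ne_zero a).symm]

end PdPull

/-! ### Smoothness of the curvature -/

theorem contDiffOn_det {m n : ℕ} {s : Set (Eu n)} {β : Eu n → Matrix (Fin m) (Fin m) ℝ}
    (hβ : ∀ i j, ContDiffOn ℝ (⊤ : ℕ∞) (fun y => β y i j) s) :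
    ContDiffOn ℝ (⊤ : ℕ∞) (fun y => (β y).det) s := by
  simp only [Matrix.det_apply]
  exact ContDiffOn.sum fun σ _ => (contDiffOn_prod fun i _ => hβ _ _).const_smul _

theorem contDiffOn_inv_two {s : Set (Eu 2)} {β : Eu 2 → Matrix (Fin 2) (Fin 2) ℝ}
    (hβ : ∀ i j, ContDiffOn ℝ (⊤ : ℕ∞) (fun y => β y i j) s) (hp : ∀ y ∈ s, (β y).PosDef)
    (i j : Fin 2) : ContDiffOn ℝ (⊤ : ℕ∞) (fun y => (β y)⁻¹ i j) s := by
  have h1 : ContDiffOn ℝ (⊤ : ℕ∞) (fun y => (β y).adjugate i j) s := by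
    fin_cases i <;> fin_cases j <;> simp [Matrix.adjugate_fin_two]
    · exact hβ 1 1
    · exact (hβ 0 1).neg
    · exact (hβ 1 0).neg
    · exact hβ 0 0
  refine (((contDiffOn_det hβ).inv fun y hy => (hp y hy).det_pos.ne').mul h1).congr fun y _ => ?_
  simp [Matrix.inv_def]

theorem contDiffOn_Chr {s : Set (Eu 2)} (hs : IsOpen s) {β : Eu 2 → Matrix (Fin 2) (Fin 2) ℝ}
    (hβ : ∀ i j, ContDiffOn ℝ (⊤ : ℕ∞) (fun y => β y i j) s) (hp : ∀ y ∈ s, (β y).PosDef)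
    (i j k : Fin 2) : ContDiffOn ℝ (⊤ : ℕ∞) (Chr β i j k) s := by
  refine contDiffOn_const.mul (ContDiffOn.sum fun l _ => (contDiffOn_inv_two hβ hp i l).mul ?_)
  exact ((pd_contDiffOn hs (hβ l k) j).add (pd_contDiffOn hs (hβ j l) k)).sub
    (pd_contDiffOn hs (hβ j k) l)

theorem contDiffOn_Rscal {s : Set (Eu 2)} (hs : IsOpen s) {β : Eu 2 → Matrix (Fin 2) (Fin 2) ℝ}
    (hβ : ∀ i j, ContDiffOn ℝ (⊤ : ℕ∞) (fun y => β y i j) s) (hp : ∀ y ∈ s, (β y).PosDef) :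
    ContDiffOn ℝ (⊤ : ℕ∞) (Rscal β) s := by
  have hC := contDiffOn_Chr hs hβ hp
  refine ContDiffOn.sum fun j _ => ContDiffOn.sum fun k _ => (contDiffOn_inv_two hβ hp j k).mul ?_
  refine ContDiffOn.sub (ContDiffOn.add (ContDiffOn.sub ?_ ?_) ?_) ?_
  · exact ContDiffOn.sum fun i _ => pd_contDiffOn hs (hC i j k) i
  · exact ContDiffOn.sum fun i _ => pd_contDiffOn hs (hC i j i) k
  · exact ContDiffOn.sum fun i _ => ContDiffOn.sum fun l _ => (hC l j k).mul (hC i i l)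
  · exact ContDiffOn.sum fun i _ => ContDiffOn.sum fun l _ => (hC l j i).mul (hC i k l)

/-! ### Wrapped products with radial factor `r ^ n` -/

/-- The wrapped product metric `dr² + rⁿ β` over an open set with smooth positive `β`. -/
structure PowerWrap (Ω : Set (Eu 2)) (β : Eu 2 → Matrix (Fin 2) (Fin 2) ℝ) (n : ℝ)
    (h : Eu 3 → Matrix (Fin 3) (Fin 3) ℝ) : Prop where
  isOpen : IsOpen Ω
  smooth : ∀ i j : Fin 2, ContDiffOn ℝ (⊤ : ℕ∞) (fun y => β y i j) Ω
  symm : ∀ y ∈ Ω, (β y).IsSymm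
  posDef : ∀ y ∈ Ω, (β y).PosDef
  wrap : WrapMetric Ω β (fun r => r ^ n) h

theorem isOpen_Mset {Ω : Set (Eu 2)} (hΩ : IsOpen Ω) : IsOpen (Mset Ω) :=
  (isOpen_lt continuous_const (EuclideanSpace.proj 0 : Eu 3 →L[ℝ] ℝ).continuous).inter
    (hΩ.preimage continuous_pr32)

/-- The inverse of `dr² + rⁿ β`. -/
def wrapInv (β : Eu 2 → Matrix (Fin 2) (Fin 2) ℝ) (n : ℝ) (x : Eu 3) :
    Matrix (Fin 3) (Fin 3) ℝ :=
  Matrix.of (Fin.cons (Fin.cons 1 0)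
    fun a => Fin.cons 0 fun b => (x 0) ^ (-n) * (β (pr32 x))⁻¹ a b)

section WrapInv

variable {β : Eu 2 → Matrix (Fin 2) (Fin 2) ℝ} {n : ℝ} {x : Eu 3}

@[simp] theorem wrapInv_zero_zero : wrapInv β n x 0 0 = 1 := rfl
@[simp] theorem wrapInv_zero_succ (a : Fin 2) : wrapInv β n x 0 a.succ = 0 := rfl
@[simp] theorem wrapInv_succ_zero (a : Fin 2) : wrapInv β n x a.succ 0 = 0 := rfl
@[simp] theorem wrapInv_succ_succ (a b : Fin 2) :
    wrapInv β n x a.succ b.succ = (x 0) ^ (-n) * (β (pr32 x))⁻¹ a b := rfl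

end WrapInv

theorem contDiffOn_pr32_comp {Ω : Set (Eu 2)} {F : Type*} [NormedAddCommGroup F] [NormedSpace ℝ F] {g : Eu 2 → F}
    (hg : ContDiffOn ℝ (⊤ : ℕ∞) g Ω) : ContDiffOn ℝ (⊤ : ℕ∞) (fun x => g (pr32 x)) (Mset Ω) :=
  hg.comp pr32L.contDiff.contDiffOn fun _ hx => hx.2

theorem contDiffOn_radial {Ω : Set (Eu 2)} {k : ℝ → ℝ} (hk : ContDiffOn ℝ (⊤ : ℕ∞) k (Ioi 0)) :
    ContDiffOn ℝ (⊤ : ℕ∞) (fun x : Eu 3 => k (x 0)) (Mset Ω) :=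
  hk.comp (EuclideanSpace.proj 0 : Eu 3 →L[ℝ] ℝ).contDiff.contDiffOn fun _ hx => hx.1

theorem contDiffOn_rpow (Ω : Set (Eu 2)) (p : ℝ) :
    ContDiffOn ℝ (⊤ : ℕ∞) (fun x : Eu 3 => (x 0) ^ p) (Mset Ω) :=
  contDiffOn_radial (k := fun r => r ^ p)
    (contDiffOn_id.rpow_const_of_ne fun _ hr => ne_of_gt hr)

namespace PowerWrap

variable {Ω : Set (Eu 2)} {β : Eu 2 → Matrix (Fin 2) (Fin 2) ℝ} {n : ℝ}
  {h : Eu 3 → Matrix (Fin 3) (Fin 3) ℝ} {x : Eu 3}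

theorem isOpenM (G : PowerWrap Ω β n h) : IsOpen (Mset Ω) := isOpen_Mset G.isOpen

theorem beta_comm (G : PowerWrap Ω β n h) {y : Eu 2} (hy : y ∈ Ω) (a b : Fin 2) : β y a b = β y b a :=
  (G.symm y hy).apply b a

theorem betaInv_comm (G : PowerWrap Ω β n h) {y : Eu 2} (hy : y ∈ Ω) (a b : Fin 2) : (β y)⁻¹ a b = (β y)⁻¹ b a := by
  have : ((β y)⁻¹).IsSymm := (G.symm y hy).inv
  exact this.apply b a

theorem beta_mul_inv (G : PowerWrap Ω β n h) {y : Eu 2} (hy : y ∈ Ω) : β y * (β y)⁻¹ = 1 :=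
  Matrix.mul_nonsing_inv _ (G.posDef y hy).det_pos.ne'.isUnit

theorem inv_eq (G : PowerWrap Ω β n h) (hx : x ∈ Mset Ω) : (h x)⁻¹ = wrapInv β n x := by
  obtain ⟨h00, h0, hs⟩ := G.wrap x hx
  have hr : (x 0) ^ n * (x 0) ^ (-n) = 1 := by
    rw [← Real.rpow_add hx.1, add_neg_cancel, Real.rpow_zero]
  refine Matrix.inv_eq_right_inv ?_
  ext i j
  rw [Matrix.mul_apply, Fin.sum_univ_succ]
  refine Fin.cases ?_ (fun a => ?_) i <;> refine Fin.cases ?_ (fun b => ?_) j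
  · simp [h00, (h0 _).1]
  · simp [(h0 _).1, (Fin.succ_ne_zero b).symm]
  · simp [(h0 _).2, Fin.succ_ne_zero a]
  · simp only [(h0 _).2, hs, wrapInv_succ_succ, zero_mul, zero_add]
    have h1 := congrFun (congrFun (G.beta_mul_inv hx.2) a) b
    rw [Matrix.mul_apply] at h1
    have h2 : (1 : Matrix (Fin 3) (Fin 3) ℝ) a.succ b.succ = (1 : Matrix (Fin 2) (Fin 2) ℝ) a b := by
      simp [Matrix.one_apply]
    rw [h2, ← h1]
    refine Finset.sum_congr rfl fun c _ => ?_
    linear_combination (β (pr32 x) a c * (β (pr32 x))⁻¹ c b) * hr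

theorem sdet_eq (G : PowerWrap Ω β n h) (hx : x ∈ Mset Ω) : sdet h x = (x 0) ^ n * sdet β (pr32 x) := by
  obtain ⟨h00, h0, hs⟩ := G.wrap x hx
  have e1 : (1 : Fin 3) = Fin.succ 0 := rfl
  have e2 : (2 : Fin 3) = Fin.succ 1 := rfl
  have hd : (h x).det = ((x 0) ^ n) ^ 2 * (β (pr32 x)).det := by
    rw [Matrix.det_fin_three, Matrix.det_fin_two, e1, e2, h00]
    simp only [h0, hs]
    ring
  rw [sdet, sdet, hd, Real.sqrt_mul (by positivity), Real.sqrt_sq (Real.rpow_nonneg hx.1.le _)]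

theorem sdet_beta_pos (G : PowerWrap Ω β n h) {y : Eu 2} (hy : y ∈ Ω) : 0 < sdet β y :=
  Real.sqrt_pos.2 (G.posDef y hy).det_pos

theorem sdet_pos (G : PowerWrap Ω β n h) (hx : x ∈ Mset Ω) : 0 < sdet h x := by
  rw [G.sdet_eq hx]
  exact mul_pos (Real.rpow_pos_of_pos hx.1 _) (G.sdet_beta_pos hx.2)

theorem contDiffOn_sdet_beta (G : PowerWrap Ω β n h) : ContDiffOn ℝ (⊤ : ℕ∞) (sdet β) Ω :=
  (contDiffOn_det G.smooth).sqrt fun y hy => (G.posDef y hy).det_pos.ne'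

theorem contDiffOn_sdet (G : PowerWrap Ω β n h) : ContDiffOn ℝ (⊤ : ℕ∞) (sdet h) (Mset Ω) :=
  ((contDiffOn_rpow Ω n).mul (contDiffOn_pr32_comp G.contDiffOn_sdet_beta)).congr
    fun _ hx => G.sdet_eq hx

theorem contDiffOn_inv (G : PowerWrap Ω β n h) (i j : Fin 3) :
    ContDiffOn ℝ (⊤ : ℕ∞) (fun x => (h x)⁻¹ i j) (Mset Ω) := by
  have h1 : ContDiffOn ℝ (⊤ : ℕ∞) (fun x => wrapInv β n x i j) (Mset Ω) := by
    refine Fin.cases ?_ (fun a => ?_) i <;> refine Fin.cases ?_ (fun b => ?_) j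
    · exact contDiffOn_const
    · exact contDiffOn_const
    · exact contDiffOn_const
    · exact (contDiffOn_rpow Ω (-n)).mul
        (contDiffOn_pr32_comp (contDiffOn_inv_two G.smooth G.posDef a b))
  exact h1.congr fun x hx => by rw [G.inv_eq hx]

end PowerWrap

section PdProd

variable {x : Eu 3} {k : ℝ → ℝ} {k' : ℝ} {g : Eu 2 → ℝ}

theorem pd_zero_mul_pr32 (hk : HasDerivAt k k' (x 0)) (hg : DifferentiableAt ℝ g (pr32 x)) :
    pd 0 (fun y : Eu 3 => k (y 0) * g (pr32 y)) x = k' * g (pr32 x) := by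
  rw [pd_mul (hasFDerivAt_radial hk).differentiableAt (hasFDerivAt_pr32_comp hg).differentiableAt,
    pd_zero_radial hk, pd_zero_pr32 hg, mul_zero, add_zero]

theorem pd_succ_mul_pr32 (hk : HasDerivAt k k' (x 0)) (hg : DifferentiableAt ℝ g (pr32 x))
    (a : Fin 2) :
    pd a.succ (fun y : Eu 3 => k (y 0) * g (pr32 y)) x = k (x 0) * pd a g (pr32 x) := by
  rw [pd_mul (hasFDerivAt_radial hk).differentiableAt (hasFDerivAt_pr32_comp hg).differentiableAt,
    pd_succ_radial hk, pd_succ_pr32 hg, zero_mul, zero_add]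

end PdProd

namespace PowerWrap

variable {Ω : Set (Eu 2)} {β : Eu 2 → Matrix (Fin 2) (Fin 2) ℝ} {n : ℝ}
  {h : Eu 3 → Matrix (Fin 3) (Fin 3) ℝ} {x : Eu 3}

theorem pd_zero_zero (G : PowerWrap Ω β n h) (hx : x ∈ Mset Ω) (j : Fin 3) :
    pd j (fun y => h y 0 0) x = 0 := by
  rw [pd_congr_on G.isOpenM (g := fun _ => (1 : ℝ)) (fun y hy => (G.wrap y hy).1) hx, pd_const]

theorem pd_zero_succ (G : PowerWrap Ω β n h) (hx : x ∈ Mset Ω) (j : Fin 3) (a : Fin 2) :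
    pd j (fun y => h y 0 a.succ) x = 0 := by
  rw [pd_congr_on G.isOpenM (g := fun _ => (0 : ℝ)) (fun y hy => ((G.wrap y hy).2.1 a).1) hx,
    pd_const]

theorem pd_succ_zero (G : PowerWrap Ω β n h) (hx : x ∈ Mset Ω) (j : Fin 3) (a : Fin 2) :
    pd j (fun y => h y a.succ 0) x = 0 := by
  rw [pd_congr_on G.isOpenM (g := fun _ => (0 : ℝ)) (fun y hy => ((G.wrap y hy).2.1 a).2) hx,
    pd_const]

theorem hasDerivAt_rpow' {r : ℝ} (hr : 0 < r) (p : ℝ) :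
    HasDerivAt (fun s : ℝ => s ^ p) (p * r ^ (p - 1)) r := by
  simpa using Real.hasDerivAt_rpow_const (x := r) (p := p) (Or.inl hr.ne')

theorem radial_pd_succ_succ (G : PowerWrap Ω β n h) (hx : x ∈ Mset Ω) (a b : Fin 2) :
    pd 0 (fun y => h y a.succ b.succ) x = n * (x 0) ^ (n - 1) * β (pr32 x) a b := by
  rw [pd_congr_on G.isOpenM (fun y hy => (G.wrap y hy).2.2 a b) hx]
  exact pd_zero_mul_pr32 (hasDerivAt_rpow' hx.1 n) ((G.smooth a b).diffAt G.isOpen hx.2)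

theorem pd_succ_succ (G : PowerWrap Ω β n h) (hx : x ∈ Mset Ω) (a b c : Fin 2) :
    pd c.succ (fun y => h y a.succ b.succ) x
      = (x 0) ^ n * pd c (fun y => β y a b) (pr32 x) := by
  rw [pd_congr_on G.isOpenM (fun y hy => (G.wrap y hy).2.2 a b) hx]
  exact pd_succ_mul_pr32 (hasDerivAt_rpow' hx.1 n) ((G.smooth a b).diffAt G.isOpen hx.2) c

theorem inv_beta_mul (G : PowerWrap Ω β n h) {y : Eu 2} (hy : y ∈ Ω) (a b : Fin 2) :
    ∑ c, (β y)⁻¹ a c * β y c b = if a = b then 1 else 0 := by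
  have h1 : (β y)⁻¹ * β y = 1 := Matrix.nonsing_inv_mul _ (G.posDef y hy).det_pos.ne'.isUnit
  have h2 := congrFun (congrFun h1 a) b
  rwa [Matrix.mul_apply, Matrix.one_apply] at h2

/-! Christoffel symbols -/

theorem Chr_zero_zero_zero (G : PowerWrap Ω β n h) (hx : x ∈ Mset Ω) : Chr h 0 0 0 x = 0 := by
  simp [Chr, Fin.sum_univ_succ (n := 2), G.inv_eq hx, G.pd_zero_zero hx]

theorem Chr_zero_zero_succ (G : PowerWrap Ω β n h) (hx : x ∈ Mset Ω) (a : Fin 2) :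
    Chr h 0 0 a.succ x = 0 := by
  simp [Chr, Fin.sum_univ_succ (n := 2), G.inv_eq hx, G.pd_zero_zero hx, G.pd_zero_succ hx]

theorem Chr_zero_succ_zero (G : PowerWrap Ω β n h) (hx : x ∈ Mset Ω) (a : Fin 2) :
    Chr h 0 a.succ 0 x = 0 := by
  simp [Chr, Fin.sum_univ_succ (n := 2), G.inv_eq hx, G.pd_zero_zero hx, G.pd_succ_zero hx]

theorem Chr_zero_succ_succ (G : PowerWrap Ω β n h) (hx : x ∈ Mset Ω) (a b : Fin 2) :
    Chr h 0 a.succ b.succ x = -(n / 2) * (x 0) ^ (n - 1) * β (pr32 x) a b := by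
  simp only [Chr, Fin.sum_univ_succ (n := 2), G.inv_eq hx, G.pd_zero_succ hx, G.pd_succ_zero hx,
    G.radial_pd_succ_succ hx, wrapInv_zero_zero, wrapInv_zero_succ, zero_mul, Finset.sum_const_zero]
  ring

theorem Chr_succ_zero_zero (G : PowerWrap Ω β n h) (hx : x ∈ Mset Ω) (a : Fin 2) :
    Chr h a.succ 0 0 x = 0 := by
  simp [Chr, Fin.sum_univ_succ (n := 2), G.inv_eq hx, G.pd_zero_zero hx, G.pd_zero_succ hx,
    G.pd_succ_zero hx]

theorem Chr_succ_zero_succ (G : PowerWrap Ω β n h) (hx : x ∈ Mset Ω) (a b : Fin 2) :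
    Chr h a.succ 0 b.succ x = if a = b then n / 2 * (x 0) ^ (-1 : ℝ) else 0 := by
  have hr : (x 0) ^ (-n) * (x 0) ^ (n - 1) = (x 0) ^ (-1 : ℝ) := by
    rw [← Real.rpow_add hx.1]; ring_nf
  have h1 := G.inv_beta_mul hx.2 a b
  simp only [Chr, Fin.sum_univ_succ (n := 2), G.inv_eq hx, G.pd_zero_succ hx, G.pd_zero_zero hx,
    G.radial_pd_succ_succ hx, wrapInv_succ_zero, wrapInv_succ_succ]
  have h2 : ∀ c : Fin 2, (x 0) ^ (-n) * (β (pr32 x))⁻¹ a c *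
      (n * (x 0) ^ (n - 1) * β (pr32 x) c b + 0 - 0)
      = n * (x 0) ^ (-1 : ℝ) * ((β (pr32 x))⁻¹ a c * β (pr32 x) c b) := fun c => by
    linear_combination n * ((β (pr32 x))⁻¹ a c * β (pr32 x) c b) * hr
  rw [Finset.sum_congr rfl fun c _ => h2 c, ← Finset.mul_sum, h1]
  split_ifs <;> ring

theorem Chr_succ_succ_zero (G : PowerWrap Ω β n h) (hx : x ∈ Mset Ω) (a b : Fin 2) :
    Chr h a.succ b.succ 0 x = if a = b then n / 2 * (x 0) ^ (-1 : ℝ) else 0 := by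
  rw [← G.Chr_succ_zero_succ hx]
  simp only [Chr, Fin.sum_univ_succ (n := 2), G.inv_eq hx, G.pd_zero_succ hx, G.pd_succ_zero hx,
    G.pd_zero_zero hx, G.radial_pd_succ_succ hx, wrapInv_succ_zero, wrapInv_succ_succ]
  congr 2
  refine Finset.sum_congr rfl fun c _ => ?_
  rw [G.beta_comm hx.2 b c]
  ring

theorem Chr_succ_succ_succ (G : PowerWrap Ω β n h) (hx : x ∈ Mset Ω) (a b c : Fin 2) :
    Chr h a.succ b.succ c.succ x = Chr β a b c (pr32 x) := by
  have hr : (x 0) ^ (-n) * (x 0) ^ n = 1 := by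
    rw [← Real.rpow_add hx.1, neg_add_cancel, Real.rpow_zero]
  simp only [Chr, Fin.sum_univ_succ (n := 2), G.inv_eq hx, G.pd_succ_succ hx, wrapInv_succ_zero,
    wrapInv_succ_succ, zero_mul, zero_add]
  congr 1
  refine Finset.sum_congr rfl fun l _ => ?_
  linear_combination (β (pr32 x))⁻¹ a l * (pd b (fun y => β y l c) (pr32 x)
    + pd c (fun y => β y b l) (pr32 x) - pd l (fun y => β y b c) (pr32 x)) * hr

/-! Derivatives of the Christoffel symbols -/

theorem pd_Chr_zero_zero_zero (G : PowerWrap Ω β n h) (hx : x ∈ Mset Ω) (j : Fin 3) :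
    pd j (fun y => Chr h 0 0 0 y) x = 0 := by
  rw [pd_congr_on G.isOpenM (g := fun _ => (0 : ℝ)) (fun y hy => G.Chr_zero_zero_zero hy) hx,
    pd_const]

theorem pd_Chr_zero_succ_zero (G : PowerWrap Ω β n h) (hx : x ∈ Mset Ω) (j : Fin 3) (a : Fin 2) :
    pd j (fun y => Chr h 0 a.succ 0 y) x = 0 := by
  rw [pd_congr_on G.isOpenM (g := fun _ => (0 : ℝ)) (fun y hy => G.Chr_zero_succ_zero hy a) hx,
    pd_const]

theorem pd_Chr_succ_zero_zero (G : PowerWrap Ω β n h) (hx : x ∈ Mset Ω) (j : Fin 3) (a : Fin 2) :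
    pd j (fun y => Chr h a.succ 0 0 y) x = 0 := by
  rw [pd_congr_on G.isOpenM (g := fun _ => (0 : ℝ)) (fun y hy => G.Chr_succ_zero_zero hy a) hx,
    pd_const]

theorem radial_pd_Chr_zero_succ_succ (G : PowerWrap Ω β n h) (hx : x ∈ Mset Ω) (a b : Fin 2) :
    pd 0 (fun y => Chr h 0 a.succ b.succ y) x
      = -(n / 2) * ((n - 1) * (x 0) ^ (n - 1 - 1)) * β (pr32 x) a b := by
  rw [pd_congr_on G.isOpenM (fun y hy => G.Chr_zero_succ_succ hy a b) hx]
  exact pd_zero_mul_pr32 (k := fun r => -(n / 2) * r ^ (n - 1))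
    ((hasDerivAt_rpow' hx.1 (n - 1)).const_mul _) ((G.smooth a b).diffAt G.isOpen hx.2)

theorem radial_pd_Chr_succ_zero_succ (G : PowerWrap Ω β n h) (hx : x ∈ Mset Ω) (a : Fin 2) :
    pd 0 (fun y => Chr h a.succ 0 a.succ y) x = n / 2 * (-1 * (x 0) ^ (-1 - 1 : ℝ)) := by
  rw [pd_congr_on G.isOpenM (g := fun y : Eu 3 => n / 2 * (y 0) ^ (-1 : ℝ))
    (fun y hy => by simpa using G.Chr_succ_zero_succ hy a a) hx]
  exact pd_zero_radial ((hasDerivAt_rpow' hx.1 (-1)).const_mul _)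

theorem pd_Chr_succ_succ_succ (G : PowerWrap Ω β n h) (hx : x ∈ Mset Ω) (a b c d : Fin 2) :
    pd d.succ (fun y => Chr h a.succ b.succ c.succ y) x = pd d (Chr β a b c) (pr32 x) := by
  rw [pd_congr_on G.isOpenM (fun y hy => G.Chr_succ_succ_succ hy a b c) hx]
  exact pd_succ_pr32 ((contDiffOn_Chr G.isOpen G.smooth G.posDef a b c).diffAt G.isOpen hx.2) d

/-- The scalar curvature of `dr² + rⁿ β`. -/
theorem Rscal_eq (G : PowerWrap Ω β n h) (hx : x ∈ Mset Ω) :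
    Rscal h x = (x 0) ^ (-n) * Rscal β (pr32 x)
      + n * (2 - 3 / 2 * n) * (x 0) ^ (-2 : ℝ) := by
  have hr2 : (x 0) ^ (-1 : ℝ) * (x 0) ^ (-1 : ℝ) = (x 0) ^ (-2 : ℝ) := by
    rw [← Real.rpow_add hx.1]; norm_num
  have hr3 : (x 0) ^ (n - 1) * (x 0) ^ (-1 : ℝ) = (x 0) ^ (n - 2) := by
    rw [← Real.rpow_add hx.1]; ring_nf
  have hr4 : (x 0) ^ (-n) * (x 0) ^ (n - 1) = (x 0) ^ (-1 : ℝ) := by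
    rw [← Real.rpow_add hx.1]; ring_nf
  have hr5 : n - 1 - 1 = n - 2 := by ring
  have hr6 : (-1 - 1 : ℝ) = -2 := by norm_num
  have t00 := G.inv_beta_mul hx.2 0 0
  have t11 := G.inv_beta_mul hx.2 1 1
  have s10 := G.beta_comm hx.2 1 0
  rw [Rscal, Fin.sum_univ_succ]
  simp only [Fin.sum_univ_succ (n := 2), G.inv_eq hx, wrapInv_zero_zero, wrapInv_zero_succ,
    wrapInv_succ_zero, wrapInv_succ_succ, G.Chr_zero_zero_zero hx, G.Chr_zero_zero_succ hx,
    G.Chr_zero_succ_zero hx, G.Chr_zero_succ_succ hx, G.Chr_succ_zero_zero hx,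
    G.Chr_succ_zero_succ hx, G.Chr_succ_succ_zero hx, G.Chr_succ_succ_succ hx,
    G.pd_Chr_zero_zero_zero hx, G.pd_Chr_zero_succ_zero hx, G.pd_Chr_succ_zero_zero hx,
    G.radial_pd_Chr_zero_succ_succ hx, G.radial_pd_Chr_succ_zero_succ hx,
    G.pd_Chr_succ_succ_succ hx, hr5, hr6]
  rw [Rscal]
  simp only [Fin.sum_univ_two] at t00 t11 ⊢
  simp only [Fin.isValue, if_true, zero_ne_one, one_ne_zero, if_false] at t00 t11 ⊢
  rw [s10] at t00 ⊢
  rw [← hr2, ← hr3]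
  linear_combination -(n / 2) * (n - 1) * (x 0) ^ (-1 : ℝ) *
    (((β (pr32 x))⁻¹ 0 0 * β (pr32 x) 0 0 + (β (pr32 x))⁻¹ 0 1 * β (pr32 x) 0 1
      + (β (pr32 x))⁻¹ 1 0 * β (pr32 x) 0 1 + (β (pr32 x))⁻¹ 1 1 * β (pr32 x) 1 1) * hr4
      + (x 0) ^ (-1 : ℝ) * (t00 + t11))

end PowerWrap

/-! ### Smooth functions compactly supported in an open set -/

/-- `f` is smooth with compact support inside `U`. -/
structure TestFun {n : ℕ} {F : Type*} [NormedAddCommGroup F] [NormedSpace ℝ F]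
    (U : Set (Eu n)) (f : Eu n → F) : Prop where
  smooth : ContDiff ℝ (⊤ : ℕ∞) f
  compact : HasCompactSupport f
  subset : tsupport f ⊆ U

theorem integrable_of_zero_off {n : ℕ} {F : Type*} [NormedAddCommGroup F] {f : Eu n → F} 
    {K : Set (Eu n)} (hK : IsCompact K)
    (hf : ContinuousOn f K) (h0 : ∀ x, x ∉ K → f x = 0) : Integrable f :=
  (integrableOn_iff_integrable_of_support_subset
    (fun x hx => by by_contra hc; exact hx (h0 x hc))).1 (hf.integrableOn_compact hK)

section TestFun

variable {n : ℕ} {F G : Type*} [NormedAddCommGroup F] [NormedSpace ℝ F]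
  [NormedAddCommGroup G] [NormedSpace ℝ G] {U : Set (Eu n)} {f : Eu n → F}

theorem TestFun.of_zero_off (hU : IsOpen U) {K : Set (Eu n)} (hK : IsCompact K) (hKU : K ⊆ U)
    (hf : ContDiffOn ℝ (⊤ : ℕ∞) f U) (h0 : ∀ x, x ∉ K → f x = 0) : TestFun U f := by
  have hs : tsupport f ⊆ K :=
    closure_minimal (fun x hx => by by_contra hc; exact hx (h0 x hc)) hK.isClosed
  refine ⟨?_, hK.of_isClosed_subset (isClosed_tsupport f) hs, hs.trans hKU⟩
  refine contDiff_iff_contDiffAt.2 fun x => ?_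
  by_cases hx : x ∈ U
  · exact hf.contDiffAt (hU.mem_nhds hx)
  · have h1 : Kᶜ ∈ nhds x := hK.isClosed.isOpen_compl.mem_nhds fun h => hx (hKU h)
    exact contDiffAt_const.congr_of_eventuallyEq
      (Filter.eventuallyEq_of_mem h1 fun y hy => h0 y hy)

theorem TestFun.transfer (hf : TestFun U f) (hU : IsOpen U) {g : Eu n → G}
    (hg : ContDiffOn ℝ (⊤ : ℕ∞) g U) (h0 : ∀ x, x ∉ tsupport f → g x = 0) : TestFun U g :=
  .of_zero_off hU hf.compact hf.subset hg h0

theorem TestFun.zero_off (_hf : TestFun U f) {x : Eu n} (hx : x ∉ tsupport f) : f x = 0 :=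
  image_eq_zero_of_notMem_tsupport hx

theorem TestFun.eq_zero (hf : TestFun U f) {x : Eu n} (hx : x ∉ U) : f x = 0 :=
  hf.zero_off fun h => hx (hf.subset h)

theorem TestFun.contDiffOn (hf : TestFun U f) : ContDiffOn ℝ (⊤ : ℕ∞) f U := hf.smooth.contDiffOn

theorem TestFun.diffAt (hf : TestFun U f) (x : Eu n) : DifferentiableAt ℝ f x :=
  hf.smooth.contDiffAt.differentiableAt (by simp)

theorem TestFun.pd_zero_off (_hf : TestFun U f) {x : Eu n} (hx : x ∉ tsupport f) (j : Fin n) :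
    pd j f x = 0 := by
  have h1 : f =ᶠ[nhds x] fun _ => 0 := notMem_tsupport_iff_eventuallyEq.1 hx
  rw [pd_congr j h1, pd_const]

theorem TestFun.pd (hf : TestFun U f) (hU : IsOpen U) (j : Fin n) : TestFun U (pd j f) :=
  hf.transfer hU (pd_contDiffOn hU hf.contDiffOn j) fun _ hx => hf.pd_zero_off hx j

theorem TestFun.clm (hf : TestFun U f) (hU : IsOpen U) (L : F →L[ℝ] G) :
    TestFun U fun x => L (f x) :=
  hf.transfer hU (L.contDiff.comp_contDiffOn hf.contDiffOn) fun x hx => by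
    rw [hf.zero_off hx, map_zero]

theorem TestFun.integrable_mul {f : Eu n → ℝ} (hf : TestFun U f) {s : Eu n → ℝ}
    (hs : ContinuousOn s U) : IntegrableOn (fun x => f x * s x) U :=
  (integrable_of_zero_off hf.compact
    (hf.smooth.continuous.continuousOn.mul (hs.mono hf.subset))
    fun x hx => by simp [hf.zero_off hx]).integrableOn

theorem TestFun.integrable (hf : TestFun U f) : Integrable f :=
  hf.smooth.continuous.integrable_of_hasCompactSupport hf.compact

theorem TestFun.integral_pd {f : Eu n → ℝ} (hf : TestFun U f) (hU : IsOpen U) (j : Fin n) :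
    ∫ x in U, _root_.pd j f x = 0 := by
  have hp := hf.pd hU j
  rw [setIntegral_eq_integral_of_forall_compl_eq_zero fun x hx => hp.eq_zero hx]
  have h1 := integral_mul_fderiv_eq_neg_fderiv_mul_of_integrable (μ := volume) (𝕜 := ℝ)
    (f := fun _ : Eu n => (1 : ℝ)) (g := f) (v := EuclideanSpace.single j 1)
    (by simp) (by simpa [_root_.pd] using! hp.integrable) (by simpa using hf.integrable)
    (fun _ _ => by fun_prop) (fun x _ => hf.diffAt x)
  simpa [_root_.pd] using! h1

end TestFun

namespace PowerWrap

variable {Ω : Set (Eu 2)} {β : Eu 2 → Matrix (Fin 2) (Fin 2) ℝ} {n : ℝ}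
  {h : Eu 3 → Matrix (Fin 3) (Fin 3) ℝ} {x : Eu 3}

theorem pd_zero_sdet (G : PowerWrap Ω β n h) (hx : x ∈ Mset Ω) :
    pd 0 (sdet h) x = n / x 0 * sdet h x := by
  rw [pd_congr_on G.isOpenM (fun y hy => G.sdet_eq hy) hx, G.sdet_eq hx,
    pd_zero_mul_pr32 (hasDerivAt_rpow' hx.1 n) (G.contDiffOn_sdet_beta.diffAt G.isOpen hx.2),
    Real.rpow_sub_one hx.1.ne']
  field_simp

/-- Vanishing of the total radial divergence. -/
theorem integral_radial (G : PowerWrap Ω β n h) {F : Eu 3 → ℝ} (hF : TestFun (Mset Ω) F) :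
    ∫ x in Mset Ω, (pd 0 F x + n / x 0 * F x) * sdet h x = 0 := by
  have hsF : TestFun (Mset Ω) fun x => F x * sdet h x :=
    hF.transfer G.isOpenM (hF.contDiffOn.mul G.contDiffOn_sdet) fun x hx => by
      rw [hF.zero_off hx, zero_mul]
  rw [← hsF.integral_pd G.isOpenM 0]
  refine setIntegral_congr_fun G.isOpenM.measurableSet fun x hx => ?_
  simp only
  rw [pd_mul (hF.diffAt x) (G.contDiffOn_sdet.diffAt G.isOpenM hx), G.pd_zero_sdet hx]
  ring

/-- The bilinear form `h^{ij} ∂ᵢ f ∂ⱼ g`. -/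
def gradInner (h : Eu 3 → Matrix (Fin 3) (Fin 3) ℝ) (f g : Eu 3 → ℝ) (x : Eu 3) : ℝ :=
  ∑ i, ∑ j, (h x)⁻¹ i j * (pd j f x * pd i g x)

theorem contDiffOn_flux (G : PowerWrap Ω β n h) {f : Eu 3 → ℝ}
    (hf : ContDiffOn ℝ (⊤ : ℕ∞) f (Mset Ω)) (j : Fin 3) :
    ContDiffOn ℝ (⊤ : ℕ∞) (fun y => sdet h y * ∑ k, (h y)⁻¹ j k * pd k f y) (Mset Ω) :=
  G.contDiffOn_sdet.mul (ContDiffOn.sum fun k _ =>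
    (G.contDiffOn_inv j k).mul (pd_contDiffOn G.isOpenM hf k))

theorem contDiffOn_lapR (G : PowerWrap Ω β n h) {f : Eu 3 → ℝ}
    (hf : ContDiffOn ℝ (⊤ : ℕ∞) f (Mset Ω)) : ContDiffOn ℝ (⊤ : ℕ∞) (lapR h f) (Mset Ω) :=
  (G.contDiffOn_sdet.inv fun _ hx => (G.sdet_pos hx).ne').mul (ContDiffOn.sum fun j _ =>
    pd_contDiffOn G.isOpenM (G.contDiffOn_flux hf j) j)

theorem contDiffOn_gradInner (G : PowerWrap Ω β n h) {f g : Eu 3 → ℝ}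
    (hf : ContDiffOn ℝ (⊤ : ℕ∞) f (Mset Ω)) (hg : ContDiffOn ℝ (⊤ : ℕ∞) g (Mset Ω)) :
    ContDiffOn ℝ (⊤ : ℕ∞) (gradInner h f g) (Mset Ω) :=
  ContDiffOn.sum fun i _ => ContDiffOn.sum fun j _ => (G.contDiffOn_inv i j).mul
    ((pd_contDiffOn G.isOpenM hf j).mul (pd_contDiffOn G.isOpenM hg i))

/-- Green's identity. -/
theorem integral_lapR_mul (G : PowerWrap Ω β n h) {f g : Eu 3 → ℝ}
    (hf : TestFun (Mset Ω) f) (hg : TestFun (Mset Ω) g) :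
    ∫ x in Mset Ω, (lapR h f x * g x + gradInner h f g x) * sdet h x = 0 := by
  set V : Fin 3 → Eu 3 → ℝ := fun j y => sdet h y * ∑ k, (h y)⁻¹ j k * pd k f y with hV
  have hVs : ∀ j, ContDiffOn ℝ (⊤ : ℕ∞) (V j) (Mset Ω) := G.contDiffOn_flux hf.contDiffOn
  have hW : ∀ j, TestFun (Mset Ω) fun x => V j x * g x := fun j =>
    hg.transfer G.isOpenM ((hVs j).mul hg.contDiffOn) fun x hx => by
      rw [hg.zero_off hx, mul_zero]
  have h1 : ∫ x in Mset Ω, ∑ j, pd j (fun y => V j y * g y) x = 0 := by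
    rw [integral_finsetSum _ fun j _ => ((hW j).pd G.isOpenM j).integrable.integrableOn]
    exact Finset.sum_eq_zero fun j _ => (hW j).integral_pd G.isOpenM j
  rw [← h1]
  refine setIntegral_congr_fun G.isOpenM.measurableSet fun x hx => ?_
  have h2 : ∀ j, pd j (fun y => V j y * g y) x = pd j (V j) x * g x + V j x * pd j g x :=
    fun j => pd_mul ((hVs j).diffAt G.isOpenM hx) (hg.diffAt x) j
  have h3 : lapR h f x * sdet h x = ∑ j, pd j (V j) x := by
    have := (G.sdet_pos hx).ne'
    rw [lapR]
    field_simp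
    rfl
  have h4 : gradInner h f g x * sdet h x = ∑ j, V j x * pd j g x := by
    rw [gradInner, Finset.sum_mul]
    refine Finset.sum_congr rfl fun j _ => ?_
    simp only [hV, Finset.sum_mul, Finset.mul_sum]
    exact Finset.sum_congr rfl fun k _ => by ring
  simp only [h2, Finset.sum_add_distrib, ← Finset.sum_mul, ← h3, ← h4]
  ring

end PowerWrap

theorem pd_comm {n : ℕ} {F : Type*} [NormedAddCommGroup F] [NormedSpace ℝ F] {f : Eu n → F}
    {x : Eu n} (hf : ContDiffAt ℝ (⊤ : ℕ∞) f x) (i j : Fin n) :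
    pd i (pd j f) x = pd j (pd i f) x := by
  have hd : DifferentiableAt ℝ (fderiv ℝ f) x :=
    (hf.fderiv_right (m := 1) (by norm_cast)).differentiableAt (by simp)
  have h1 : ∀ i j : Fin n, pd i (pd j f) x = fderiv ℝ (fderiv ℝ f) x
      (EuclideanSpace.single i 1) (EuclideanSpace.single j 1) := fun i j => by
    rw [pd]
    change fderiv ℝ (fun y => fderiv ℝ f y (EuclideanSpace.single j 1)) x _ = _
    rw [fderiv_clm_apply hd (differentiableAt_const _)]
    simp
  rw [h1, h1]
  exact (hf.isSymmSndFDerivAt (by simp; norm_cast)).eq _ _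

/-- The radial first-order operator `a(r) ∂ᵣ + b(r)`. -/
def radMult {F : Type*} [NormedAddCommGroup F] [NormedSpace ℝ F] (a b : ℝ → ℝ) (f : Eu 3 → F)
    (x : Eu 3) : F :=
  a (x 0) • pd 0 f x + b (x 0) • f x

/-- The angular part of the metric gradient form. -/
def angForm (β : Eu 2 → Matrix (Fin 2) (Fin 2) ℝ) (n : ℝ) (f g : Eu 3 → ℝ) (x : Eu 3) : ℝ :=
  (x 0) ^ (-n) * ∑ a, ∑ b, (β (pr32 x))⁻¹ a b * (pd b.succ f x * pd a.succ g x)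

/-- A smooth radial profile together with its first three derivatives on `(0, ∞)`. -/
structure Profile (a a₁ a₂ a₃ : ℝ → ℝ) : Prop where
  smooth : ContDiffOn ℝ (⊤ : ℕ∞) a (Ioi 0)
  deriv₁ : ∀ r, 0 < r → HasDerivAt a (a₁ r) r
  deriv₂ : ∀ r, 0 < r → HasDerivAt a₁ (a₂ r) r
  deriv₃ : ∀ r, 0 < r → HasDerivAt a₂ (a₃ r) r

theorem contDiffOn_of_hasDerivAt {a a₁ : ℝ → ℝ} (ha : ContDiffOn ℝ (⊤ : ℕ∞) a (Ioi 0))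
    (hd : ∀ r, 0 < r → HasDerivAt a (a₁ r) r) : ContDiffOn ℝ (⊤ : ℕ∞) a₁ (Ioi 0) :=
  (ha.deriv_of_isOpen isOpen_Ioi (m := (⊤ : ℕ∞)) (by simp)).congr fun r hr => (hd r hr).deriv.symm

/-- The zeroth-order coefficient making `a ∂ᵣ + b` antisymmetric. -/
def multB (n : ℝ) (a a₁ : ℝ → ℝ) (r : ℝ) : ℝ := (a₁ r + n * a r / r) / 2

namespace Profile

variable {a a₁ a₂ a₃ : ℝ → ℝ}

theorem smooth₁ (P : Profile a a₁ a₂ a₃) : ContDiffOn ℝ (⊤ : ℕ∞) a₁ (Ioi 0) :=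
  contDiffOn_of_hasDerivAt P.smooth P.deriv₁

theorem smooth₂ (P : Profile a a₁ a₂ a₃) : ContDiffOn ℝ (⊤ : ℕ∞) a₂ (Ioi 0) :=
  contDiffOn_of_hasDerivAt P.smooth₁ P.deriv₂

theorem smooth₃ (P : Profile a a₁ a₂ a₃) : ContDiffOn ℝ (⊤ : ℕ∞) a₃ (Ioi 0) :=
  contDiffOn_of_hasDerivAt P.smooth₂ P.deriv₃

theorem smooth_multB (P : Profile a a₁ a₂ a₃) (n : ℝ) :
    ContDiffOn ℝ (⊤ : ℕ∞) (multB n a a₁) (Ioi 0) :=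
  ((P.smooth₁.add ((contDiffOn_const.mul P.smooth).div contDiffOn_id
    fun _ hr => ne_of_gt hr)).div_const 2)

theorem multB_deriv (P : Profile a a₁ a₂ a₃) (n : ℝ) {r : ℝ} (hr : 0 < r) :
    HasDerivAt (multB n a a₁) ((a₂ r + (n * a₁ r * r - n * a r) / r ^ 2) / 2) r := by
  have h1 := ((P.deriv₂ r hr).add
    (((P.deriv₁ r hr).const_mul n).div (hasDerivAt_id r) hr.ne')).div_const 2
  simpa using! h1

end Profile

namespace PowerWrap

variable {Ω : Set (Eu 2)} {β : Eu 2 → Matrix (Fin 2) (Fin 2) ℝ} {n : ℝ}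
  {h : Eu 3 → Matrix (Fin 3) (Fin 3) ℝ} {x : Eu 3} {f g : Eu 3 → ℝ}

theorem gradInner_eq (G : PowerWrap Ω β n h) (hx : x ∈ Mset Ω) (f g : Eu 3 → ℝ) :
    gradInner h f g x = pd 0 f x * pd 0 g x + angForm β n f g x := by
  simp only [gradInner, angForm, Fin.sum_univ_succ (n := 2), G.inv_eq hx, wrapInv_zero_zero,
    wrapInv_zero_succ, wrapInv_succ_zero, wrapInv_succ_succ, zero_mul, Finset.sum_const_zero,
    Finset.mul_sum, one_mul, add_zero, zero_add, mul_assoc]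

theorem angForm_self_nonneg (G : PowerWrap Ω β n h) (hx : x ∈ Mset Ω) (f : Eu 3 → ℝ) :
    0 ≤ angForm β n f f x := by
  refine mul_nonneg (Real.rpow_nonneg hx.1.le _) ?_
  have h1 := (G.posDef _ hx.2).inv.posSemidef.dotProduct_mulVec_nonneg fun a => pd a.succ f x
  refine h1.trans_eq ?_
  simp only [dotProduct, Matrix.mulVec, Finset.mul_sum]
  refine Finset.sum_congr rfl fun a _ => Finset.sum_congr rfl fun b _ => ?_
  simp
  ring

theorem contDiffOn_angForm (G : PowerWrap Ω β n h)
    (hf : ContDiffOn ℝ (⊤ : ℕ∞) f (Mset Ω)) (hg : ContDiffOn ℝ (⊤ : ℕ∞) g (Mset Ω)) :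
    ContDiffOn ℝ (⊤ : ℕ∞) (angForm β n f g) (Mset Ω) :=
  (contDiffOn_rpow Ω (-n)).mul <| ContDiffOn.sum fun a _ => ContDiffOn.sum fun b _ =>
    (contDiffOn_pr32_comp (contDiffOn_inv_two G.smooth G.posDef a b)).mul
      ((pd_contDiffOn G.isOpenM hf _).mul (pd_contDiffOn G.isOpenM hg _))

theorem pd_zero_angForm (G : PowerWrap Ω β n h) (hf : ContDiffOn ℝ (⊤ : ℕ∞) f (Mset Ω))
    (hx : x ∈ Mset Ω) :
    pd 0 (angForm β n f f) x = 2 * angForm β n f (pd 0 f) x - n / x 0 * angForm β n f f x := by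
  have hfa := hf.contDiffAt (G.isOpenM.mem_nhds hx)
  have hp : ∀ j, DifferentiableAt ℝ (pd j f) x := fun j =>
    (pd_contDiffOn G.isOpenM hf j).diffAt G.isOpenM hx
  have hb : ∀ a b, DifferentiableAt ℝ (fun y => (β y)⁻¹ a b) (pr32 x) := fun a b =>
    (contDiffOn_inv_two G.smooth G.posDef a b).diffAt G.isOpen hx.2
  have hb' : ∀ a b, DifferentiableAt ℝ (fun y => (β (pr32 y))⁻¹ a b) x := fun a b =>
    (hasFDerivAt_pr32_comp (hb a b)).differentiableAt
  have ht : ∀ a b, DifferentiableAt ℝ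
      (fun y => (β (pr32 y))⁻¹ a b * (pd b.succ f y * pd a.succ f y)) x := fun a b =>
    (hb' a b).fun_mul ((hp _).fun_mul (hp _))
  have hr := hasDerivAt_rpow' hx.1 (-n)
  have h1 : ∀ a b : Fin 2, pd 0 (fun y => (β (pr32 y))⁻¹ a b * (pd b.succ f y * pd a.succ f y)) x
      = (β (pr32 x))⁻¹ a b * (pd b.succ (pd 0 f) x * pd a.succ f x
        + pd b.succ f x * pd a.succ (pd 0 f) x) := fun a b => by
    rw [pd_mul (hb' a b) ((hp _).fun_mul (hp _)), pd_zero_pr32 (hb a b), pd_mul (hp _) (hp _),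
      pd_comm hfa 0, pd_comm hfa 0]
    ring
  have h2 : pd 0 (angForm β n f f) x = -n * (x 0) ^ (-n - 1) *
      (∑ a, ∑ b, (β (pr32 x))⁻¹ a b * (pd b.succ f x * pd a.succ f x))
      + (x 0) ^ (-n) * ∑ a, ∑ b, (β (pr32 x))⁻¹ a b * (pd b.succ (pd 0 f) x * pd a.succ f x
        + pd b.succ f x * pd a.succ (pd 0 f) x) := by
    change pd 0 (fun y => (y 0) ^ (-n) * ∑ a, ∑ b : Fin 2,
      (β (pr32 y))⁻¹ a b * (pd b.succ f y * pd a.succ f y)) x = _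
    rw [pd_mul (hasFDerivAt_radial hr).differentiableAt
        (DifferentiableAt.fun_sum fun a _ => DifferentiableAt.fun_sum fun b _ => ht a b),
      pd_zero_radial hr, pd_sum _ fun a _ => DifferentiableAt.fun_sum fun b _ => ht a b]
    congr 2
    refine Finset.sum_congr rfl fun a _ => ?_
    rw [pd_sum _ fun b _ => ht a b]
    exact Finset.sum_congr rfl fun b _ => h1 a b
  rw [h2, Real.rpow_sub_one hx.1.ne', angForm, angForm]
  simp only [Fin.sum_univ_two]
  rw [G.betaInv_comm hx.2 1 0]
  ring

theorem pd_zero_radMult {a b : ℝ → ℝ} {a' b' : ℝ} (ha : HasDerivAt a a' (x 0))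
    (hb : HasDerivAt b b' (x 0)) (hf : DifferentiableAt ℝ f x)
    (hf0 : DifferentiableAt ℝ (pd 0 f) x) :
    pd 0 (radMult a b f) x = a' * pd 0 f x + a (x 0) * pd 0 (pd 0 f) x
      + (b' * f x + b (x 0) * pd 0 f x) := by
  change pd 0 (fun y : Eu 3 => a (y 0) * pd 0 f y + b (y 0) * f y) x = _
  rw [pd_add ((hasFDerivAt_radial ha).differentiableAt.fun_mul hf0)
    ((hasFDerivAt_radial hb).differentiableAt.fun_mul hf),
    pd_mul (hasFDerivAt_radial ha).differentiableAt hf0,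
    pd_mul (hasFDerivAt_radial hb).differentiableAt hf, pd_zero_radial ha, pd_zero_radial hb]

theorem pd_succ_radMult {a b : ℝ → ℝ} {a' b' : ℝ} (ha : HasDerivAt a a' (x 0))
    (hb : HasDerivAt b b' (x 0)) (hf : DifferentiableAt ℝ f x)
    (hf0 : DifferentiableAt ℝ (pd 0 f) x) (c : Fin 2) :
    pd c.succ (radMult a b f) x = a (x 0) * pd c.succ (pd 0 f) x + b (x 0) * pd c.succ f x := by
  change pd c.succ (fun y : Eu 3 => a (y 0) * pd 0 f y + b (y 0) * f y) x = _
  rw [pd_add ((hasFDerivAt_radial ha).differentiableAt.fun_mul hf0)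
    ((hasFDerivAt_radial hb).differentiableAt.fun_mul hf),
    pd_mul (hasFDerivAt_radial ha).differentiableAt hf0,
    pd_mul (hasFDerivAt_radial hb).differentiableAt hf, pd_succ_radial ha, pd_succ_radial hb]
  ring

theorem contDiffOn_radMult {F : Type*} [NormedAddCommGroup F] [NormedSpace ℝ F] {f : Eu 3 → F}
    (G : PowerWrap Ω β n h) {a b : ℝ → ℝ}
    (ha : ContDiffOn ℝ (⊤ : ℕ∞) a (Ioi 0)) (hb : ContDiffOn ℝ (⊤ : ℕ∞) b (Ioi 0))
    (hf : ContDiffOn ℝ (⊤ : ℕ∞) f (Mset Ω)) :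
    ContDiffOn ℝ (⊤ : ℕ∞) (radMult a b f) (Mset Ω) :=
  ((contDiffOn_radial ha).smul (pd_contDiffOn G.isOpenM hf 0)).add
    ((contDiffOn_radial hb).smul hf)

theorem testFun_radMult {F : Type*} [NormedAddCommGroup F] [NormedSpace ℝ F] {f : Eu 3 → F}
    (G : PowerWrap Ω β n h) {a b : ℝ → ℝ}
    (ha : ContDiffOn ℝ (⊤ : ℕ∞) a (Ioi 0)) (hb : ContDiffOn ℝ (⊤ : ℕ∞) b (Ioi 0))
    (hf : TestFun (Mset Ω) f) : TestFun (Mset Ω) (radMult a b f) :=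
  hf.transfer G.isOpenM (G.contDiffOn_radMult ha hb hf.contDiffOn) fun x hx => by
    rw [radMult, hf.pd_zero_off hx, hf.zero_off hx, smul_zero, smul_zero, add_zero]

theorem gradInner_radMult (G : PowerWrap Ω β n h) (hx : x ∈ Mset Ω) {a b : ℝ → ℝ} {a' b' : ℝ}
    (ha : HasDerivAt a a' (x 0)) (hb : HasDerivAt b b' (x 0))
    (hf : ContDiffOn ℝ (⊤ : ℕ∞) f (Mset Ω)) :
    gradInner h f (radMult a b f) x =
      pd 0 f x * (a' * pd 0 f x + a (x 0) * pd 0 (pd 0 f) x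
        + (b' * f x + b (x 0) * pd 0 f x))
      + a (x 0) * angForm β n f (pd 0 f) x + b (x 0) * angForm β n f f x := by
  have hd := hf.diffAt G.isOpenM hx
  have hd0 := (pd_contDiffOn G.isOpenM hf 0).diffAt G.isOpenM hx
  have h1 : angForm β n f (radMult a b f) x
      = a (x 0) * angForm β n f (pd 0 f) x + b (x 0) * angForm β n f f x := by
    simp only [angForm, pd_succ_radMult ha hb hd hd0, Fin.sum_univ_two]
    ring
  rw [G.gradInner_eq hx, pd_zero_radMult ha hb hd hd0, h1]
  ring

theorem contDiffOn_Rscal (G : PowerWrap Ω β n h) :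
    ContDiffOn ℝ (⊤ : ℕ∞) (Rscal h) (Mset Ω) :=
  (((contDiffOn_rpow Ω (-n)).mul (contDiffOn_pr32_comp
      (_root_.contDiffOn_Rscal G.isOpen G.smooth G.posDef))).add
    (contDiffOn_const.mul (contDiffOn_rpow Ω (-2)))).congr fun _ hx => G.Rscal_eq hx

theorem pd_zero_Rscal (G : PowerWrap Ω β n h) (hx : x ∈ Mset Ω) :
    pd 0 (Rscal h) x = -(n / x 0) * ((x 0) ^ (-n) * Rscal β (pr32 x))
      - 2 * (n * (2 - 3 / 2 * n)) / x 0 ^ 3 := by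
  have hR := (_root_.contDiffOn_Rscal G.isOpen G.smooth G.posDef).diffAt G.isOpen hx.2
  have h1 := hasDerivAt_rpow' hx.1 (-n)
  have h2 := (hasDerivAt_rpow' hx.1 (-2)).const_mul (n * (2 - 3 / 2 * n))
  rw [pd_congr_on G.isOpenM (fun y hy => G.Rscal_eq hy) hx,
    pd_add ((hasFDerivAt_radial h1).differentiableAt.fun_mul
      (hasFDerivAt_pr32_comp hR).differentiableAt) (hasFDerivAt_radial h2).differentiableAt,
    pd_zero_mul_pr32 h1 hR, pd_zero_radial h2, Real.rpow_sub_one hx.1.ne']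
  have h3 : (x 0) ^ (-2 - 1 : ℝ) = (x 0 ^ 3)⁻¹ := by
    rw [← Real.rpow_natCast, ← Real.rpow_neg hx.1.le]; norm_num
  rw [h3]
  ring

end PowerWrap

/-- The zeroth-order weight in the virial identity for `a ∂ᵣ + b`. -/
def virialPot (β : Eu 2 → Matrix (Fin 2) (Fin 2) ℝ) (n : ℝ) (a a₁ a₂ a₃ : ℝ → ℝ) (x : Eu 3) : ℝ :=
  -(a₃ (x 0) + 2 * n * a₂ (x 0) / x 0 + (n ^ 2 - 2 * n) * a₁ (x 0) / x 0 ^ 2) / 4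
    - n ^ 2 / 8 * a (x 0) / x 0 ^ 3
    + n / 8 * a (x 0) / x 0 * ((x 0) ^ (-n) * Rscal β (pr32 x))

/-- The operator `m² - Δ_h + ¼ R_h` on real functions. -/
def lichR (h : Eu 3 → Matrix (Fin 3) (Fin 3) ℝ) (m : ℝ) (f : Eu 3 → ℝ) (x : Eu 3) : ℝ :=
  m ^ 2 * f x - lapR h f x + Rscal h x / 4 * f x

theorem hasDerivAt_div_id {k : ℝ → ℝ} {k' r : ℝ} (hk : HasDerivAt k k' r) (hr : r ≠ 0) :
    HasDerivAt (fun s => k s / s) (k' / r - k r / r ^ 2) r := by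
  refine (hk.fun_div (hasDerivAt_id r) hr).congr_deriv ?_
  simp only [id]
  field_simp

namespace PowerWrap

variable {Ω : Set (Eu 2)} {β : Eu 2 → Matrix (Fin 2) (Fin 2) ℝ} {n : ℝ}
  {h : Eu 3 → Matrix (Fin 3) (Fin 3) ℝ} {x : Eu 3} {f g : Eu 3 → ℝ} {a a₁ a₂ a₃ : ℝ → ℝ}

theorem integrableOn (G : PowerWrap Ω β n h) (hf : TestFun (Mset Ω) f) {q : Eu 3 → ℝ}
    (hq : ContDiffOn ℝ (⊤ : ℕ∞) q (Mset Ω)) (h0 : ∀ x, x ∉ tsupport f → q x = 0) :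
    IntegrableOn (fun x => q x * sdet h x) (Mset Ω) :=
  (hf.transfer G.isOpenM hq h0).integrable_mul G.contDiffOn_sdet.continuousOn

theorem angForm_zero_off {U : Set (Eu 3)} (hf : TestFun U f) (hx : x ∉ tsupport f) :
    angForm β n f g x = 0 := by
  simp [angForm, hf.pd_zero_off hx]

/-- Differences of integrands by a total radial divergence do not change integrals. -/
theorem integral_eq_of_radial (G : PowerWrap Ω β n h) {F p q : Eu 3 → ℝ}
    (hF : TestFun (Mset Ω) F) (hq : IntegrableOn (fun x => q x * sdet h x) (Mset Ω))
    (hpq : ∀ x ∈ Mset Ω, p x = q x + (pd 0 F x + n / x 0 * F x)) :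
    ∫ x in Mset Ω, p x * sdet h x = ∫ x in Mset Ω, q x * sdet h x := by
  have hn : ContDiffOn ℝ (⊤ : ℕ∞) (fun x : Eu 3 => n / x 0) (Mset Ω) :=
    contDiffOn_radial (k := fun r => n / r)
      (contDiffOn_const.div contDiffOn_id fun _ hr => ne_of_gt hr)
  have hi := G.integrableOn hF
    (q := fun x => pd 0 F x + n / x 0 * F x)
    ((pd_contDiffOn G.isOpenM hF.contDiffOn 0).add (hn.mul hF.contDiffOn))
    fun x hx => by rw [hF.pd_zero_off hx, hF.zero_off hx]; ring
  rw [← add_zero (∫ x in Mset Ω, q x * sdet h x), ← G.integral_radial hF, ← integral_add hq hi]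
  refine setIntegral_congr_fun G.isOpenM.measurableSet fun x hx => ?_
  simp only [hpq x hx]
  ring

theorem integral_lapR_eq (G : PowerWrap Ω β n h)
    (hf : TestFun (Mset Ω) f) (hg : TestFun (Mset Ω) g) (m : ℝ) :
    ∫ x in Mset Ω, (lichR h m f x * g x) * sdet h x
      = ∫ x in Mset Ω, (gradInner h f g x + (m ^ 2 + Rscal h x / 4) * (f x * g x)) * sdet h x := by
  have hc := G.contDiffOn_Rscal
  have h1 := G.integrableOn hg (q := fun x => lichR h m f x * g x)
    (((contDiffOn_const.mul hf.contDiffOn).sub (G.contDiffOn_lapR hf.contDiffOn)).add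
      ((hc.div_const 4).mul hf.contDiffOn) |>.mul hg.contDiffOn)
    fun x hx => by rw [hg.zero_off hx, mul_zero]
  have h2 := G.integrableOn hf (q := fun x => gradInner h f g x
      + (m ^ 2 + Rscal h x / 4) * (f x * g x))
    ((G.contDiffOn_gradInner hf.contDiffOn hg.contDiffOn).add
      ((contDiffOn_const.add (hc.div_const 4)).mul (hf.contDiffOn.mul hg.contDiffOn)))
    fun x hx => by simp [gradInner, hf.pd_zero_off hx, hf.zero_off hx]
  rw [← sub_eq_zero, ← integral_sub h1 h2, ← neg_eq_zero, ← integral_neg,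
    ← G.integral_lapR_mul hf hg]
  refine setIntegral_congr_fun G.isOpenM.measurableSet fun x hx => ?_
  simp only [lichR]
  ring

theorem contDiffOn_virialPot (G : PowerWrap Ω β n h) (P : Profile a a₁ a₂ a₃) :
    ContDiffOn ℝ (⊤ : ℕ∞) (virialPot β n a a₁ a₂ a₃) (Mset Ω) := by
  have hr : ContDiffOn ℝ (⊤ : ℕ∞) (fun x : Eu 3 => x 0) (Mset Ω) :=
    contDiffOn_radial (k := fun r => r) contDiffOn_id
  have hr0 : ∀ x ∈ Mset Ω, x 0 ≠ 0 := fun x hx => hx.1.ne'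
  have c0 := contDiffOn_radial (Ω := Ω) P.smooth
  have c1 := contDiffOn_radial (Ω := Ω) P.smooth₁
  have c2 := contDiffOn_radial (Ω := Ω) P.smooth₂
  have c3 := contDiffOn_radial (Ω := Ω) P.smooth₃
  have hR := contDiffOn_pr32_comp (_root_.contDiffOn_Rscal G.isOpen G.smooth G.posDef)
  refine ContDiffOn.add (ContDiffOn.sub ?_ ?_) ?_
  · exact ((c3.add ((contDiffOn_const.mul c2).div hr hr0)).add
      ((contDiffOn_const.mul c1).div (hr.pow 2) fun x hx => pow_ne_zero _ (hr0 x hx))).neg.div_const 4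
  · exact (contDiffOn_const.mul c0).div (hr.pow 3) fun x hx => pow_ne_zero _ (hr0 x hx)
  · exact ((contDiffOn_const.mul c0).div hr hr0).mul ((contDiffOn_rpow Ω (-n)).mul hR)

theorem contDiffOn_virialDensity (G : PowerWrap Ω β n h) (P : Profile a a₁ a₂ a₃)
    (hf : TestFun (Mset Ω) f) (c d : ℝ) {V : Eu 3 → ℝ} (hV : ContDiffOn ℝ (⊤ : ℕ∞) V (Mset Ω)) :
    ContDiffOn ℝ (⊤ : ℕ∞) (fun x => c * a₁ (x 0) * pd 0 f x ^ 2
        + d * a (x 0) / x 0 * angForm β n f f x + V x * f x ^ 2) (Mset Ω) := by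
  have hr : ContDiffOn ℝ (⊤ : ℕ∞) (fun x : Eu 3 => x 0) (Mset Ω) :=
    contDiffOn_radial (k := fun r => r) contDiffOn_id
  refine ContDiffOn.add (ContDiffOn.add ?_ ?_) ?_
  · exact (contDiffOn_const.mul (contDiffOn_radial P.smooth₁)).mul
      ((pd_contDiffOn G.isOpenM hf.contDiffOn 0).pow 2)
  · exact ((contDiffOn_const.mul (contDiffOn_radial P.smooth)).div hr fun x hx => hx.1.ne').mul
      (G.contDiffOn_angForm hf.contDiffOn hf.contDiffOn)
  · exact hV.mul (hf.contDiffOn.pow 2)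

theorem integrableOn_virialDensity (G : PowerWrap Ω β n h) (P : Profile a a₁ a₂ a₃)
    (hf : TestFun (Mset Ω) f) (c d : ℝ) {V : Eu 3 → ℝ} (hV : ContDiffOn ℝ (⊤ : ℕ∞) V (Mset Ω)) :
    IntegrableOn (fun x => (c * a₁ (x 0) * pd 0 f x ^ 2
        + d * a (x 0) / x 0 * angForm β n f f x + V x * f x ^ 2) * sdet h x) (Mset Ω) :=
  G.integrableOn hf (G.contDiffOn_virialDensity P hf c d hV) fun x hx => by
    rw [hf.pd_zero_off hx, hf.zero_off hx, angForm_zero_off hf hx]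
    ring

/-- The virial identity for the multiplier `a ∂ᵣ + b`. -/
theorem integral_virial (G : PowerWrap Ω β n h) (P : Profile a a₁ a₂ a₃)
    (hf : TestFun (Mset Ω) f) (m : ℝ) :
    ∫ x in Mset Ω, (lichR h m f x * radMult a (multB n a a₁) f x) * sdet h x
      = ∫ x in Mset Ω, (1 * a₁ (x 0) * pd 0 f x ^ 2 + n / 2 * a (x 0) / x 0 * angForm β n f f x
          + virialPot β n a a₁ a₂ a₃ x * f x ^ 2) * sdet h x := by
  rw [G.integral_lapR_eq hf (G.testFun_radMult P.smooth (P.smooth_multB n) hf)]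
  have cf0 := pd_contDiffOn G.isOpenM hf.contDiffOn 0
  have ca := contDiffOn_radial (Ω := Ω) P.smooth
  have hb₁ : ContDiffOn ℝ (⊤ : ℕ∞)
      (fun r => (a₂ r + (n * a₁ r * r - n * a r) / r ^ 2) / 2) (Ioi 0) :=
    contDiffOn_of_hasDerivAt (P.smooth_multB n) fun r hr => P.multB_deriv n hr
  have hk : ContDiffOn ℝ (⊤ : ℕ∞) (fun x => 1 / 2 * ((a₂ (x 0)
        + (n * a₁ (x 0) * x 0 - n * a (x 0)) / x 0 ^ 2) / 2)
        + (m ^ 2 / 2 + Rscal h x / 8) * a (x 0)) (Mset Ω) :=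
    (contDiffOn_const.mul (contDiffOn_radial hb₁)).add
      ((contDiffOn_const.add (G.contDiffOn_Rscal.div_const 8)).mul ca)
  have hF : TestFun (Mset Ω) fun x => 1 / 2 * a (x 0) * (pd 0 f x * pd 0 f x + angForm β n f f x)
      + (1 / 2 * ((a₂ (x 0) + (n * a₁ (x 0) * x 0 - n * a (x 0)) / x 0 ^ 2) / 2)
        + (m ^ 2 / 2 + Rscal h x / 8) * a (x 0)) * (f x * f x) :=
    hf.transfer G.isOpenM (((contDiffOn_const.mul ca).mul ((cf0.mul cf0).add
      (G.contDiffOn_angForm hf.contDiffOn hf.contDiffOn))).add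
        (hk.mul (hf.contDiffOn.mul hf.contDiffOn))) fun x hx => by
      rw [hf.pd_zero_off hx, hf.zero_off hx, angForm_zero_off hf hx]
      ring
  refine G.integral_eq_of_radial hF
    (G.integrableOn_virialDensity P hf 1 (n / 2) (G.contDiffOn_virialPot P)) fun x hx => ?_
  have hx0 := hx.1
  have hr : HasDerivAt (fun r : ℝ => r) 1 (x 0) := hasDerivAt_id _
  have h0 := P.deriv₁ _ hx0
  have h1 := P.deriv₂ _ hx0
  have h2 := P.deriv₃ _ hx0
  have hB₂ : HasDerivAt (fun r => 1 / 2 * ((a₂ r + (n * a₁ r * r - n * a r) / r ^ 2) / 2))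
      (1 / 4 * (a₃ (x 0) + n * a₂ (x 0) / x 0 - 2 * n * a₁ (x 0) / x 0 ^ 2
        + 2 * n * a (x 0) / x 0 ^ 3)) (x 0) := by
    refine (((h2.fun_add ((((h1.const_mul n).fun_mul hr).fun_sub (h0.const_mul n)).fun_div
      (hr.fun_pow 2) (pow_ne_zero 2 hx0.ne'))).div_const 2).const_mul (1 / 2)).congr_deriv ?_
    push_cast
    field_simp
    ring
  have da := (hasFDerivAt_radial h0).differentiableAt
  have dB := (hasFDerivAt_radial hB₂).differentiableAt
  have dR := G.contDiffOn_Rscal.diffAt G.isOpenM hx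
  have df := hf.diffAt x
  have df0 := cf0.diffAt G.isOpenM hx
  have dT := (G.contDiffOn_angForm hf.contDiffOn hf.contDiffOn).diffAt G.isOpenM hx
  have eR : pd 0 (fun y => m ^ 2 / 2 + Rscal h y / 8) x = pd 0 (Rscal h) x / 8 := by
    simp [pd, div_eq_mul_inv, fderiv_const_add, fderiv_mul_const dR, mul_comm]
  have dR' : DifferentiableAt ℝ (fun y => m ^ 2 / 2 + Rscal h y / 8) x := by fun_prop
  rw [pd_add ((da.const_mul _).fun_mul ((df0.fun_mul df0).fun_add dT))
      ((dB.fun_add (dR'.fun_mul da)).fun_mul (df.fun_mul df)),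
    pd_mul (da.const_mul _) ((df0.fun_mul df0).fun_add dT),
    pd_mul (dB.fun_add (dR'.fun_mul da)) (df.fun_mul df), pd_add (df0.fun_mul df0) dT,
    pd_mul df0 df0, pd_mul df df, pd_add dB (dR'.fun_mul da), pd_mul dR' da, eR,
    pd_zero_radial hB₂, pd_zero_radial h0, pd_zero_radial (h0.const_mul (1 / 2)),
    G.pd_zero_angForm hf.contDiffOn hx, G.pd_zero_Rscal hx,
    G.gradInner_radMult hx h0 (P.multB_deriv n hx0) hf.contDiffOn, G.Rscal_eq hx]
  have h3 : (x 0) ^ (-2 : ℝ) = (x 0 ^ 2)⁻¹ := by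
    rw [← Real.rpow_natCast, ← Real.rpow_neg hx.1.le]; norm_num
  rw [h3, radMult, multB, virialPot, smul_eq_mul, smul_eq_mul]
  generalize (x 0) ^ (-n) * Rscal β (pr32 x) = ρ
  field_simp
  ring

end PowerWrap

/-- The pointwise bounds on a radial profile that make the virial form coercive. -/
structure ProfileBounds (a a₁ a₂ a₃ : ℝ → ℝ) (ε : ℝ) : Prop where
  nonneg₁ : ∀ r, 0 < r → 0 ≤ a₁ r
  nonpos₂ : ∀ r, 0 < r → a₂ r ≤ 0
  third_le : ∀ r, 0 < r → a₃ r ≤ 6 * a₁ r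
  sq_mul_third_le : ∀ r, 0 < r → r ^ 2 * a₃ r ≤ 6 * a₁ r
  mul_first_le : ∀ r, 0 < r → r * a₁ r ≤ a r
  le_id : ∀ r, 0 < r → a r ≤ r
  le_first : ∀ r, 0 < r → 1 - 2 * r ≤ a₁ r
  le_inv : ∀ r, 0 < r → a r ≤ 1 / ε

/-- The explicit profile with first derivative `(1 + r) ^ (-1 - ε)`. -/
def prof (ε r : ℝ) : ℝ := (1 - (1 + r) ^ (-ε)) / ε
/-- First derivative of `prof`. -/
def prof₁ (ε r : ℝ) : ℝ := (1 + r) ^ (-1 - ε)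
/-- Second derivative of `prof`. -/
def prof₂ (ε r : ℝ) : ℝ := -(1 + ε) * (1 + r) ^ (-2 - ε)
/-- Third derivative of `prof`. -/
def prof₃ (ε r : ℝ) : ℝ := (1 + ε) * (2 + ε) * (1 + r) ^ (-3 - ε)

theorem hasDerivAt_one_add_rpow {r : ℝ} (hr : 0 < r) (p : ℝ) :
    HasDerivAt (fun s : ℝ => (1 + s) ^ p) (p * (1 + r) ^ (p - 1)) r := by
  have h1 : HasDerivAt (fun s : ℝ => 1 + s) 1 r := by simpa using (hasDerivAt_id r).const_add 1
  simpa using h1.rpow_const (p := p) (Or.inl (by positivity))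

theorem profile_prof {ε : ℝ} (hε : 0 < ε) :
    Profile (prof ε) (prof₁ ε) (prof₂ ε) (prof₃ ε) where
  smooth := (contDiffOn_const.sub ((contDiffOn_const.add contDiffOn_id).rpow_const_of_ne
    fun r hr => by have : (0 : ℝ) < r := hr; simp only [id]; positivity)).div_const ε
  deriv₁ r hr := by
    refine (((hasDerivAt_one_add_rpow hr (-ε)).const_sub 1).div_const ε).congr_deriv ?_
    rw [prof₁, show -ε - 1 = -1 - ε by ring]
    field_simp
  deriv₂ r hr := by
    refine (hasDerivAt_one_add_rpow hr (-1 - ε)).congr_deriv ?_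
    rw [prof₂, show -1 - ε - 1 = -2 - ε by ring]
    ring
  deriv₃ r hr := by
    refine ((hasDerivAt_one_add_rpow hr (-2 - ε)).const_mul _).congr_deriv ?_
    rw [prof₃, show -2 - ε - 1 = -3 - ε by ring]
    ring

theorem profileBounds_prof {ε : ℝ} (hε : 0 < ε) (hε1 : ε ≤ 1) :
    ProfileBounds (prof ε) (prof₁ ε) (prof₂ ε) (prof₃ ε) ε where
  nonneg₁ r hr := by rw [prof₁]; positivity
  nonpos₂ r hr := by
    have : 0 ≤ (1 + ε) * (1 + r) ^ (-2 - ε) := by positivity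
    rw [prof₂]; linarith
  third_le r hr := by
    have h1 : (1 + r) ^ (-3 - ε) ≤ (1 + r) ^ (-1 - ε) :=
      Real.rpow_le_rpow_of_exponent_le (by linarith) (by linarith)
    have h2 : 0 ≤ (1 + r) ^ (-3 - ε) := by positivity
    rw [prof₃, prof₁]
    nlinarith [mul_nonneg hε.le h2, mul_nonneg (mul_nonneg hε.le (sub_nonneg.2 hε1)) h2,
      mul_nonneg (sub_nonneg.2 hε1) h2]
  sq_mul_third_le r hr := by
    have h1 : r ^ 2 * (1 + r) ^ (-3 - ε) ≤ (1 + r) ^ (-1 - ε) := by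
      have h3 : (1 + r) ^ (-1 - ε) = (1 + r) ^ 2 * (1 + r) ^ (-3 - ε) := by
        rw [← Real.rpow_natCast, ← Real.rpow_add (by positivity)]
        norm_num
        ring_nf
      rw [h3]
      gcongr
      linarith
    have h2 : 0 ≤ r ^ 2 * (1 + r) ^ (-3 - ε) := by positivity
    rw [prof₃, prof₁]
    nlinarith [mul_nonneg hε.le h2, mul_nonneg (mul_nonneg hε.le (sub_nonneg.2 hε1)) h2,
      mul_nonneg (sub_nonneg.2 hε1) h2]
  mul_first_le r hr := by
    have hr1 : 0 < 1 + r := by positivity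
    have hs : 1 + -(r / (1 + r)) = (1 + r)⁻¹ := by field_simp; ring
    have ht : 0 ≤ r / (1 + r) := by positivity
    have h1 := rpow_one_add_le_one_add_mul_self (s := -(r / (1 + r)))
      (neg_le_neg ((div_le_one hr1).2 (by linarith))) hε.le hε1
    rw [hs, Real.inv_rpow hr1.le, ← Real.rpow_neg hr1.le] at h1
    have h2 : (1 + r) ^ (-1 - ε) = (1 + r) ^ (-ε) / (1 + r) := by
      rw [← Real.rpow_sub_one hr1.ne']; ring_nf
    rw [prof, prof₁, h2, le_div_iff₀ hε]
    have h3 : r * ((1 + r) ^ (-ε) / (1 + r)) * ε = ε * (r / (1 + r)) * (1 + r) ^ (-ε) := by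
      field_simp
    rw [h3]
    nlinarith [mul_nonneg hε.le ht]
  le_id r hr := by
    have hr1 : 0 < 1 + r := by positivity
    have h1 := rpow_one_add_le_one_add_mul_self (s := r) (by linarith) hε.le hε1
    have h2 : 0 < (1 + r) ^ ε := by positivity
    have h3 : (1 + r) ^ ε * (1 + r) ^ (-ε) = 1 := by
      rw [← Real.rpow_add hr1, add_neg_cancel, Real.rpow_zero]
    have h4 : 0 ≤ (1 + r) ^ (-ε) := by positivity
    have h5 : (1 + r) ^ (-ε) ≤ 1 := Real.rpow_le_one_of_one_le_of_nonpos (by linarith) (by linarith)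
    rw [prof, div_le_iff₀ hε]
    nlinarith [mul_nonneg (mul_nonneg hε.le hr.le) (sub_nonneg.2 h5)]
  le_first r hr := by
    have h1 : (1 + r) ^ (-2 : ℝ) ≤ (1 + r) ^ (-1 - ε) :=
      Real.rpow_le_rpow_of_exponent_le (by linarith) (by linarith)
    refine le_trans ?_ h1
    rw [Real.rpow_neg (by positivity), Real.rpow_two, ← one_div, le_div_iff₀ (by positivity)]
    nlinarith [pow_pos hr 3, pow_pos hr 2]
  le_inv r hr := by
    have : 0 ≤ (1 + r) ^ (-ε) := by positivity
    rw [prof]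
    gcongr
    linarith

/-- Lower bound for the virial potential corrected by a Hardy term. -/
theorem virialPot_lower {n r a a₁ a₂ a₃ ρ w : ℝ} (hn : 1 / 2 ≤ n) (hn' : n ≤ 4 / 3) (hr : 0 < r)
    (h1 : 0 ≤ a₁) (h2 : a₂ ≤ 0) (h3 : a₃ ≤ 6 * a₁) (h4 : r ^ 2 * a₃ ≤ 6 * a₁) (h5 : r * a₁ ≤ a)
    (h6 : a ≤ r) (h7 : 1 - 2 * r ≤ a₁) (hρ : 400000 * w ≤ ρ) (hw : w = r ^ (-n)) :
    1 / 1000 * a₁ / r ^ 2 ≤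
      -(a₃ + 2 * n * a₂ / r + (n ^ 2 - 2 * n) * a₁ / r ^ 2) / 4 - n ^ 2 / 8 * a / r ^ 3
        + n / 8 * a / r * ρ
        + 17 / 18 * ((n - 1) ^ 2 / 4 * a₁ / r ^ 2 + (n - 1) / 2 * a₂ / r) := by
  have ha : 0 ≤ a := (mul_nonneg hr.le h1).trans h5
  have hw0 : 0 < w := hw ▸ Real.rpow_pos_of_pos hr _
  have key : 0 ≤ -(r ^ 2 * a₃) / 4 + (1 / 4 - (n - 1) ^ 2 / 72 - 1 / 1000) * a₁
      - n ^ 2 / 8 * (a / r) + n / 8 * (a / r) * (r ^ 2 * ρ)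
      - r * a₂ * (n / 2 - 17 / 36 * (n - 1)) := by
    have e1 : 0 ≤ -(r * a₂ * (n / 2 - 17 / 36 * (n - 1))) := by
      have := mul_nonneg (mul_nonneg hr.le (neg_nonneg.2 h2))
        (show 0 ≤ n / 2 - 17 / 36 * (n - 1) by linarith)
      linarith
    have hq : a₁ ≤ a / r := by rw [le_div_iff₀ hr]; linarith
    have hq1 : a / r ≤ 1 := (div_le_one hr).2 h6
    have hq0 : 0 ≤ a / r := by positivity
    have e2 : (24 / 100 + 3 / 1000) * a₁ ≤ (1 / 4 - (n - 1) ^ 2 / 72 - 1 / 1000) * a₁ :=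
      mul_le_mul_of_nonneg_right (by nlinarith) h1
    have e3 : n ^ 2 / 8 * (a / r) ≤ 2 / 9 * (a / r) :=
      mul_le_mul_of_nonneg_right (by nlinarith) hq0
    have hρ0 : 0 ≤ ρ := by linarith
    rcases lt_or_ge r (1 / 100) with hlt | hge
    · have e4 : 0 ≤ n / 8 * (a / r) * (r ^ 2 * ρ) := by positivity
      have e5 : r ^ 2 * a₃ ≤ 1 / 10000 * (6 * a₁) :=
        (mul_le_mul_of_nonneg_left h3 (by positivity)).trans
          (mul_le_mul_of_nonneg_right (by nlinarith) (by linarith))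
      linarith
    · have hw1 : 1 / 10000 ≤ r ^ 2 * w := by
        have e6 : r ^ 2 * w = r ^ (2 - n) := by
          rw [hw, ← Real.rpow_natCast, ← Real.rpow_add hr]; rfl
        rw [e6]
        rcases le_total 1 r with h | h
        · exact le_trans (by norm_num) (Real.one_le_rpow h (by linarith))
        · have e7 := Real.rpow_le_rpow_of_exponent_ge hr h (show 2 - n ≤ 2 by linarith)
          rw [Real.rpow_two] at e7
          nlinarith
      have e8 : 40 ≤ r ^ 2 * ρ := by
        have := mul_le_mul_of_nonneg_left hρ (sq_nonneg r)
        linarith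
      have e9 : n / 8 * (a / r) * 40 ≤ n / 8 * (a / r) * (r ^ 2 * ρ) :=
        mul_le_mul_of_nonneg_left e8 (by positivity)
      have e10 : 1 / 2 * (a / r) ≤ n * (a / r) := mul_le_mul_of_nonneg_right hn hq0
      linarith
  have hk := div_nonneg key (sq_nonneg r)
  refine sub_nonneg.1 (hk.trans_eq ?_)
  field_simp
  ring

/-- The inhomogeneous power weight is dominated by the first derivative of the profile. -/
theorem japanese_le_prof₁ {ε p r : ℝ} (hp : 0 ≤ p) (hε : 1 + ε ≤ 2 * p) (hr : 0 < r) :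
    (1 + r ^ 2) ^ (-p) ≤ 2 ^ p * prof₁ ε r := by
  have h1 : (1 + r ^ 2) ^ (-p) ≤ ((1 + r) ^ 2 / 2) ^ (-p) :=
    Real.rpow_le_rpow_of_nonpos (by positivity) (by nlinarith [sq_nonneg (1 - r)]) (by linarith)
  have h2 : ((1 + r) ^ 2 / 2) ^ (-p) = 2 ^ p * (1 + r) ^ (-(2 * p)) := by
    rw [Real.div_rpow (by positivity) (by norm_num), ← Real.rpow_natCast, ← Real.rpow_mul
      (by positivity), Real.rpow_neg (by norm_num : (0:ℝ) ≤ 2)]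
    rw [div_inv_eq_mul, mul_comm]
    norm_num
  rw [h2] at h1
  refine h1.trans (mul_le_mul_of_nonneg_left ?_ (by positivity))
  exact Real.rpow_le_rpow_of_exponent_le (by linarith) (by linarith)

theorem japanese_succ_le_prof₁ {ε p r : ℝ} (hp : 0 ≤ p) (hε : 1 + ε ≤ 2 * p) (hr : 0 < r) :
    (1 + r ^ 2) ^ (-(1 + p)) ≤ 2 ^ p * (prof₁ ε r / r ^ 2) := by
  have h0 : 0 ≤ 2 ^ p * prof₁ ε r := by rw [prof₁]; positivity
  rw [neg_add, Real.rpow_add (by positivity), Real.rpow_neg_one, ← mul_div_assoc, mul_comm,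
    ← div_eq_mul_inv]
  exact div_le_div₀ h0 (japanese_le_prof₁ hp hε hr) (by positivity) (by linarith)

namespace PowerWrap

variable {Ω : Set (Eu 2)} {β : Eu 2 → Matrix (Fin 2) (Fin 2) ℝ} {n : ℝ}
  {h : Eu 3 → Matrix (Fin 3) (Fin 3) ℝ} {x : Eu 3} {f g : Eu 3 → ℝ} {a a₁ a₂ a₃ : ℝ → ℝ} {ε : ℝ}

theorem integrableOn_radial (G : PowerWrap Ω β n h) {F : Eu 3 → ℝ} (hF : TestFun (Mset Ω) F) :
    IntegrableOn (fun x => (pd 0 F x + n / x 0 * F x) * sdet h x) (Mset Ω) := by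
  have hn : ContDiffOn ℝ (⊤ : ℕ∞) (fun x : Eu 3 => n / x 0) (Mset Ω) :=
    contDiffOn_radial (k := fun r => n / r)
      (contDiffOn_const.div contDiffOn_id fun _ hr => ne_of_gt hr)
  exact G.integrableOn hF
    (q := fun x => pd 0 F x + n / x 0 * F x)
    ((pd_contDiffOn G.isOpenM hF.contDiffOn 0).add (hn.mul hF.contDiffOn))
    fun x hx => by rw [hF.pd_zero_off hx, hF.zero_off hx]; ring

theorem integral_mono (G : PowerWrap Ω β n h) {p q : Eu 3 → ℝ}
    (hp : IntegrableOn (fun x => p x * sdet h x) (Mset Ω))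
    (hq : IntegrableOn (fun x => q x * sdet h x) (Mset Ω)) (hpq : ∀ x ∈ Mset Ω, p x ≤ q x) :
    ∫ x in Mset Ω, p x * sdet h x ≤ ∫ x in Mset Ω, q x * sdet h x :=
  setIntegral_mono_on hp hq G.isOpenM.measurableSet fun x hx =>
    mul_le_mul_of_nonneg_right (hpq x hx) (Real.sqrt_nonneg _)

/-- Integrands ordered up to a total radial divergence have ordered integrals. -/
theorem integral_le_of_radial (G : PowerWrap Ω β n h) {F p q : Eu 3 → ℝ}
    (hF : TestFun (Mset Ω) F) (hp : IntegrableOn (fun x => p x * sdet h x) (Mset Ω))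
    (hq : IntegrableOn (fun x => q x * sdet h x) (Mset Ω))
    (hpq : ∀ x ∈ Mset Ω, p x ≤ q x + (pd 0 F x + n / x 0 * F x)) :
    ∫ x in Mset Ω, p x * sdet h x ≤ ∫ x in Mset Ω, q x * sdet h x := by
  rw [← G.integral_eq_of_radial hF hq fun x _ => rfl]
  refine G.integral_mono hp ?_ hpq
  refine (hq.add (G.integrableOn_radial hF)).congr_fun (fun x _ => ?_) G.isOpenM.measurableSet
  simp only [Pi.add_apply]
  ring

theorem testFun_radial_sq (G : PowerWrap Ω β n h) {k : ℝ → ℝ}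
    (hk : ContDiffOn ℝ (⊤ : ℕ∞) k (Ioi 0)) (hf : TestFun (Mset Ω) f) :
    TestFun (Mset Ω) fun x => k (x 0) * (f x * f x) :=
  hf.transfer G.isOpenM ((contDiffOn_radial hk).mul (hf.contDiffOn.mul hf.contDiffOn))
    fun x hx => by rw [hf.zero_off hx]; ring

theorem pd_zero_radial_sq (hf : TestFun (Mset Ω) f) {k : ℝ → ℝ} {k' : ℝ}
    (hk : HasDerivAt k k' (x 0)) :
    pd 0 (fun x => k (x 0) * (f x * f x)) x = k' * f x ^ 2 + 2 * k (x 0) * f x * pd 0 f x := by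
  have df := hf.diffAt x
  rw [pd_mul (hasFDerivAt_radial hk).differentiableAt (df.fun_mul df), pd_mul df df,
    pd_zero_radial hk]
  ring

/-- Coercivity of the virial form. -/
theorem virial_coercive (G : PowerWrap Ω β n h) (hn : 1 / 2 ≤ n) (hn' : n ≤ 4 / 3)
    (hβ : ∀ y ∈ Ω, 400000 ≤ Rscal β y) (P : Profile a a₁ a₂ a₃)
    (B : ProfileBounds a a₁ a₂ a₃ ε) (hf : TestFun (Mset Ω) f) (m : ℝ) :
    ∫ x in Mset Ω, (1 / 1000 * a₁ (x 0) * pd 0 f x ^ 2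
        + 1 / 1000 * a (x 0) / x 0 * angForm β n f f x
        + 1 / 1000 * a₁ (x 0) / x 0 ^ 2 * f x ^ 2) * sdet h x
      ≤ ∫ x in Mset Ω, (lichR h m f x * radMult a (multB n a a₁) f x) * sdet h x := by
  have hr : ContDiffOn ℝ (⊤ : ℕ∞) (fun r : ℝ => r) (Ioi 0) := contDiffOn_id
  have hV : ContDiffOn ℝ (⊤ : ℕ∞) (fun x : Eu 3 => 1 / 1000 * a₁ (x 0) / x 0 ^ 2) (Mset Ω) :=
    contDiffOn_radial (k := fun r => 1 / 1000 * a₁ r / r ^ 2)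
      ((contDiffOn_const.mul P.smooth₁).div (hr.pow 2) fun r hr => pow_ne_zero _ (ne_of_gt hr))
  have hk : ContDiffOn ℝ (⊤ : ℕ∞) (fun r => 17 / 36 * (n - 1) * (a₁ r / r)) (Ioi 0) :=
    contDiffOn_const.mul (P.smooth₁.div hr fun r hr => ne_of_gt hr)
  rw [G.integral_virial P hf m]
  refine G.integral_le_of_radial (G.testFun_radial_sq hk hf)
    (G.integrableOn_virialDensity P hf _ _ hV)
    (G.integrableOn_virialDensity P hf _ _ (G.contDiffOn_virialPot P)) fun x hx => ?_
  have hx0 := hx.1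
  rw [pd_zero_radial_sq hf ((hasDerivAt_div_id (P.deriv₂ _ hx0) hx0.ne').const_mul _)]
  have hw : 0 < x 0 ^ (-n) := Real.rpow_pos_of_pos hx0 _
  have key := virialPot_lower hn hn' hx0 (B.nonneg₁ _ hx0) (B.nonpos₂ _ hx0) (B.third_le _ hx0)
    (B.sq_mul_third_le _ hx0) (B.mul_first_le _ hx0) (B.le_id _ hx0) (B.le_first _ hx0)
    (ρ := x 0 ^ (-n) * Rscal β (pr32 x)) (by nlinarith [hβ _ hx.2]) rfl
  have h1 := B.nonneg₁ _ hx0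
  have ha : 0 ≤ a (x 0) := (mul_nonneg hx0.le h1).trans (B.mul_first_le _ hx0)
  have hT := G.angForm_self_nonneg hx f
  have t1 : 0 ≤ 17 / 18 * a₁ (x 0) * (pd 0 f x + (n - 1) / 2 / x 0 * f x) ^ 2 := by positivity
  have t2 : 0 ≤ (1 / 18 - 1 / 1000) * a₁ (x 0) * pd 0 f x ^ 2 :=
    mul_nonneg (mul_nonneg (by norm_num) h1) (sq_nonneg _)
  have t3 : 0 ≤ (n / 2 - 1 / 1000) * (a (x 0) / x 0 * angForm β n f f x) :=
    mul_nonneg (by linarith) (by positivity)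
  have t4 := mul_nonneg (sub_nonneg.2 key) (sq_nonneg (f x))
  rw [← sub_nonneg]
  refine (add_nonneg (add_nonneg t1 t2) (add_nonneg t3 t4)).trans_eq ?_
  rw [virialPot]
  generalize (x 0) ^ (-n) * Rscal β (pr32 x) = ρ
  field_simp
  ring

/-- Energy bound by Hardy's inequality. -/
theorem energy_coercive (G : PowerWrap Ω β n h) (hn : 1 / 2 ≤ n) (hn' : n ≤ 4 / 3)
    (hβ : ∀ y ∈ Ω, 400000 ≤ Rscal β y) (hf : TestFun (Mset Ω) f) (m : ℝ) :
    ∫ x in Mset Ω, (1 / 100 * (pd 0 f x ^ 2 + f x ^ 2 / x 0 ^ 2)) * sdet h x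
      ≤ ∫ x in Mset Ω, (lichR h m f x * f x) * sdet h x := by
  have hr : ContDiffOn ℝ (⊤ : ℕ∞) (fun r : ℝ => r) (Ioi 0) := contDiffOn_id
  have hk : ContDiffOn ℝ (⊤ : ℕ∞) (fun r : ℝ => 17 / 36 * (n - 1) * (1 / r)) (Ioi 0) :=
    contDiffOn_const.mul (contDiffOn_const.div hr fun r hr => ne_of_gt hr)
  have cf0 := pd_contDiffOn G.isOpenM hf.contDiffOn 0
  rw [G.integral_lapR_eq hf hf]
  refine G.integral_le_of_radial (G.testFun_radial_sq hk hf)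
    (G.integrableOn hf (contDiffOn_const.mul ((cf0.pow 2).add ((hf.contDiffOn.pow 2).div
      (contDiffOn_radial (k := fun r => r ^ 2) (hr.pow 2)) fun x hx => pow_ne_zero _ hx.1.ne')))
      fun x hx => by rw [hf.pd_zero_off hx, hf.zero_off hx]; simp)
    (G.integrableOn hf ((G.contDiffOn_gradInner hf.contDiffOn hf.contDiffOn).add
      ((contDiffOn_const.add (G.contDiffOn_Rscal.div_const 4)).mul
        (hf.contDiffOn.mul hf.contDiffOn)))
      fun x hx => by simp [gradInner, hf.pd_zero_off hx, hf.zero_off hx]) fun x hx => ?_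
  have hx0 := hx.1
  rw [pd_zero_radial_sq hf ((hasDerivAt_div_id (hasDerivAt_const _ 1) hx0.ne').const_mul _),
    G.gradInner_eq hx, G.Rscal_eq hx]
  have hw : 0 < x 0 ^ (-n) := Real.rpow_pos_of_pos hx0 _
  have hT := G.angForm_self_nonneg hx f
  have hρ : 0 ≤ x 0 ^ (-n) * Rscal β (pr32 x) := mul_nonneg hw.le (by linarith [hβ _ hx.2])
  have h3 : (x 0) ^ (-2 : ℝ) = (x 0 ^ 2)⁻¹ := by
    rw [← Real.rpow_natCast, ← Real.rpow_neg hx.1.le]; norm_num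
  rw [h3]
  generalize (x 0) ^ (-n) * Rscal β (pr32 x) = ρ at hρ ⊢
  have t1 : 0 ≤ 17 / 18 * (pd 0 f x + (n - 1) / 2 / x 0 * f x) ^ 2 := by positivity
  have t2 : 0 ≤ (1 / 18 - 1 / 100) * pd 0 f x ^ 2 :=
    mul_nonneg (by norm_num) (sq_nonneg _)
  have t3 : 0 ≤ (m ^ 2 + ρ / 4) * f x ^ 2 := by positivity
  have t4 : 0 ≤ (n / 2 - 3 / 8 * n ^ 2 + 17 / 72 * (n - 1) ^ 2 - 1 / 100) * (f x ^ 2 / x 0 ^ 2) :=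
    mul_nonneg (by nlinarith) (by positivity)
  rw [← sub_nonneg]
  refine (add_nonneg (add_nonneg t1 t2) (add_nonneg (add_nonneg t3 t4) hT)).trans_eq ?_
  field_simp
  ring

/-- The multiplier is bounded by the energy. -/
theorem radMult_le_energy (G : PowerWrap Ω β n h) (hn : 1 / 2 ≤ n) (hn' : n ≤ 4 / 3)
    (hβ : ∀ y ∈ Ω, 400000 ≤ Rscal β y) (P : Profile a a₁ a₂ a₃)
    (B : ProfileBounds a a₁ a₂ a₃ ε) (hf : TestFun (Mset Ω) f) (m : ℝ) :
    ∫ x in Mset Ω, (radMult a (multB n a a₁) f x ^ 2) * sdet h x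
      ≤ 300 / ε ^ 2 * ∫ x in Mset Ω, (lichR h m f x * f x) * sdet h x := by
  have hr : ContDiffOn ℝ (⊤ : ℕ∞) (fun r : ℝ => r) (Ioi 0) := contDiffOn_id
  have cf0 := pd_contDiffOn G.isOpenM hf.contDiffOn 0
  have hA := G.testFun_radMult P.smooth (P.smooth_multB n) hf
  have hi : IntegrableOn (fun x => 1 / 100 * (pd 0 f x ^ 2 + f x ^ 2 / x 0 ^ 2) * sdet h x)
      (Mset Ω) := (G.integrableOn hf (contDiffOn_const.mul ((cf0.pow 2).add
        ((hf.contDiffOn.pow 2).div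
      (contDiffOn_radial (k := fun r => r ^ 2) (hr.pow 2)) fun x hx => pow_ne_zero _ hx.1.ne')))
      fun x hx => by rw [hf.pd_zero_off hx, hf.zero_off hx]; simp)
  refine le_trans ?_ (mul_le_mul_of_nonneg_left (G.energy_coercive hn hn' hβ hf m)
    (by positivity))
  rw [← integral_const_mul]
  refine setIntegral_mono_on (G.integrableOn hA (hA.contDiffOn.pow 2)
    fun x hx => by rw [hA.zero_off hx]; simp) (hi.const_mul _) G.isOpenM.measurableSet
    fun x hx => ?_
  rw [← mul_assoc]
  refine mul_le_mul_of_nonneg_right ?_ (Real.sqrt_nonneg _)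
  have hx0 := hx.1
  have h1 := B.nonneg₁ _ hx0
  have h5 := B.mul_first_le _ hx0
  have ha : 0 ≤ a (x 0) := (mul_nonneg hx0.le h1).trans h5
  have hE := B.le_inv _ hx0
  have hb : 0 ≤ x 0 * multB n a a₁ (x 0) := by rw [multB]; positivity
  have hb1 : x 0 * multB n a a₁ (x 0) ≤ 7 / 6 * (1 / ε) := by
    have : x 0 * multB n a a₁ (x 0) = (x 0 * a₁ (x 0) + n * a (x 0)) / 2 := by
      rw [multB]; field_simp
    rw [this]
    nlinarith
  have e1 : a (x 0) ^ 2 ≤ (1 / ε) ^ 2 := pow_le_pow_left₀ ha hE 2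
  have e2 : (x 0 * multB n a a₁ (x 0)) ^ 2 ≤ (7 / 6 * (1 / ε)) ^ 2 := pow_le_pow_left₀ hb hb1 2
  have e3 : radMult a (multB n a a₁) f x
      = a (x 0) * pd 0 f x + (x 0 * multB n a a₁ (x 0)) * (f x / x 0) := by
    rw [radMult, smul_eq_mul, smul_eq_mul]; field_simp
  have e4 : 300 / ε ^ 2 * (1 / 100 * (pd 0 f x ^ 2 + f x ^ 2 / x 0 ^ 2))
      = 3 * (1 / ε) ^ 2 * (pd 0 f x ^ 2 + (f x / x 0) ^ 2) := by ring
  rw [e3, e4]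
  have m1 := mul_le_mul_of_nonneg_right e1 (sq_nonneg (pd 0 f x))
  have m2 := mul_le_mul_of_nonneg_right e2 (sq_nonneg (f x / x 0))
  have m3 : 0 ≤ (1 / ε) ^ 2 * (pd 0 f x) ^ 2 := by positivity
  have m4 : 0 ≤ (1 / ε) ^ 2 * (f x / x 0) ^ 2 := by positivity
  have m5 := sq_nonneg (a (x 0) * pd 0 f x - (x 0 * multB n a a₁ (x 0)) * (f x / x 0))
  nlinarith

/-- The multiplier is antisymmetric. -/
theorem integral_radMult_mul (G : PowerWrap Ω β n h) (P : Profile a a₁ a₂ a₃)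
    (hf : TestFun (Mset Ω) f) (hg : TestFun (Mset Ω) g) :
    ∫ x in Mset Ω, (radMult a (multB n a a₁) f x * g x) * sdet h x
      = -∫ x in Mset Ω, (f x * radMult a (multB n a a₁) g x) * sdet h x := by
  have hA := G.testFun_radMult P.smooth (P.smooth_multB n) hg
  have hF : TestFun (Mset Ω) fun x => a (x 0) * (f x * g x) :=
    hf.transfer G.isOpenM ((contDiffOn_radial P.smooth).mul (hf.contDiffOn.mul hg.contDiffOn))
      fun x hx => by rw [hf.zero_off hx]; ring
  have hi := G.integrableOn hf (hf.contDiffOn.mul hA.contDiffOn)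
    fun x hx => by rw [hf.zero_off hx, zero_mul]
  have := G.integral_eq_of_radial hF (p := fun x => radMult a (multB n a a₁) f x * g x)
    (q := fun x => -(f x * radMult a (multB n a a₁) g x))
    (hi.neg.congr_fun (fun x _ => by simp) G.isOpenM.measurableSet) fun x hx => by
      have h0 := P.deriv₁ _ hx.1
      have hx0 := hx.1
      rw [pd_mul (hasFDerivAt_radial h0).differentiableAt ((hf.diffAt x).fun_mul (hg.diffAt x)),
        pd_mul (hf.diffAt x) (hg.diffAt x), pd_zero_radial h0]
      simp only [radMult, multB, smul_eq_mul]
      field_simp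
      ring
  rw [this, ← integral_neg]
  simp

/-- The virial form controls the weighted norms of the local smoothing estimate. -/
theorem weighted_le_virial (G : PowerWrap Ω β n h) (hn : 1 / 2 ≤ n) (hn' : n ≤ 4 / 3)
    (hβ : ∀ y ∈ Ω, 400000 ≤ Rscal β y) (hf : TestFun (Mset Ω) f) (m : ℝ) (hε : 0 < ε)
    (hε1 : ε ≤ 1) {η₁ η₂ : ℝ} (h₁ : ε ≤ 2 * η₁) (h₂ : ε ≤ 2 * η₂) :
    ∫ x in Mset Ω, ((1 + x 0 ^ 2) ^ (-(3 / 2 + η₁)) * f x ^ 2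
        + (1 + x 0 ^ 2) ^ (-(1 / 2 + η₂)) * gradInner h f f x) * sdet h x
      ≤ 1000 * ((2 : ℝ) ^ (1 / 2 + η₁) + (2 : ℝ) ^ (1 / 2 + η₂)) *
        ∫ x in Mset Ω, (lichR h m f x * radMult (prof ε) (multB n (prof ε) (prof₁ ε)) f x)
          * sdet h x := by
  have P := profile_prof hε
  have B := profileBounds_prof hε hε1
  refine le_trans ?_ (mul_le_mul_of_nonneg_left (G.virial_coercive hn hn' hβ P B hf m)
    (by positivity))
  have hr : ContDiffOn ℝ (⊤ : ℕ∞) (fun r : ℝ => r) (Ioi 0) := contDiffOn_id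
  have hV : ContDiffOn ℝ (⊤ : ℕ∞) (fun x : Eu 3 => 1 / 1000 * prof₁ ε (x 0) / x 0 ^ 2) (Mset Ω) :=
    contDiffOn_radial (k := fun r => 1 / 1000 * prof₁ ε r / r ^ 2)
      ((contDiffOn_const.mul P.smooth₁).div (hr.pow 2) fun r hr => pow_ne_zero _ (ne_of_gt hr))
  have hJ (p : ℝ) : ContDiffOn ℝ (⊤ : ℕ∞) (fun x : Eu 3 => (1 + x 0 ^ 2) ^ p) (Mset Ω) :=
    contDiffOn_radial (k := fun r => (1 + r ^ 2) ^ p)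
      ((contDiffOn_const.add (hr.pow 2)).rpow_const_of_ne fun r _ => by positivity)
  rw [← integral_const_mul]
  refine setIntegral_mono_on (G.integrableOn hf (((hJ _).mul (hf.contDiffOn.pow 2)).add
    ((hJ _).mul (G.contDiffOn_gradInner hf.contDiffOn hf.contDiffOn)))
    fun x hx => by simp [gradInner, hf.pd_zero_off hx, hf.zero_off hx])
    ((G.integrableOn_virialDensity P hf _ _ hV).const_mul _) G.isOpenM.measurableSet
    fun x hx => ?_
  rw [← mul_assoc]
  refine mul_le_mul_of_nonneg_right ?_ (Real.sqrt_nonneg _)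
  have hx0 := hx.1
  have hT := G.angForm_self_nonneg hx f
  have w1 := japanese_succ_le_prof₁ (ε := ε) (p := 1 / 2 + η₁) (by linarith) (by linarith) hx0
  have w2 := japanese_le_prof₁ (ε := ε) (p := 1 / 2 + η₂) (by linarith) (by linarith) hx0
  rw [show 1 + (1 / 2 + η₁) = 3 / 2 + η₁ by ring] at w1
  rw [G.gradInner_eq hx]
  have k1 : (0 : ℝ) < 2 ^ (1 / 2 + η₁) := by positivity
  have k2 : (0 : ℝ) < 2 ^ (1 / 2 + η₂) := by positivity
  have h1 := B.nonneg₁ _ hx0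
  have h5 : prof₁ ε (x 0) ≤ prof ε (x 0) / x 0 := by
    rw [le_div_iff₀ hx0]; linarith [B.mul_first_le _ hx0]
  generalize (2 : ℝ) ^ (1 / 2 + η₁) = κ₁ at *
  generalize (2 : ℝ) ^ (1 / 2 + η₂) = κ₂ at *
  have m1 := mul_le_mul_of_nonneg_right w1 (sq_nonneg (f x))
  have m2 := mul_le_mul_of_nonneg_right w2 (add_nonneg (sq_nonneg (pd 0 f x)) hT)
  have m3 : 0 ≤ κ₁ * (prof₁ ε (x 0) * pd 0 f x ^ 2) := by positivity
  have m4 : 0 ≤ κ₂ * (prof₁ ε (x 0) / x 0 ^ 2 * f x ^ 2) := by positivity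
  have h6 : 0 ≤ prof ε (x 0) / x 0 := h1.trans h5
  have m5 : 0 ≤ κ₁ * (prof ε (x 0) / x 0 * angForm β n f f x) := by positivity
  have m6 : κ₂ * (prof₁ ε (x 0) * angForm β n f f x)
      ≤ κ₂ * (prof ε (x 0) / x 0 * angForm β n f f x) := by gcongr
  have e : 1000 * (κ₁ + κ₂) * (1 / 1000 * prof₁ ε (x 0) * pd 0 f x ^ 2
        + 1 / 1000 * prof ε (x 0) / x 0 * angForm β n f f x
        + 1 / 1000 * prof₁ ε (x 0) / x 0 ^ 2 * f x ^ 2)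
      = κ₁ * (prof₁ ε (x 0) * pd 0 f x ^ 2) + κ₁ * (prof ε (x 0) / x 0 * angForm β n f f x)
        + κ₁ * (prof₁ ε (x 0) / x 0 ^ 2) * f x ^ 2 + κ₂ * prof₁ ε (x 0) * pd 0 f x ^ 2
        + κ₂ * (prof ε (x 0) / x 0 * angForm β n f f x)
        + κ₂ * (prof₁ ε (x 0) / x 0 ^ 2 * f x ^ 2) := by ring
  rw [e]
  linarith

end PowerWrap

/-! ### Real components of spinor fields -/

/-- The real coordinate functionals on `ℂ⁴`. -/
def coordL (k : Fin 4 × Bool) : (Fin 4 → ℂ) →L[ℝ] ℝ :=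
  (if k.2 then Complex.reCLM else Complex.imCLM) ∘L
    (ContinuousLinearMap.proj k.1 : (Fin 4 → ℂ) →L[ℝ] ℂ)

theorem sum_coordL_mul (v w : Fin 4 → ℂ) :
    ∑ k, coordL k v * coordL k w = (∑ i, (starRingEnd ℂ) (v i) * w i).re := by
  rw [Fintype.sum_prod_type, Complex.re_sum]
  refine Finset.sum_congr rfl fun i _ => ?_
  simp [coordL]

theorem sum_coordL_sq (v : Fin 4 → ℂ) : ∑ k, coordL k v ^ 2 = ∑ c, ‖v c‖ ^ 2 := by
  simp only [pow_two (coordL _ v), sum_coordL_mul, Complex.re_sum]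
  refine Finset.sum_congr rfl fun c _ => ?_
  rw [← Complex.normSq_eq_norm_sq, ← Complex.normSq_eq_conj_mul_self, Complex.ofReal_re]

/-- The spinor fields with compact support in `M`. -/
def testSpace (Ω : Set (Eu 2)) : Submodule ℂ (Eu 3 → Fin 4 → ℂ) where
  carrier := {f | TestFun (Mset Ω) f}
  add_mem' {f g} hf hg := ⟨hf.smooth.add hg.smooth, hf.compact.add hg.compact,
    (tsupport_add f g).trans (union_subset hf.subset hg.subset)⟩
  zero_mem' := ⟨contDiff_const, HasCompactSupport.zero, by simp [tsupport]⟩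
  smul_mem' c f hf := ⟨contDiff_const.smul hf.smooth, hf.compact.comp_left (g := fun v => c • v)
      (smul_zero c), (closure_mono (Function.support_const_smul_subset c f)).trans hf.subset⟩

theorem pd_const_smul {c : ℂ} {f : Eu 3 → Fin 4 → ℂ} {x : Eu 3} (hf : DifferentiableAt ℝ f x)
    (j : Fin 3) : pd j (fun y => c • f y) x = c • pd j f x := by
  rw [pd, fderiv_fun_const_smul hf]
  rfl

section Operators

variable {Ω : Set (Eu 2)} {A : Fin 3 → Eu 3 → Fin 4 → Fin 4 → ℂ} {B : Eu 3 → Fin 4 → Fin 4 → ℂ}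
  {f g : Eu 3 → Fin 4 → ℂ} {x : Eu 3}

theorem contDiffOn_Hop {s : Set (Eu 3)} (hs : IsOpen s)
    (hA : ∀ j i k, ContDiffOn ℝ (⊤ : ℕ∞) (fun x => A j x i k) s)
    (hB : ∀ i k, ContDiffOn ℝ (⊤ : ℕ∞) (fun x => B x i k) s)
    (hf : ContDiffOn ℝ (⊤ : ℕ∞) f s) : ContDiffOn ℝ (⊤ : ℕ∞) (Hop A B f) s := by
  refine contDiffOn_pi.2 fun i => ContDiffOn.add (ContDiffOn.sum fun j _ => ContDiffOn.sum
    fun k _ => ?_) (ContDiffOn.sum fun k _ => ?_)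
  · exact (hA j i k).mul (contDiffOn_pi.1 (pd_contDiffOn hs hf j) k)
  · exact (hB i k).mul (contDiffOn_pi.1 hf k)

theorem Hop_congr {s : Set (Eu 3)} (hs : IsOpen s) (hfg : EqOn f g s) :
    EqOn (Hop A B f) (Hop A B g) s := fun x hx => by
  funext i
  simp only [Hop, pd_congr_on hs hfg hx, hfg hx]

theorem TestFun.Hop (hΩ : IsOpen (Mset Ω))
    (hA : ∀ j i k, ContDiffOn ℝ (⊤ : ℕ∞) (fun x => A j x i k) (Mset Ω))
    (hB : ∀ i k, ContDiffOn ℝ (⊤ : ℕ∞) (fun x => B x i k) (Mset Ω))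
    (hf : TestFun (Mset Ω) f) : TestFun (Mset Ω) (Hop A B f) :=
  hf.transfer hΩ (contDiffOn_Hop hΩ hA hB hf.contDiffOn) fun x hx => by
    funext i
    simp [_root_.Hop, hf.pd_zero_off hx, hf.zero_off hx]

theorem Hop_add (hf : DifferentiableAt ℝ f x) (hg : DifferentiableAt ℝ g x) :
    Hop A B (f + g) x = Hop A B f x + Hop A B g x := by
  have h1 (j : Fin 3) : pd j (f + g) x = pd j f x + pd j g x := pd_add hf hg j
  funext i
  simp only [Hop, Pi.add_apply, h1, mul_add, Finset.sum_add_distrib]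
  ring

theorem Hop_smul (c : ℂ) (hf : DifferentiableAt ℝ f x) :
    Hop A B (c • f) x = c • Hop A B f x := by
  have h1 (j : Fin 3) : pd j (c • f) x = c • pd j f x := pd_const_smul hf j
  funext i
  simp only [Hop, Pi.smul_apply, h1, smul_eq_mul, mul_add, Finset.mul_sum, mul_left_comm c]

theorem radMult_add {a b : ℝ → ℝ} (hf : DifferentiableAt ℝ f x) (hg : DifferentiableAt ℝ g x) :
    radMult a b (f + g) x = radMult a b f x + radMult a b g x := by
  have h1 : pd 0 (f + g) x = pd 0 f x + pd 0 g x := pd_add hf hg 0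
  simp only [radMult, Pi.add_apply, h1, smul_add]
  abel

theorem radMult_smul {a b : ℝ → ℝ} (c : ℂ) (hf : DifferentiableAt ℝ f x) :
    radMult a b (c • f) x = c • radMult a b f x := by
  have h1 : pd 0 (c • f) x = c • pd 0 f x := pd_const_smul hf 0
  simp only [radMult, Pi.smul_apply, h1, smul_add, smul_comm c]

theorem coordL_radMult {a b : ℝ → ℝ} (k : Fin 4 × Bool) (hf : DifferentiableAt ℝ f x) :
    coordL k (radMult a b f x) = radMult a b (fun y => coordL k (f y)) x := by
  simp only [radMult, map_add, map_smul, pd_clm (coordL k) hf]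

end Operators

/-- A symmetric first-order operator whose square is `m² - Δ_h + ¼ R_h`. -/
structure DiracOp (Ω : Set (Eu 2)) (h : Eu 3 → Matrix (Fin 3) (Fin 3) ℝ) (m : ℝ)
    (A : Fin 3 → Eu 3 → Fin 4 → Fin 4 → ℂ) (B : Eu 3 → Fin 4 → Fin 4 → ℂ) : Prop where
  smooth_fst : ∀ j i k, ContDiffOn ℝ (⊤ : ℕ∞) (fun x => A j x i k) (Mset Ω)
  smooth_zero : ∀ i k, ContDiffOn ℝ (⊤ : ℕ∞) (fun x => B x i k) (Mset Ω)
  symm : ∀ f g : Eu 3 → Fin 4 → ℂ, TestFun (Mset Ω) f → TestFun (Mset Ω) g →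
    innM Ω h (Hop A B f) g = innM Ω h f (Hop A B g)
  sq : ∀ f : Eu 3 → Fin 4 → ℂ, ContDiff ℝ (⊤ : ℕ∞) f → ∀ x ∈ Mset Ω, ∀ i : Fin 4,
    Hop A B (Hop A B f) x i = ((m : ℂ) ^ 2) * f x i - lapC h (fun y => f y i) x
      + ((Rscal h x / 4 : ℝ) : ℂ) * f x i

namespace PowerWrap

variable {Ω : Set (Eu 2)} {β : Eu 2 → Matrix (Fin 2) (Fin 2) ℝ} {n m : ℝ}
  {h : Eu 3 → Matrix (Fin 3) (Fin 3) ℝ} {x : Eu 3} {f g : Eu 3 → Fin 4 → ℂ}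
  {A : Fin 3 → Eu 3 → Fin 4 → Fin 4 → ℂ} {B : Eu 3 → Fin 4 → Fin 4 → ℂ}
  {a a₁ a₂ a₃ : ℝ → ℝ} {ε : ℝ}

theorem clm_lapC (G : PowerWrap Ω β n h) (hx : x ∈ Mset Ω) {φ : Eu 3 → ℂ}
    (hφ : ContDiffOn ℝ (⊤ : ℕ∞) φ (Mset Ω)) (L : ℂ →L[ℝ] ℝ) :
    L (lapC h φ x) = lapR h (fun y => L (φ y)) x := by
  have hd (j : Fin 3) : ContDiffOn ℝ (⊤ : ℕ∞)
      (fun y => sdet h y • ∑ k, (h y)⁻¹ j k • pd k φ y) (Mset Ω) :=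
    G.contDiffOn_sdet.smul (ContDiffOn.sum fun k _ =>
      (G.contDiffOn_inv j k).smul (pd_contDiffOn G.isOpenM hφ k))
  have h1 : lapC h φ x
      = (sdet h x)⁻¹ • ∑ j, pd j (fun y => sdet h y • ∑ k, (h y)⁻¹ j k • pd k φ y) x := by
    simp only [lapC, Complex.real_smul, Complex.ofReal_inv]
  rw [h1, map_smul, map_sum, lapR, smul_eq_mul]
  congr 1
  refine Finset.sum_congr rfl fun j _ => ?_
  rw [← pd_clm L ((hd j).diffAt G.isOpenM hx)]
  refine pd_congr_on G.isOpenM (fun y hy => ?_) hx j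
  simp only [map_smul, map_sum, smul_eq_mul, pd_clm L (hφ.diffAt G.isOpenM hy)]

theorem coordL_Hop_Hop (G : PowerWrap Ω β n h) (D : DiracOp Ω h m A B)
    (hf : TestFun (Mset Ω) f) (hx : x ∈ Mset Ω) (k : Fin 4 × Bool) :
    coordL k (Hop A B (Hop A B f) x) = lichR h m (fun y => coordL k (f y)) x := by
  have hi : ContDiffOn ℝ (⊤ : ℕ∞) (fun y => f y k.1) (Mset Ω) :=
    contDiffOn_pi.1 hf.contDiffOn k.1
  have h1 : Hop A B (Hop A B f) x k.1 = (m ^ 2) • f x k.1 - lapC h (fun y => f y k.1) x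
      + (Rscal h x / 4) • f x k.1 := by
    rw [D.sq f hf.smooth x hx k.1, Complex.real_smul, Complex.real_smul, Complex.ofReal_pow]
  simp only [coordL, ContinuousLinearMap.comp_apply, ContinuousLinearMap.proj_apply, h1, map_add,
    map_sub, map_smul, G.clm_lapC hx hi, smul_eq_mul, lichR]

theorem integrable_inn (G : PowerWrap Ω β n h) (hf : TestFun (Mset Ω) f)
    (hg : ContDiffOn ℝ (⊤ : ℕ∞) g (Mset Ω)) :
    IntegrableOn (fun x => (∑ i, (starRingEnd ℂ) (f x i) * g x i) * ((sdet h x : ℝ) : ℂ))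
      (Mset Ω) := by
  have hc : ContinuousOn (fun x => (∑ i, (starRingEnd ℂ) (f x i) * g x i) * ((sdet h x : ℝ) : ℂ))
      (Mset Ω) := by
    refine ContinuousOn.mul (continuousOn_finsetSum _ fun i _ => ?_)
      (Complex.continuous_ofReal.comp_continuousOn G.contDiffOn_sdet.continuousOn)
    exact (Complex.continuous_conj.comp_continuousOn
      (continuousOn_pi.1 hf.contDiffOn.continuousOn i)).mul
      (continuousOn_pi.1 hg.continuousOn i)
  exact (integrable_of_zero_off hf.compact (hc.mono hf.subset) fun x hx => by
    simp [hf.zero_off hx]).integrableOn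

theorem re_innM (G : PowerWrap Ω β n h) (hf : TestFun (Mset Ω) f)
    (hg : TestFun (Mset Ω) g) :
    (innM Ω h f g).re
      = ∑ k, ∫ x in Mset Ω, (coordL k (f x) * coordL k (g x)) * sdet h x := by
  have h1 := integral_re (G.integrable_inn hf hg.contDiffOn)
  rw [innM]
  refine h1.symm.trans ?_
  rw [← integral_finsetSum]
  · refine setIntegral_congr_fun G.isOpenM.measurableSet fun x _ => ?_
    simp only [← Finset.sum_mul, sum_coordL_mul]
    simp
  · intro k _
    exact G.integrableOn (hf.clm G.isOpenM (coordL k))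
      (((coordL k).contDiff.comp_contDiffOn hf.contDiffOn).mul
        ((coordL k).contDiff.comp_contDiffOn hg.contDiffOn))
      fun x hx => by
        rw [(hf.clm G.isOpenM (coordL k)).zero_off hx, zero_mul]

theorem innM_add_left (G : PowerWrap Ω β n h) {f' : Eu 3 → Fin 4 → ℂ} (hf : TestFun (Mset Ω) f)
    (hf' : TestFun (Mset Ω) f') (hg : TestFun (Mset Ω) g) :
    innM Ω h (f + f') g = innM Ω h f g + innM Ω h f' g := by
  rw [innM, innM, innM, ← integral_add (G.integrable_inn hf hg.contDiffOn)
    (G.integrable_inn hf' hg.contDiffOn)]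
  refine setIntegral_congr_fun G.isOpenM.measurableSet fun x _ => ?_
  simp only [Pi.add_apply, map_add, add_mul, Finset.sum_add_distrib]

theorem innM_smul_left (c : ℂ) :
    innM Ω h (c • f) g = (starRingEnd ℂ) c * innM Ω h f g := by
  rw [innM, innM, ← integral_const_mul]
  simp only [Pi.smul_apply, smul_eq_mul, map_mul, Finset.mul_sum, Finset.sum_mul, mul_assoc]

theorem conj_innM : (starRingEnd ℂ) (innM Ω h g f) = innM Ω h f g := by
  rw [innM, innM, ← integral_conj]
  simp only [map_mul, map_sum, Complex.conj_conj, Complex.conj_ofReal, mul_comm]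

theorem innM_smul_right (c : ℂ) : innM Ω h f (c • g) = c * innM Ω h f g := by
  rw [← conj_innM, innM_smul_left, map_mul, Complex.conj_conj, conj_innM]

theorem re_innM_self (G : PowerWrap Ω β n h) (hf : TestFun (Mset Ω) f) :
    (innM Ω h f f).re = ∫ x in Mset Ω, (∑ c, ‖f x c‖ ^ 2) * sdet h x := by
  refine (integral_re (G.integrable_inn hf hf.contDiffOn)).symm.trans ?_
  refine setIntegral_congr_fun G.isOpenM.measurableSet fun x _ => ?_
  simp only [RCLike.re_to_complex, Complex.re_mul_ofReal, ← sum_coordL_mul, ← pow_two,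
    sum_coordL_sq]

/-- The pre-inner product `⟨·,·⟩_h` on test spinors. -/
@[reducible] def innCore (G : PowerWrap Ω β n h) : PreInnerProductSpace.Core ℂ (testSpace Ω) where
  inner f g := innM Ω h f g
  conj_inner_symm _ _ := conj_innM
  re_inner_nonneg f := by
    change 0 ≤ (innM Ω h (f : Eu 3 → Fin 4 → ℂ) f).re
    rw [G.re_innM_self f.2]
    exact integral_nonneg fun x => mul_nonneg (by positivity) (Real.sqrt_nonneg _)
  add_left f f' g := G.innM_add_left f.2 f'.2 g.2
  smul_left _ _ _ := innM_smul_left _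

/-- The Dirac operator on test spinors. -/
def hopL (G : PowerWrap Ω β n h) (D : DiracOp Ω h m A B) : testSpace Ω →ₗ[ℂ] testSpace Ω where
  toFun f := ⟨Hop A B f, TestFun.Hop G.isOpenM D.smooth_fst D.smooth_zero f.2⟩
  map_add' f g := Subtype.ext (funext fun x => Hop_add (f.2.diffAt x) (g.2.diffAt x))
  map_smul' c f := Subtype.ext (funext fun x => Hop_smul c (f.2.diffAt x))

/-- The radial multiplier on test spinors. -/
def radL (G : PowerWrap Ω β n h) (P : Profile a a₁ a₂ a₃) : testSpace Ω →ₗ[ℂ] testSpace Ω where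
  toFun f := ⟨radMult a (multB n a a₁) f, G.testFun_radMult P.smooth (P.smooth_multB n) f.2⟩
  map_add' f g := Subtype.ext (funext fun x => radMult_add (f.2.diffAt x) (g.2.diffAt x))
  map_smul' c f := Subtype.ext (funext fun x => radMult_smul c (f.2.diffAt x))

theorem re_innM_radMult (G : PowerWrap Ω β n h) (P : Profile a a₁ a₂ a₃)
    (hf : TestFun (Mset Ω) f) (hg : TestFun (Mset Ω) g) :
    (innM Ω h (radMult a (multB n a a₁) f) g).re
      = -(innM Ω h f (radMult a (multB n a a₁) g)).re := by
  rw [G.re_innM (G.testFun_radMult P.smooth (P.smooth_multB n) hf) hg,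
    G.re_innM hf (G.testFun_radMult P.smooth (P.smooth_multB n) hg), ← Finset.sum_neg_distrib]
  refine Finset.sum_congr rfl fun k _ => ?_
  simp only [coordL_radMult k (hf.diffAt _), coordL_radMult k (hg.diffAt _)]
  exact G.integral_radMult_mul P (hf.clm G.isOpenM _) (hg.clm G.isOpenM _)

theorem innM_radMult (G : PowerWrap Ω β n h) (P : Profile a a₁ a₂ a₃)
    (hf : TestFun (Mset Ω) f) (hg : TestFun (Mset Ω) g) :
    innM Ω h (radMult a (multB n a a₁) f) g = -innM Ω h f (radMult a (multB n a a₁) g) := by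
  refine Complex.ext (G.re_innM_radMult P hf hg) ?_
  have h1 := G.re_innM_radMult P hf ((testSpace Ω).smul_mem Complex.I hg)
  have h2 : radMult a (multB n a a₁) (Complex.I • g)
      = Complex.I • radMult a (multB n a a₁) g :=
    funext fun x => radMult_smul _ (hg.diffAt x)
  rw [h2, innM_smul_right, innM_smul_right] at h1
  simpa [neg_eq_iff_eq_neg] using h1

theorem re_innM_Hop_sq (G : PowerWrap Ω β n h) (D : DiracOp Ω h m A B)
    (hf : TestFun (Mset Ω) f) (hg : TestFun (Mset Ω) g) :
    (innM Ω h (Hop A B (Hop A B f)) g).re = ∑ k, ∫ x in Mset Ω,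
      (lichR h m (fun y => coordL k (f y)) x * coordL k (g x)) * sdet h x := by
  have hH {f : Eu 3 → Fin 4 → ℂ} (hf : TestFun (Mset Ω) f) :=
    TestFun.Hop G.isOpenM D.smooth_fst D.smooth_zero hf
  rw [G.re_innM (hH (hH hf)) hg]
  refine Finset.sum_congr rfl fun k _ => setIntegral_congr_fun G.isOpenM.measurableSet
    fun x hx => ?_
  simp only [G.coordL_Hop_Hop D hf hx]

theorem innM_radMult_le (G : PowerWrap Ω β n h) (D : DiracOp Ω h m A B) (hn : 1 / 2 ≤ n)
    (hn' : n ≤ 4 / 3) (hβ : ∀ y ∈ Ω, 400000 ≤ Rscal β y) (P : Profile a a₁ a₂ a₃)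
    (hb : ProfileBounds a a₁ a₂ a₃ ε) (hf : TestFun (Mset Ω) f) :
    (innM Ω h (radMult a (multB n a a₁) f) (radMult a (multB n a a₁) f)).re
      ≤ 300 / ε ^ 2 * (innM Ω h (Hop A B f) (Hop A B f)).re := by
  have hA := G.testFun_radMult P.smooth (P.smooth_multB n) hf
  have hHf := TestFun.Hop G.isOpenM D.smooth_fst D.smooth_zero hf
  rw [← D.symm _ _ hHf hf, G.re_innM_Hop_sq D hf hf, G.re_innM hA hA, Finset.mul_sum]
  refine Finset.sum_le_sum fun k _ => ?_
  simp only [coordL_radMult k (hf.diffAt _), ← pow_two]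
  exact G.radMult_le_energy hn hn' hβ P hb (hf.clm G.isOpenM _) m

theorem sum_gradInner (hf : TestFun (Mset Ω) f) :
    ∑ k, gradInner h (fun y => coordL k (f y)) (fun y => coordL k (f y)) x = gradhSq h f x := by
  simp only [gradInner, gradhSq]
  rw [Finset.sum_comm]
  refine Finset.sum_congr rfl fun i _ => ?_
  rw [Finset.sum_comm]
  refine Finset.sum_congr rfl fun j _ => ?_
  rw [← Finset.mul_sum]
  congr 1
  have hp (i : Fin 3) (c : Fin 4) : pd i (fun y => f y c) x = pd i f x c :=
    pd_clm (ContinuousLinearMap.proj c : (Fin 4 → ℂ) →L[ℝ] ℂ) (hf.diffAt x) i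
  simp only [pd_clm (coordL _) (hf.diffAt x), hp]
  rw [← Complex.re_sum, ← sum_coordL_mul]
  exact Finset.sum_congr rfl fun k _ => mul_comm _ _

theorem weighted_le_innM (G : PowerWrap Ω β n h) (D : DiracOp Ω h m A B) (hn : 1 / 2 ≤ n)
    (hn' : n ≤ 4 / 3) (hβ : ∀ y ∈ Ω, 400000 ≤ Rscal β y) (hf : TestFun (Mset Ω) f)
    (hε : 0 < ε) (hε1 : ε ≤ 1) {η₁ η₂ : ℝ} (h₁ : ε ≤ 2 * η₁) (h₂ : ε ≤ 2 * η₂) :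
    ∫ x in Mset Ω, ((1 + (x 0) ^ 2) ^ (-(3 / 2 + η₁)) * (∑ c, ‖f x c‖ ^ 2)
        + (1 + (x 0) ^ 2) ^ (-(1 / 2 + η₂)) * gradhSq h f x) * sdet h x
      ≤ 1000 * ((2 : ℝ) ^ (1 / 2 + η₁) + (2 : ℝ) ^ (1 / 2 + η₂)) *
        (innM Ω h (Hop A B (Hop A B f)) (radMult (prof ε) (multB n (prof ε) (prof₁ ε)) f)).re := by
  have P := profile_prof hε
  rw [G.re_innM_Hop_sq D hf (G.testFun_radMult P.smooth (P.smooth_multB n) hf), Finset.mul_sum]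
  have hJ (p : ℝ) : ContDiffOn ℝ (⊤ : ℕ∞) (fun x : Eu 3 => (1 + x 0 ^ 2) ^ p) (Mset Ω) :=
    contDiffOn_radial (k := fun r => (1 + r ^ 2) ^ p)
      ((contDiffOn_const.add (contDiffOn_id.pow 2)).rpow_const_of_ne fun r _ => by positivity)
  have hk (k : Fin 4 × Bool) := hf.clm G.isOpenM (coordL k)
  have key : ∫ x in Mset Ω, ((1 + (x 0) ^ 2) ^ (-(3 / 2 + η₁)) * (∑ c, ‖f x c‖ ^ 2)
        + (1 + (x 0) ^ 2) ^ (-(1 / 2 + η₂)) * gradhSq h f x) * sdet h x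
      = ∑ k, ∫ x in Mset Ω, ((1 + x 0 ^ 2) ^ (-(3 / 2 + η₁)) * coordL k (f x) ^ 2
        + (1 + x 0 ^ 2) ^ (-(1 / 2 + η₂))
          * gradInner h (fun y => coordL k (f y)) (fun y => coordL k (f y)) x) * sdet h x := by
    rw [← integral_finsetSum]
    · refine setIntegral_congr_fun G.isOpenM.measurableSet fun x hx => ?_
      rw [← sum_gradInner hf, ← Finset.sum_mul, Finset.sum_add_distrib, ← Finset.mul_sum,
        ← Finset.mul_sum, sum_coordL_sq]
    · intro k _
      exact G.integrableOn (hk k) (((hJ _).mul ((hk k).contDiffOn.pow 2)).add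
        ((hJ _).mul (G.contDiffOn_gradInner (hk k).contDiffOn (hk k).contDiffOn)))
        fun x hx => by simp [gradInner, (hk k).pd_zero_off hx, (hk k).zero_off hx]
  rw [key]
  refine Finset.sum_le_sum fun k _ => ?_
  simp only [coordL_radMult k (hf.diffAt _)]
  exact G.weighted_le_virial hn hn' hβ (hk k) m hε hε1 h₁ h₂

end PowerWrap

section Evolution

variable {E : Type*} [SeminormedAddCommGroup E] [InnerProductSpace ℂ E] {H : E →ₗ[ℂ] E}
  {ρ : ℝ → ℝ} {u : ℝ → E}

theorem WeakEvol.norm_apply_eq (hu : WeakEvol H ρ u) (hρ : Continuous ρ)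
    (hH : ∀ x y, inner ℂ (H x) y = inner ℂ x (H y)) (hg : ∀ t, t ∈ goodTimes H u) (t : ℝ) :
    ‖H (u t)‖ = ‖H (u 0)‖ := by
  rcases le_total 0 t with ht | ht
  · simpa using hu.norm_eq_of_good hρ hH ht (fun s _ => hg s) 1
  · simpa using (hu.norm_eq_of_good hρ hH ht (fun s _ => hg s) 1).symm

/-- A quantity dominated by the virial form is integrable in time up to the energy. -/
theorem WeakEvol.integral_le (hu : WeakEvol H ρ u) (hρ : Continuous ρ) (hρ0 : ∀ t, 0 ≤ ρ t)
    (hH : ∀ x y, inner ℂ (H x) y = inner ℂ x (H y)) {A : E →ₗ[ℂ] E}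
    (hA : ∀ x y, inner ℂ (A x) y = -inner ℂ x (A y)) {K : ℝ} (hK0 : 0 ≤ K)
    (hK : ∀ x, ‖A x‖ ≤ K * ‖H x‖) (hg : ∀ t, t ∈ goodTimes H u) {W : ℝ → ℝ} {C : ℝ} (hC : 0 ≤ C)
    (hW : ∀ t, W t ≤ C * (inner ℂ (H (H (u t))) (A (u t))).re) :
    ∫ t, ρ t * W t ≤ 2 * C * K * ‖H (u 0)‖ ^ 2 := by
  by_cases hi : Integrable fun t => ρ t * W t
  swap
  · rw [integral_undef hi]
    positivity
  set V : ℝ → ℝ := fun s => (inner ℂ (-Complex.I • H (u s)) (A (u s))).re with hV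
  have hVb (t : ℝ) : |V t| ≤ K * ‖H (u 0)‖ ^ 2 := by
    have h1 : |V t| ≤ ‖inner ℂ (-Complex.I • H (u t)) (A (u t))‖ := Complex.abs_re_le_norm _
    have h2 := norm_inner_le_norm (𝕜 := ℂ) (-Complex.I • H (u t)) (A (u t))
    rw [norm_smul, norm_neg, Complex.norm_I, one_mul] at h2
    have h3 := mul_le_mul_of_nonneg_left (hK (u t)) (norm_nonneg (H (u t)))
    rw [hu.norm_apply_eq hρ hH hg t] at h2 h3
    nlinarith
  have hVd (t : ℝ) := hu.hasDerivAt_virial hρ hH hA hK (hg t)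
  refine le_of_tendsto (intervalIntegral_tendsto_integral hi Filter.tendsto_neg_atTop_atBot
    Filter.tendsto_id) (Filter.eventually_atTop.2 ⟨0, fun T hT => ?_⟩)
  have hTT : -T ≤ T := by linarith
  have hgd (t : ℝ) := (hVd t).const_mul (-C)
  have key := intervalIntegral.integral_le_sub_of_hasDeriv_right_of_le hTT
    (g := fun t => -C * V t) (φ := fun t => ρ t * W t)
    (fun t _ => (hgd t).continuousAt.continuousWithinAt)
    (fun t _ => (hgd t).hasDerivWithinAt) hi.integrableOn (fun t _ => by
      have := mul_le_mul_of_nonneg_left (hW t) (hρ0 t)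
      linarith)
  refine key.trans ?_
  have h1 := mul_le_mul_of_nonneg_left ((neg_abs_le (V T)).trans' (neg_le_neg (hVb T))) hC
  have h2 := mul_le_mul_of_nonneg_left ((le_abs_self (V (-T))).trans (hVb (-T))) hC
  linarith

end Evolution

section JointSmooth

variable {F : Type*} [NormedAddCommGroup F] [NormedSpace ℝ F] {M : Set (Eu 3)}
  {w : ℝ → Eu 3 → F}

theorem contDiffOn_slice (hw : ContDiffOn ℝ (⊤ : ℕ∞) (fun p : ℝ × Eu 3 => w p.1 p.2) (univ ×ˢ M))
    (t : ℝ) : ContDiffOn ℝ (⊤ : ℕ∞) (w t) M :=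
  hw.comp (f := fun x => (t, x)) (contDiff_prodMk_right t).contDiffOn fun _ hx => ⟨mem_univ _, hx⟩

theorem contDiff_slice_time
    (hw : ContDiffOn ℝ (⊤ : ℕ∞) (fun p : ℝ × Eu 3 => w p.1 p.2) (univ ×ˢ M)) {x : Eu 3}
    (hx : x ∈ M) : ContDiff ℝ (⊤ : ℕ∞) fun t => w t x :=
  contDiffOn_univ.1 (hw.comp (f := fun t => (t, x)) (contDiff_prodMk_left x).contDiffOn
    fun _ _ => ⟨mem_univ _, hx⟩)

theorem contDiffOn_pd_slice (hM : IsOpen M)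
    (hw : ContDiffOn ℝ (⊤ : ℕ∞) (fun p : ℝ × Eu 3 => w p.1 p.2) (univ ×ˢ M)) (j : Fin 3) :
    ContDiffOn ℝ (⊤ : ℕ∞) (fun p : ℝ × Eu 3 => pd j (w p.1) p.2) (univ ×ˢ M) := by
  have ho : IsOpen ((univ : Set ℝ) ×ˢ M) := isOpen_univ.prod hM
  refine ((hw.fderiv_of_isOpen ho (by simp)).clm_apply
    (contDiffOn_const (c := ((0 : ℝ), (EuclideanSpace.single j 1 : Eu 3))))).congr fun p hp => ?_
  have h1 := HasFDerivAt.comp (g := fun q : ℝ × Eu 3 => w q.1 q.2) (f := fun x => (p.1, x)) p.2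
    (show HasFDerivAt _ _ (p.1, p.2) from (hw.diffAt ho hp).hasFDerivAt)
    (hasFDerivAt_prodMk_right p.1 p.2)
  change fderiv ℝ (w p.1) p.2 _ = _
  rw [show w p.1 = (fun q : ℝ × Eu 3 => w q.1 q.2) ∘ fun x => (p.1, x) from rfl, h1.fderiv]
  simp

theorem contDiffOn_Hop_slice {A : Fin 3 → Eu 3 → Fin 4 → Fin 4 → ℂ}
    {B : Eu 3 → Fin 4 → Fin 4 → ℂ} {w : ℝ → Eu 3 → Fin 4 → ℂ} (hM : IsOpen M)
    (hA : ∀ j i k, ContDiffOn ℝ (⊤ : ℕ∞) (fun x => A j x i k) M)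
    (hB : ∀ i k, ContDiffOn ℝ (⊤ : ℕ∞) (fun x => B x i k) M)
    (hw : ContDiffOn ℝ (⊤ : ℕ∞) (fun p : ℝ × Eu 3 => w p.1 p.2) (univ ×ˢ M)) :
    ContDiffOn ℝ (⊤ : ℕ∞) (fun p : ℝ × Eu 3 => Hop A B (w p.1) p.2) (univ ×ˢ M) := by
  have hs {φ : Eu 3 → ℂ} (hφ : ContDiffOn ℝ (⊤ : ℕ∞) φ M) :
      ContDiffOn ℝ (⊤ : ℕ∞) (fun p : ℝ × Eu 3 => φ p.2) (univ ×ˢ M) :=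
    hφ.comp contDiffOn_snd fun _ hp => hp.2
  refine contDiffOn_pi.2 fun i => ContDiffOn.add (ContDiffOn.sum fun j _ => ContDiffOn.sum
    fun k _ => ?_) (ContDiffOn.sum fun k _ => ?_)
  · exact (hs (hA j i k)).mul (contDiffOn_pi.1 (contDiffOn_pd_slice hM hw j) k)
  · exact (hs (hB i k)).mul (contDiffOn_pi.1 hw k)

/-- The times at which `w` vanishes off a compact subset of `M` form a closed set. -/
theorem isClosed_vanish (hw : ContDiffOn ℝ (⊤ : ℕ∞) (fun p : ℝ × Eu 3 => w p.1 p.2) (univ ×ˢ M))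
    (h0 : ∀ t, ∀ x ∉ M, w t x = 0) (K : Set (Eu 3)) : IsClosed {t | ∀ x ∉ K, w t x = 0} := by
  have h1 : {t | ∀ x ∉ K, w t x = 0} = ⋂ x ∈ M \ K, {t | w t x = 0} := by
    ext t
    simp only [mem_ofPred_eq, mem_iInter, mem_sdiff]
    refine ⟨fun h x hx => h x hx.2, fun h x hx => ?_⟩
    by_cases hM : x ∈ M
    · exact h x ⟨hM, hx⟩
    · exact h0 t x hM
  rw [h1]
  exact isClosed_biInter fun x hx =>
    isClosed_eq (contDiff_slice_time hw hx.1).continuous continuous_const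

end JointSmooth

theorem Hop_zero_off {A : Fin 3 → Eu 3 → Fin 4 → Fin 4 → ℂ} {B : Eu 3 → Fin 4 → Fin 4 → ℂ}
    {f : Eu 3 → Fin 4 → ℂ} {K : Set (Eu 3)} (hK : IsClosed K) (h0 : ∀ x ∉ K, f x = 0) :
    ∀ x ∉ K, Hop A B f x = 0 := fun x hx => by
  rw [Hop_congr (g := fun _ => 0) hK.isOpen_compl (fun y hy => h0 y hy) hx]
  funext i
  simp [Hop]

/-- An open subset of `ℝ³` is exhausted by countably many compact subsets. -/
theorem exists_compact_exhaustion {M : Set (Eu 3)} (hM : IsOpen M) :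
    ∃ K : ℕ → Set (Eu 3), (∀ N, IsCompact (K N)) ∧ (∀ N, K N ⊆ M) ∧
      ∀ L ⊆ M, IsCompact L → ∃ N, L ⊆ K N := by
  have : LocallyCompactSpace M := hM.locallyCompactSpace
  let e : CompactExhaustion M := default
  refine ⟨fun N => Subtype.val '' e N, fun N => (e.isCompact N).image continuous_subtype_val,
    fun N => Subtype.coe_image_subset _ _, fun L hL hc => ?_⟩
  have hc' : IsCompact (Subtype.val ⁻¹' L : Set M) := by
    rw [Subtype.isCompact_iff, Subtype.image_preimage_coe, inter_eq_right.2 hL]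
    exact hc
  obtain ⟨N, hN⟩ := e.exists_superset_of_isCompact hc'
  exact ⟨N, fun x hx => ⟨⟨x, hL hx⟩, hN hx, rfl⟩⟩

/-- A smooth spatially compactly supported solution of `i φ ∂ₜ u = H u`. -/
structure DiracSol (Ω : Set (Eu 2)) (A : Fin 3 → Eu 3 → Fin 4 → Fin 4 → ℂ)
    (B : Eu 3 → Fin 4 → Fin 4 → ℂ) (φ : ℝ → ℝ) (u : ℝ → Eu 3 → Fin 4 → ℂ) : Prop where
  smooth : ContDiffOn ℝ (⊤ : ℕ∞) (fun p : ℝ × Eu 3 => u p.1 p.2) (univ ×ˢ Mset Ω)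
  supp : ∀ t, HasCompactSupport (u t) ∧ tsupport (u t) ⊆ Mset Ω
  eq : ∀ t : ℝ, ∀ x ∈ Mset Ω, ∀ c : Fin 4,
    Complex.I * ((φ t : ℝ) : ℂ) * deriv (fun s => u s x c) t = Hop A B (u t) x c

namespace DiracSol

variable {Ω : Set (Eu 2)} {β : Eu 2 → Matrix (Fin 2) (Fin 2) ℝ} {n m : ℝ}
  {h : Eu 3 → Matrix (Fin 3) (Fin 3) ℝ}
  {A : Fin 3 → Eu 3 → Fin 4 → Fin 4 → ℂ} {B : Eu 3 → Fin 4 → Fin 4 → ℂ}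
  {φ : ℝ → ℝ} {u : ℝ → Eu 3 → Fin 4 → ℂ}

theorem testFun (S : DiracSol Ω A B φ u) (hM : IsOpen (Mset Ω)) (t : ℝ) :
    TestFun (Mset Ω) (u t) :=
  .of_zero_off hM (S.supp t).1 (S.supp t).2 (contDiffOn_slice S.smooth t)
    fun _ hx => image_eq_zero_of_notMem_tsupport hx

theorem hasDerivAt_apply (S : DiracSol Ω A B φ u) (hφ : ∀ t, 0 < φ t) {x : Eu 3}
    (hx : x ∈ Mset Ω) (c : Fin 4) (t : ℝ) :
    HasDerivAt (fun s => u s x c) (-Complex.I * (((φ t)⁻¹ : ℝ) : ℂ) * Hop A B (u t) x c) t := by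
  have hd : DifferentiableAt ℝ (fun s => u s x c) t :=
    (contDiff_pi.1 (contDiff_slice_time S.smooth hx) c).contDiffAt.differentiableAt (by simp)
  refine hd.hasDerivAt.congr_deriv ?_
  rw [← S.eq t x hx c]
  have : ((φ t : ℝ) : ℂ) ≠ 0 := Complex.ofReal_ne_zero.2 (hφ t).ne'
  push_cast
  field_simp
  rw [Complex.I_sq]
  ring

/-- The weak form of the evolution equation. -/
theorem hasDerivAt_innM (S : DiracSol Ω A B φ u) (G : PowerWrap Ω β n h) (D : DiracOp Ω h m A B)
    (hφc : Continuous φ) (hφ : ∀ t, 0 < φ t) {v : Eu 3 → Fin 4 → ℂ} (hv : TestFun (Mset Ω) v)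
    (t : ℝ) : HasDerivAt (fun s => innM Ω h v (u s))
      (-Complex.I * (((φ t)⁻¹ : ℝ) : ℂ) * innM Ω h v (Hop A B (u t))) t := by
  have hHs := contDiffOn_Hop_slice G.isOpenM D.smooth_fst D.smooth_zero S.smooth
  set F' : ℝ → Eu 3 → ℂ := fun s x => -Complex.I * (((φ s)⁻¹ : ℝ) : ℂ) *
    ((∑ i, (starRingEnd ℂ) (v x i) * Hop A B (u s) x i) * ((sdet h x : ℝ) : ℂ)) with hF'
  have hc : ContinuousOn (fun p : ℝ × Eu 3 => F' p.1 p.2) (univ ×ˢ Mset Ω) := by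
    refine ContinuousOn.mul (continuousOn_const.mul (Complex.continuous_ofReal.comp_continuousOn
      ((hφc.comp continuous_fst).inv₀ fun p => (hφ p.1).ne').continuousOn))
      (ContinuousOn.mul (continuousOn_finsetSum _ fun i _ => ContinuousOn.mul ?_ ?_) ?_)
    · exact (Complex.continuous_conj.comp ((continuous_apply i).comp
        (hv.smooth.continuous.comp continuous_snd))).continuousOn
    · exact continuousOn_pi.1 hHs.continuousOn i
    · exact Complex.continuous_ofReal.comp_continuousOn
        (G.contDiffOn_sdet.continuousOn.comp continuousOn_snd fun p hp => hp.2)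
  obtain ⟨b, hb⟩ := ((isCompact_Icc (a := t - 1) (b := t + 1)).prod
    hv.compact.isCompact).exists_bound_of_continuousOn
    (hc.mono (prod_mono (subset_univ _) hv.subset))
  have h0 : ∀ s, ∀ x ∉ tsupport v, F' s x = 0 := fun s x hx => by simp [hF', hv.zero_off hx]
  have hbi : Integrable ((tsupport v).indicator fun _ => b) (volume.restrict (Mset Ω)) :=
    ((integrable_indicator_iff hv.compact.isCompact.measurableSet).2
      (integrableOn_const (C := b) hv.compact.isCompact.measure_lt_top.ne)).restrict
  have key := hasDerivAt_integral_of_dominated_loc_of_deriv_le (μ := volume.restrict (Mset Ω))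
    (F := fun s x => (∑ i, (starRingEnd ℂ) (v x i) * u s x i) * ((sdet h x : ℝ) : ℂ))
    (F' := F') (x₀ := t) (bound := (tsupport v).indicator fun _ => b)
    (Metric.ball_mem_nhds t one_pos)
    (Filter.Eventually.of_forall fun s =>
      (G.integrable_inn hv (S.testFun G.isOpenM s).contDiffOn).aestronglyMeasurable)
    (G.integrable_inn hv (S.testFun G.isOpenM t).contDiffOn)
    ((hc.comp (f := fun x => (t, x)) (Continuous.prodMk_right t).continuousOn
      fun x hx => ⟨mem_univ _, hx⟩).aestronglyMeasurable G.isOpenM.measurableSet)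
    (Filter.Eventually.of_forall fun x s hs => by
      by_cases hx : x ∈ tsupport v
      · rw [indicator_of_mem hx]
        refine hb (s, x) ⟨?_, hx⟩
        rw [Metric.mem_ball, Real.dist_eq, abs_lt] at hs
        exact ⟨by linarith, by linarith⟩
      · rw [indicator_of_notMem hx, h0 s x hx, norm_zero])
    hbi
    ((ae_restrict_iff' G.isOpenM.measurableSet).2 (Filter.Eventually.of_forall fun x hx s _ => by
      have := (HasDerivAt.fun_sum fun i (_ : i ∈ Finset.univ) =>
        (S.hasDerivAt_apply hφ hx i s).const_mul ((starRingEnd ℂ) (v x i))).mul_const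
          ((sdet h x : ℝ) : ℂ)
      refine this.congr_deriv ?_
      rw [hF']
      simp only [Finset.mul_sum, Finset.sum_mul]
      refine Finset.sum_congr rfl fun i _ => ?_
      ring))
  refine key.2.congr_deriv ?_
  rw [innM, ← integral_const_mul]

theorem contDiffOn_iterate (S : DiracSol Ω A B φ u) (hM : IsOpen (Mset Ω))
    (D : DiracOp Ω h m A B) (k : ℕ) :
    ContDiffOn ℝ (⊤ : ℕ∞) (fun p : ℝ × Eu 3 => (Hop A B)^[k] (u p.1) p.2) (univ ×ˢ Mset Ω) := by
  induction k with
  | zero => exact S.smooth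
  | succ k ih =>
    refine (contDiffOn_Hop_slice (w := fun t => (Hop A B)^[k] (u t)) hM D.smooth_fst
      D.smooth_zero ih).congr fun p _ => ?_
    rw [Function.iterate_succ_apply']

theorem iterate_zero_off {K : Set (Eu 3)} (hK : IsClosed K) {f : Eu 3 → Fin 4 → ℂ}
    (h0 : ∀ x ∉ K, f x = 0) (k : ℕ) : ∀ x ∉ K, (Hop A B)^[k] f x = 0 := by
  induction k with
  | zero => exact h0
  | succ k ih =>
    rw [Function.iterate_succ_apply']
    exact Hop_zero_off hK ih

theorem exists_bound (S : DiracSol Ω A B φ u) (G : PowerWrap Ω β n h) (D : DiracOp Ω h m A B)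
    {K : Set (Eu 3)} (hK : IsCompact K) (hKM : K ⊆ Mset Ω) (k : ℕ) (T : ℝ) :
    ∃ b, ∀ t, (∀ x ∉ K, u t x = 0) → |t| ≤ T →
      (innM Ω h ((Hop A B)^[k] (u t)) ((Hop A B)^[k] (u t))).re ≤ b := by
  have hs := S.contDiffOn_iterate G.isOpenM D k
  have hc : ContinuousOn (fun p : ℝ × Eu 3 =>
      (∑ c, ‖(Hop A B)^[k] (u p.1) p.2 c‖ ^ 2) * sdet h p.2) (univ ×ˢ Mset Ω) :=
    (continuousOn_finsetSum _ fun c _ => ((continuousOn_pi.1 hs.continuousOn c).norm.pow 2)).mul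
      (G.contDiffOn_sdet.continuousOn.comp continuousOn_snd fun p hp => hp.2)
  obtain ⟨b, hb⟩ := ((isCompact_Icc (a := -T) (b := T)).prod hK).exists_bound_of_continuousOn
    (hc.mono (prod_mono (subset_univ _) hKM))
  refine ⟨b * volume.real K, fun t ht htT => ?_⟩
  have hz := iterate_zero_off (A := A) (B := B) hK.isClosed ht k
  have hT : TestFun (Mset Ω) ((Hop A B)^[k] (u t)) :=
    .of_zero_off G.isOpenM hK hKM (contDiffOn_slice (w := fun t => (Hop A B)^[k] (u t)) hs t) hz
  rw [G.re_innM_self hT, setIntegral_eq_of_subset_of_forall_sdiff_eq_zero G.isOpenM.measurableSet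
    hKM fun x hx => by simp [hz x hx.2]]
  refine (le_abs_self _).trans (norm_setIntegral_le_of_norm_le_const hK.measure_lt_top
    fun x hx => hb (t, x) ⟨abs_le.1 htT, hx⟩)

end DiracSol

/-- The local smoothing estimate with an explicit constant. -/
theorem DiracSol.smoothing {Ω : Set (Eu 2)} {β : Eu 2 → Matrix (Fin 2) (Fin 2) ℝ} {n m : ℝ}
    {h : Eu 3 → Matrix (Fin 3) (Fin 3) ℝ} {A : Fin 3 → Eu 3 → Fin 4 → Fin 4 → ℂ}
    {B : Eu 3 → Fin 4 → Fin 4 → ℂ} {φ : ℝ → ℝ} {u : ℝ → Eu 3 → Fin 4 → ℂ} {ε η₁ η₂ : ℝ}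
    (S : DiracSol Ω A B φ u) (G : PowerWrap Ω β n h) (D : DiracOp Ω h m A B)
    (hφc : Continuous φ) (hφ : ∀ t, 0 < φ t) (hn : 1 / 2 ≤ n) (hn' : n ≤ 4 / 3)
    (hβ : ∀ y ∈ Ω, 400000 ≤ Rscal β y) (hε : 0 < ε) (hε1 : ε ≤ 1) (h₁ : ε ≤ 2 * η₁)
    (h₂ : ε ≤ 2 * η₂) :
    (∫ t : ℝ, (φ t)⁻¹ * ∫ x in Mset Ω,
        ((1 + (x 0) ^ 2) ^ (-(3 / 2 + η₁)) * (∑ c, ‖u t x c‖ ^ 2)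
          + (1 + (x 0) ^ 2) ^ (-(1 / 2 + η₂)) * gradhSq h (u t) x) * sdet h x)
      ≤ 2 * (1000 * ((2 : ℝ) ^ (1 / 2 + η₁) + (2 : ℝ) ^ (1 / 2 + η₂))) * √(300 / ε ^ 2) *
        ∫ x in Mset Ω, (∑ c, ‖Hop A B (u 0) x c‖ ^ 2) * sdet h x := by
  let _ : SeminormedAddCommGroup (testSpace Ω) :=
    InnerProductSpace.Core.toSeminormedAddCommGroup (c := G.innCore)
  let _ : InnerProductSpace ℂ (testSpace Ω) := InnerProductSpace.ofCore G.innCore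
  have P := profile_prof hε
  set H : testSpace Ω →ₗ[ℂ] testSpace Ω := G.hopL D with hHdef
  set R : testSpace Ω →ₗ[ℂ] testSpace Ω := G.radL P with hRdef
  set U : ℝ → testSpace Ω := fun t => ⟨u t, S.testFun G.isOpenM t⟩ with hU
  have hsq (f : testSpace Ω) : ‖f‖ ^ 2 = (innM Ω h f f).re := (inner_self_eq_norm_sq (𝕜 := ℂ) f).symm
  have hρ : Continuous fun t => (φ t)⁻¹ := hφc.inv₀ fun t => (hφ t).ne'
  have hE : WeakEvol H (fun t => (φ t)⁻¹) U := fun v t => S.hasDerivAt_innM G D hφc hφ v.2 t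
  have hH (f g : testSpace Ω) : inner ℂ (H f) g = inner ℂ f (H g) := D.symm f g f.2 g.2
  have hR (f g : testSpace Ω) : inner ℂ (R f) g = -inner ℂ f (R g) := G.innM_radMult P f.2 g.2
  have hK (f : testSpace Ω) : ‖R f‖ ≤ √(300 / ε ^ 2) * ‖H f‖ := by
    refine le_of_sq_le_sq ?_ (by positivity)
    rw [mul_pow, Real.sq_sqrt (by positivity), hsq, hsq]
    exact G.innM_radMult_le D hn hn' hβ P (profileBounds_prof hε hε1) f.2
  have hpow (k : ℕ) (f : testSpace Ω) :
      (((H ^ k) f : testSpace Ω) : Eu 3 → Fin 4 → ℂ) = (Hop A B)^[k] f := by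
    induction k with
    | zero => rfl
    | succ k ih =>
      rw [Function.iterate_succ_apply', ← ih, pow_succ', Module.End.mul_apply]
      rfl
  obtain ⟨K, hKc, hKM, hKe⟩ := exists_compact_exhaustion G.isOpenM
  have hg (t : ℝ) : t ∈ goodTimes H U := by
    refine hE.mem_goodTimes hρ hH (S := fun N => {t | ∀ x ∉ K N, u t x = 0})
      (fun N => isClosed_vanish S.smooth (fun t x hx => ?_) (K N)) (fun t => ?_)
      (fun N k T => ?_) t
    · exact image_eq_zero_of_notMem_tsupport fun hx' => hx ((S.supp t).2 hx')
    · obtain ⟨N, hN⟩ := hKe _ (S.supp t).2 (S.supp t).1.isCompact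
      exact ⟨N, fun x hx => image_eq_zero_of_notMem_tsupport fun hx' => hx (hN hx')⟩
    · obtain ⟨b, hb⟩ := S.exists_bound G D (hKc N) (hKM N) k T
      refine ⟨√b, fun t ht hT => Real.le_sqrt_of_sq_le ?_⟩
      rw [hsq, hpow]
      exact hb t ht hT
  have key := hE.integral_le hρ (fun t => (inv_pos.2 (hφ t)).le) hH hR (Real.sqrt_nonneg _) hK hg
    (by positivity) fun t =>
      G.weighted_le_innM D hn hn' hβ (S.testFun G.isOpenM t) hε hε1 h₁ h₂
  rw [hsq] at key
  exact key.trans_eq (congrArg _ (G.re_innM_self (H (U 0)).2))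

/-- **Local smoothing for the Dirac equation on sub-flat wrapped products**
(`d(r) = rⁿ`, `n ∈ (2−√2, 4/3]`, `R_β ≥ C_n`). -/
theorem stmt4 (n : ℝ) (hn₁ : 2 - Real.sqrt 2 < n) (hn₂ : n ≤ 4 / 3) :
    ∃ Cn > (0 : ℝ),
    ∀ η₁ : ℝ, 0 < η₁ → ∀ η₂ : ℝ, 0 < η₂ → ∃ C > (0 : ℝ),
      ∀ Ω : Set (Eu 2), IsOpen Ω →
      ∀ β : Eu 2 → Matrix (Fin 2) (Fin 2) ℝ,
        (∀ i j : Fin 2, ContDiffOn ℝ (⊤ : ℕ∞) (fun y => β y i j) Ω) →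
        (∀ y ∈ Ω, (β y).IsSymm) → (∀ y ∈ Ω, (β y).PosDef) →
        (∀ y ∈ Ω, Cn ≤ Rscal β y) →
      ∀ h : Eu 3 → Matrix (Fin 3) (Fin 3) ℝ,
        (∀ x, (h x).IsSymm) → (∀ x, (h x).PosDef) →
        WrapMetric Ω β (fun r => r ^ n) h →
      ∀ m : ℝ, 0 ≤ m →
      ∀ φ : ℝ → ℝ, ContDiff ℝ (⊤ : ℕ∞) φ → (∀ t, 0 < φ t) →
      ∀ (A : Fin 3 → Eu 3 → Fin 4 → Fin 4 → ℂ) (B : Eu 3 → Fin 4 → Fin 4 → ℂ),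
        (∀ j i k, ContDiffOn ℝ (⊤ : ℕ∞) (fun x => A j x i k) (Mset Ω)) →
        (∀ i k, ContDiffOn ℝ (⊤ : ℕ∞) (fun x => B x i k) (Mset Ω)) →
        (∀ f g : Eu 3 → Fin 4 → ℂ, ContDiff ℝ (⊤ : ℕ∞) f → ContDiff ℝ (⊤ : ℕ∞) g →
          HasCompactSupport f → HasCompactSupport g →
          tsupport f ⊆ Mset Ω → tsupport g ⊆ Mset Ω →
          innM Ω h (Hop A B f) g = innM Ω h f (Hop A B g)) →
        (∀ f : Eu 3 → Fin 4 → ℂ, ContDiff ℝ (⊤ : ℕ∞) f → ∀ x ∈ Mset Ω, ∀ i : Fin 4,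
          Hop A B (Hop A B f) x i
            = ((m : ℂ) ^ 2) * f x i - lapC h (fun y => f y i) x
              + ((Rscal h x / 4 : ℝ) : ℂ) * f x i) →
      ∀ (u : ℝ → Eu 3 → Fin 4 → ℂ) (u₀ : Eu 3 → Fin 4 → ℂ),
        ContDiffOn ℝ (⊤ : ℕ∞) (fun p : ℝ × Eu 3 => u p.1 p.2)
          ((Set.univ : Set ℝ) ×ˢ Mset Ω) →
        (∀ t, HasCompactSupport (u t) ∧ tsupport (u t) ⊆ Mset Ω) →
        (∀ t : ℝ, ∀ x ∈ Mset Ω, ∀ c : Fin 4,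
          Complex.I * ((φ t : ℝ) : ℂ) * deriv (fun s => u s x c) t = Hop A B (u t) x c) →
        (∀ x ∈ Mset Ω, u 0 x = u₀ x) →
        (∫ t : ℝ, (φ t)⁻¹ *
            ∫ x in Mset Ω,
              ((1 + (x 0) ^ 2) ^ (-(3 / 2 + η₁)) * (∑ c, ‖u t x c‖ ^ 2)
                + (1 + (x 0) ^ 2) ^ (-(1 / 2 + η₂)) * gradhSq h (u t) x) * sdet h x)
          ≤ C * ∫ x in Mset Ω, (∑ c, ‖Hop A B u₀ x c‖ ^ 2) * sdet h x := by
  have hs : √2 < 3 / 2 := (Real.sqrt_lt' (by norm_num)).2 (by norm_num)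
  have hn : 1 / 2 ≤ n := by linarith
  refine ⟨400000, by norm_num, fun η₁ hη₁ η₂ hη₂ => ?_⟩
  set ε : ℝ := min 1 (min (2 * η₁) (2 * η₂)) with hεdef
  have hε : 0 < ε := by positivity
  have hε1 : ε ≤ 1 := min_le_left _ _
  have h₁ : ε ≤ 2 * η₁ := (min_le_right _ _).trans (min_le_left _ _)
  have h₂ : ε ≤ 2 * η₂ := (min_le_right _ _).trans (min_le_right _ _)
  refine ⟨2 * (1000 * ((2 : ℝ) ^ (1 / 2 + η₁) + (2 : ℝ) ^ (1 / 2 + η₂))) * √(300 / ε ^ 2),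
    by positivity, ?_⟩
  intro Ω hΩ β hβs hβsymm hβpos hβR h _ _ hW m _ φ hφs hφ A B hA hB hsymm hsq u u₀ hu hsupp heq hu₀
  have G : PowerWrap Ω β n h := ⟨hΩ, hβs, hβsymm, hβpos, hW⟩
  have D : DiracOp Ω h m A B := ⟨hA, hB, fun f g hf hg =>
    hsymm f g hf.smooth hg.smooth hf.compact hg.compact hf.subset hg.subset, hsq⟩
  have S : DiracSol Ω A B φ u := ⟨hu, hsupp, heq⟩
  refine (S.smoothing G D hφs.continuous hφ hn hn₂ hβR hε hε1 h₁ h₂).trans_eq (congrArg _ ?_)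
  refine setIntegral_congr_fun G.isOpenM.measurableSet fun x hx => ?_
  simp only [Hop_congr (A := A) (B := B) G.isOpenM hu₀ hx]
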